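/- Let n ≥ 4, let m be an integer with 4 ≤ m ≤ n, and let S be a set of four distinct vertices of the godan graph EA_n such that for some i ∈ {1,…,n} exactly three vertices of S have m-th symbol equal to i (i.e., |S ∩ V(EA_n^{m:i})| = 3). Then there exist n − 1 pairwise internally edge disjoint S-trees in EA_n. -/

import Mathlib

namespace Godan

/-- The transposition (12), using 0-based indices 0,1 for symbols 1,2. -/
def perm12 (n : ℕ) (hn : 3 ≤ n) : Equiv.Perm (Fin n) :=
  Equiv.swap ⟨0, by omega⟩ ⟨1, by omega⟩

/-- The 3-cycle (123): symbol 1 ↦ 2 ↦ 3 ↦ 1, i.e. index 0 ↦ 1 ↦ 2 ↦ 0. -/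
def perm123 (n : ℕ) (hn : 3 ≤ n) : Equiv.Perm (Fin n) :=
  Equiv.swap ⟨0, by omega⟩ ⟨2, by omega⟩ * Equiv.swap ⟨0, by omega⟩ ⟨1, by omega⟩

/-- The 3-cycle (132): symbol 1 ↦ 3 ↦ 2 ↦ 1, i.e. index 0 ↦ 2 ↦ 1 ↦ 0. -/
def perm132 (n : ℕ) (hn : 3 ≤ n) : Equiv.Perm (Fin n) :=
  Equiv.swap ⟨0, by omega⟩ ⟨1, by omega⟩ * Equiv.swap ⟨0, by omega⟩ ⟨2, by omega⟩

/-- Ω* = {(12), (123), (132)} ∪ {(12)(3i) : 4 ≤ i ≤ n}; symbol i has index i - 1,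
so the transposition (3i) is `Equiv.swap ⟨2,_⟩ k` with 3 ≤ k = i - 1 ≤ n - 1. -/
def OmegaStar (n : ℕ) (hn : 3 ≤ n) : Set (Equiv.Perm (Fin n)) :=
  {perm12 n hn, perm123 n hn, perm132 n hn} ∪
    {s | ∃ k : Fin n, 3 ≤ (k : ℕ) ∧ s = perm12 n hn * Equiv.swap ⟨2, by omega⟩ k}

/-- The godan graph EA_n: vertices are the permutations of {1,…,n}, and u,v are
adjacent iff u = v ∘ s for some s ∈ Ω* (note `(v * s) i = v (s i)` in Mathlib).
Since Ω* is closed under inverses, `fromRel` yields exactly this adjacency. -/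
def godanGraph (n : ℕ) (hn : 3 ≤ n) : SimpleGraph (Equiv.Perm (Fin n)) :=
  SimpleGraph.fromRel (fun u v => ∃ s ∈ OmegaStar n hn, u = v * s)

/-- `T 0, …, T (r-1)` is a family of r pairwise internally edge disjoint S-trees:
each `T i` is a subgraph of `G` which is a tree containing all vertices of `S`,
and for i ≠ j, `V(T i) ∩ V(T j) = S` and `E(T i) ∩ E(T j) = ∅`. -/
def IsIDSTFamily {V : Type*} (G : SimpleGraph V) (S : Set V) {r : ℕ}
    (T : Fin r → G.Subgraph) : Prop :=
  (∀ i, S ⊆ (T i).verts ∧ ((T i).coe).IsTree) ∧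
    ∀ i j, i ≠ j → (T i).verts ∩ (T j).verts = S ∧ (T i).edgeSet ∩ (T j).edgeSet = ∅

/-- The maximum number of pairwise internally edge disjoint S-trees in G. -/
noncomputable def maxIDST {V : Type*} (G : SimpleGraph V) (S : Set V) : ℕ :=
  sSup {r : ℕ | ∃ T : Fin r → G.Subgraph, IsIDSTFamily G S T}

/-- The generalized k-connectivity κ_k(G): the minimum over all k-element vertex
sets S of the maximum number of pairwise internally edge disjoint S-trees. -/
noncomputable def genConn {V : Type*} [Fintype V] (G : SimpleGraph V) (k : ℕ) : ℕ :=
  sInf {m : ℕ | ∃ S : Finset V, S.card = k ∧ maxIDST G (↑S : Set V) = m}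

open Equiv

variable {V : Type*}

/-- `v` can be reached from `u` by a path of `G` inside `A`. -/
def ReachIn (G : SimpleGraph V) (A : Set V) : V → V → Prop :=
  Relation.ReflTransGen fun a b => G.Adj a b ∧ a ∈ A ∧ b ∈ A

/-- The set `A` induces a (pre)connected subgraph of `G`. -/
def Conn (G : SimpleGraph V) (A : Set V) : Prop :=
  ∀ u ∈ A, ∀ v ∈ A, ReachIn G A u v

/-- The set `W` stays connected after deleting fewer than `k` vertices. -/
def KConn (G : SimpleGraph V) (W : Set V) (k : ℕ) : Prop :=
  ∀ X : Finset V, X.card < k → Conn G (W \ X)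

/-- The graph obtained from `G` by keeping, among the edges inside `S`, only those in `E`. -/
def restrictEdges (G : SimpleGraph V) (S : Set V) (E : Set (Sym2 V)) : SimpleGraph V where
  Adj u v := G.Adj u v ∧ (u ∈ S → v ∈ S → s(u, v) ∈ E)
  symm := ⟨fun u v h => ⟨h.1.symm, fun hv hu => by
    rw [Sym2.eq_swap]; exact h.2 hu hv⟩⟩
  loopless := ⟨fun u h => G.loopless.irrefl u h.1⟩

section Basics

variable {G H : SimpleGraph V} {A B : Set V} {u v w x y : V}

theorem ReachIn.refl (u : V) : ReachIn G A u u := Relation.ReflTransGen.refl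

theorem ReachIn.trans (h : ReachIn G A u v) (h' : ReachIn G A v w) : ReachIn G A u w :=
  Relation.ReflTransGen.trans h h'

theorem ReachIn.symm (h : ReachIn G A u v) : ReachIn G A v u := by
  induction h with
  | refl => exact ReachIn.refl _
  | tail _ h ih => exact Relation.ReflTransGen.head ⟨h.1.symm, h.2.2, h.2.1⟩ ih

theorem ReachIn.mono (hAB : A ⊆ B) (h : ReachIn G A u v) : ReachIn G B u v :=
  Relation.ReflTransGen.mono (fun _ _ h => ⟨h.1, hAB h.2.1, hAB h.2.2⟩) _ _ h

theorem ReachIn.of_adj (h : G.Adj u v) (hu : u ∈ A) (hv : v ∈ A) : ReachIn G A u v :=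
  Relation.ReflTransGen.single ⟨h, hu, hv⟩

theorem ReachIn.invariant {J : Set V} (h : ReachIn G A u v) (hu : u ∈ J)
    (hJ : ∀ a ∈ J, a ∈ A → ∀ b ∈ A, G.Adj a b → b ∈ J) : v ∈ J := by
  induction h with
  | refl => exact hu
  | tail _ h ih => exact hJ _ ih h.2.1 _ h.2.2 h.1

theorem Conn.of_hub (c : V) (h : ∀ u ∈ A, ReachIn G A u c) : Conn G A :=
  fun u hu v hv => (h u hu).trans (h v hv).symm

theorem conn_singleton (a : V) : Conn G {a} := Conn.of_hub a fun u hu => by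
  rw [Set.mem_singleton_iff.1 hu]; exact ReachIn.refl _

theorem Conn.union (hA : Conn G A) (hB : Conn G B) (hu : u ∈ A) (hv : v ∈ B)
    (h : G.Adj u v ∨ u = v) : Conn G (A ∪ B) := by
  have huv : ReachIn G (A ∪ B) v u := by
    rcases h with h | rfl
    · exact ReachIn.of_adj h.symm (Or.inr hv) (Or.inl hu)
    · exact ReachIn.refl _
  refine Conn.of_hub u fun x hx => ?_
  rcases hx with hx | hx
  · exact (hA x hx u hu).mono Set.subset_union_left
  · exact ((hB x hx v hv).mono Set.subset_union_right).trans huv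

theorem Conn.union_adj (hA : Conn G A) (hB : Conn G B) (hu : u ∈ A) (hv : v ∈ B)
    (h : G.Adj u v) : Conn G (A ∪ B) := hA.union hB hu hv (Or.inl h)

/-- Adding to a connected set vertices that are adjacent to it. -/
theorem Conn.union_of_adj (hA : Conn G A) (h : ∀ b ∈ B, ∃ a ∈ A, G.Adj b a) :
    Conn G (A ∪ B) := by
  intro u hu v hv
  have key : ∀ u ∈ A ∪ B, ∃ a ∈ A, ReachIn G (A ∪ B) u a := by
    rintro u (hu | hu)
    · exact ⟨u, hu, ReachIn.refl _⟩
    · obtain ⟨a, ha, hua⟩ := h u hu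
      exact ⟨a, ha, ReachIn.of_adj hua (Or.inr hu) (Or.inl ha)⟩
  obtain ⟨a, ha, hua⟩ := key u hu
  obtain ⟨b, hb, hvb⟩ := key v hv
  exact hua.trans (((hA a ha b hb).mono Set.subset_union_left).trans hvb.symm)

theorem Conn.union_of_adj_or_mem (hA : Conn G A) (h : ∀ b ∈ B, b ∈ A ∨ ∃ a ∈ A, G.Adj b a) :
    Conn G (A ∪ B) := by
  rw [← Set.union_sdiff_self]
  exact hA.union_of_adj fun b hb => (h b hb.1).resolve_left hb.2

theorem Conn.insert_adj (hA : Conn G A) (hv : v ∈ A) (h : G.Adj u v) : Conn G (insert u A) := by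
  rw [Set.insert_eq]
  exact (conn_singleton u).union_adj hA (Set.mem_singleton u) hv h

theorem ReachIn.mono_graph (hGH : ∀ a ∈ A, ∀ b ∈ A, G.Adj a b → H.Adj a b)
    (h : ReachIn G A u v) : ReachIn H A u v :=
  Relation.ReflTransGen.mono (fun _ _ h => ⟨hGH _ h.2.1 _ h.2.2 h.1, h.2⟩) _ _ h

theorem Conn.mono_graph (hGH : ∀ a ∈ A, ∀ b ∈ A, G.Adj a b → H.Adj a b)
    (h : Conn G A) : Conn H A :=
  fun u hu v hv => (h u hu v hv).mono_graph hGH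

/-- A set meeting `S` in at most one vertex does not notice the edge restriction. -/
theorem Conn.restrictEdges {S : Set V} {E : Set (Sym2 V)} (h : Conn G A)
    (hS : (A ∩ S).Subsingleton) : Conn (restrictEdges G S E) A :=
  h.mono_graph fun _ ha _ hb hab =>
    ⟨hab, fun haS hbS => (G.ne_of_adj hab (hS ⟨ha, haS⟩ ⟨hb, hbS⟩)).elim⟩

theorem KConn.mono {k l : ℕ} (h : KConn G A k) (hl : l ≤ k) : KConn G A l :=
  fun X hX => h X (hX.trans_le hl)

theorem KConn.conn {k : ℕ} (h : KConn G A k) (hk : 0 < k) : Conn G A := by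
  simpa using h ∅ (by simpa using hk)

end Basics

/-- Internally disjoint connected pieces covering `S` can be thinned to internally edge disjoint
`S`-trees. -/
theorem exists_isIDSTFamily {ι : Type*} [Fintype ι] {r : ℕ} (hr : Fintype.card ι = r)
    (G : SimpleGraph V) {S : Set V} (hS : S.Nonempty) (U : ι → Set V) (E : ι → Set (Sym2 V))
    (hU : ∀ i j, i ≠ j → Disjoint (U i) (U j))
    (hE : ∀ i j, i ≠ j → Disjoint (E i) (E j))
    (hc : ∀ i, Conn (restrictEdges G S (E i)) (U i ∪ S)) :
    ∃ T : Fin r → G.Subgraph, IsIDSTFamily G S T := by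
  have key : ∀ i, ∃ T : G.Subgraph, T.verts = U i ∪ S ∧ T.coe.IsTree ∧
      ∀ u ∈ S, ∀ v ∈ S, T.Adj u v → s(u, v) ∈ E i := by
    intro i
    have hcon : ((restrictEdges G S (E i)).induce (U i ∪ S)).Connected := by
      have : Nonempty ↑(U i ∪ S) := by
        obtain ⟨x, hx⟩ := hS
        exact ⟨⟨x, Or.inr hx⟩⟩
      refine SimpleGraph.Connected.mk ?_
      rintro ⟨u, hu⟩ ⟨v, hv⟩
      have h := hc i u hu v hv
      induction h with
      | refl => exact SimpleGraph.Reachable.refl _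
      | tail _ h ih =>
        exact (ih h.2.1).trans (SimpleGraph.Adj.reachable (by exact h.1))
    obtain ⟨T, hTle, hT⟩ := hcon.exists_isTree_le
    refine ⟨⟨U i ∪ S, fun a b => ∃ ha hb, T.Adj ⟨a, ha⟩ ⟨b, hb⟩, ?_, ?_, ?_⟩, rfl, ?_, ?_⟩
    · rintro a b ⟨ha, hb, h⟩
      exact (hTle h).1
    · rintro a b ⟨ha, hb, h⟩
      exact ha
    · exact ⟨fun a b ⟨ha, hb, h⟩ => ⟨hb, ha, h.symm⟩⟩
    · convert hT using 1
      ext a b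
      exact ⟨fun ⟨_, _, h⟩ => h, fun h => ⟨a.2, b.2, h⟩⟩
    · rintro u hu v hv ⟨ha, hb, h⟩
      exact (hTle h).2 hu hv
  choose T hT1 hT2 hT3 using key
  let e := (Fintype.equivFinOfCardEq hr).symm
  refine ⟨fun l => T (e l), fun l => ⟨by rw [hT1]; exact Set.subset_union_right, hT2 _⟩, ?_⟩
  intro i j hij
  have hij' : e i ≠ e j := fun h => hij (e.injective h)
  have hv : (T (e i)).verts ∩ (T (e j)).verts = S := by
    rw [hT1, hT1, ← Set.inter_union_distrib_right, (hU _ _ hij').inter_eq, Set.empty_union]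
  refine ⟨hv, ?_⟩
  rw [Set.eq_empty_iff_forall_notMem]
  rintro ⟨u, v⟩ ⟨h1, h2⟩
  have h1' : (T (e i)).Adj u v := h1
  have h2' : (T (e j)).Adj u v := h2
  have hu : u ∈ S := hv ▸ ⟨h1'.fst_mem, h2'.fst_mem⟩
  have hv : v ∈ S := hv ▸ ⟨h1'.snd_mem, h2'.snd_mem⟩
  exact Set.disjoint_left.1 (hE _ _ hij') (hT3 _ u hu v hv h1') (hT3 _ u hu v hv h2')

theorem exists_fan_of_separators [Fintype V] {G : SimpleGraph V} {W : Set V} {w : V}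
    (T : Finset V) (hTW : ↑T ⊆ W) (hwT : w ∉ T)
    (hsep : ∀ S : Finset V, S.card < T.card → w ∉ S → ∃ t ∈ T, t ∉ S ∧ ReachIn G (W \ S) t w) :
    ∃ F : V → Set V, (∀ t ∈ T, t ∈ F t ∧ Conn G (insert w (F t)) ∧ F t ⊆ W \ {w}) ∧
      ∀ t ∈ T, ∀ t' ∈ T, t ≠ t' → Disjoint (F t) (F t') := by
  classical
  let I := {v : V // v ∈ W ∧ v ≠ w ∧ ¬ G.Adj v w}
  let N : V → Finset V := fun v => Finset.univ.filter fun b => b ∈ W ∧ b ≠ w ∧ (b = v ∨ G.Adj v b)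
  have hall : ∀ J : Finset I, J.card ≤ (J.biUnion fun v => N v.1 \ T).card := by
    intro J
    by_contra! hlt
    let J' : Finset V := J.map ⟨Subtype.val, Subtype.val_injective⟩
    have hJ' : J'.card = J.card := Finset.card_map _
    let NJ : Finset V := J'.biUnion N
    have hbi : (J.biUnion fun v => N v.1 \ T) = NJ \ T := by
      ext b
      simp only [NJ, J', Finset.mem_biUnion, Finset.mem_sdiff, Finset.mem_map,
        Function.Embedding.coeFn_mk]
      constructor
      · rintro ⟨a, ha, hb, hT⟩
        exact ⟨⟨a, ⟨a, ha, rfl⟩, hb⟩, hT⟩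
      · rintro ⟨⟨_, ⟨a, ha, rfl⟩, hb⟩, hT⟩
        exact ⟨a, ha, hb, hT⟩
    have hmem : ∀ v ∈ J', v ∈ W ∧ v ≠ w ∧ ¬ G.Adj v w := by
      intro v hv
      obtain ⟨a, -, rfl⟩ := Finset.mem_map.1 hv
      exact a.2
    have hsub : J' ⊆ NJ := fun v hv => Finset.mem_biUnion.2 ⟨v, hv, Finset.mem_filter.2
      ⟨Finset.mem_univ _, (hmem v hv).1, (hmem v hv).2.1, Or.inl rfl⟩⟩
    have hwNJ : w ∉ NJ := by
      simp [NJ, N]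
    have hScard : ((NJ \ J') ∪ (T \ NJ)).card < T.card := by
      have h1 := Finset.card_union_le (NJ \ J') (T \ NJ)
      have h2 := Finset.card_sdiff_add_card_eq_card hsub
      have h3 := Finset.card_sdiff_add_card_inter T NJ
      have h4 := Finset.card_sdiff_add_card_inter NJ T
      rw [Finset.inter_comm] at h4
      rw [hbi] at hlt
      omega
    obtain ⟨t, htT, htS, hr⟩ := hsep _ hScard (by simp [hwNJ, hwT])
    have htJ : t ∈ J' := by
      simp only [Finset.mem_union, Finset.mem_sdiff, not_or, not_and, not_not] at htS
      exact htS.1 (htS.2 htT)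
    have hwJ : w ∈ (J' : Set V) := by
      refine hr.invariant htJ ?_
      intro a ha _ b hb hab
      have hbw : b ≠ w := by
        rintro rfl
        exact (hmem a ha).2.2 hab
      have hbN : b ∈ NJ := Finset.mem_biUnion.2 ⟨a, ha, by
        simp only [N, Finset.mem_filter]
        exact ⟨Finset.mem_univ _, hb.1, hbw, Or.inr hab⟩⟩
      by_contra hbJ
      exact hb.2 (Finset.mem_union_left _ (Finset.mem_sdiff.2 ⟨hbN, hbJ⟩))
    exact (hmem w hwJ).2.1 rfl
  obtain ⟨φ, hφi, hφ⟩ := (Finset.all_card_le_biUnion_card_iff_exists_injective _).1 hall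
  have hφ' : ∀ v : I, φ v ∈ W ∧ φ v ≠ w ∧ (φ v = v ∨ G.Adj v (φ v)) ∧ φ v ∉ T := by
    intro v
    have := hφ v
    simp only [N, Finset.mem_sdiff, Finset.mem_filter, Finset.mem_univ, true_and] at this
    tauto
  let R : V → V → Prop := fun a b => ∃ h, φ ⟨a, h⟩ = b
  let F : V → Set V := fun t => {v | Relation.ReflTransGen R t v}
  have hFsub : ∀ t ∈ T, F t ⊆ W \ {w} := by
    intro t ht v hv
    rcases Relation.ReflTransGen.cases_tail hv with h | ⟨a, -, h, h'⟩
    · subst h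
      exact ⟨hTW ht, fun h => hwT (by rw [← Set.mem_singleton_iff.1 h]; exact ht)⟩
    · have := hφ' ⟨a, h⟩
      rw [h'] at this
      exact ⟨this.1, this.2.1⟩
  have htF : ∀ t, t ∈ F t := fun t => Relation.ReflTransGen.refl
  refine ⟨F, fun t ht => ⟨htF t, ?_, hFsub t ht⟩, ?_⟩
  · have hconn : Conn G (F t) := by
      refine Conn.of_hub t fun v hv => ?_
      induction hv with
      | refl => exact ReachIn.refl _
      | @tail a b hab hb ih =>
        refine ReachIn.trans ?_ ih
        obtain ⟨h, h'⟩ := hb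
        have := (hφ' ⟨a, h⟩).2.2.1
        rw [h'] at this
        rcases this with h1 | h1
        · rw [h1]; exact ReachIn.refl _
        · exact ReachIn.of_adj h1.symm (Relation.ReflTransGen.tail hab ⟨h, h'⟩) hab
    obtain ⟨b, hb, hbw⟩ : ∃ b ∈ F t, G.Adj b w := by
      by_contra! hno
      have hI : ∀ v ∈ F t, v ∈ W ∧ v ≠ w ∧ ¬ G.Adj v w := fun v hv =>
        ⟨(hFsub t ht hv).1, (hFsub t ht hv).2, hno v hv⟩
      let P : Finset V := Finset.univ.filter (· ∈ F t)
      have hP : ∀ v, v ∈ P ↔ v ∈ F t := by simp [P]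
      let ψ : V → V := fun v => if h : v ∈ F t then φ ⟨v, hI v h⟩ else v
      have hcard : P.card ≤ (P.erase t).card := by
        refine Finset.card_le_card_of_injOn ψ ?_ ?_
        · intro v hv
          have hv' := (hP v).1 hv
          simp only [ψ, dif_pos hv', Finset.coe_erase, Set.mem_sdiff, Finset.mem_coe, hP,
            Set.mem_singleton_iff]
          exact ⟨Relation.ReflTransGen.tail hv' ⟨hI v hv', rfl⟩,
            fun h => (hφ' ⟨v, hI v hv'⟩).2.2.2 (h ▸ ht)⟩
        · intro v hv v' hv' h
          have hv := (hP v).1 hv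
          have hv' := (hP v').1 hv'
          simp only [ψ, dif_pos hv, dif_pos hv'] at h
          exact congrArg Subtype.val (hφi h)
      exact absurd hcard (not_le.2 (Finset.card_erase_lt_of_mem ((hP t).2 (htF t))))
    exact hconn.insert_adj hb hbw.symm
  · intro t ht t' ht' hne
    rw [Set.disjoint_left]
    intro v hv
    induction hv with
    | refl =>
      intro h
      rcases Relation.ReflTransGen.cases_tail h with h | ⟨a, -, h, h'⟩
      · exact hne h
      · exact (hφ' ⟨a, h⟩).2.2.2 (h' ▸ ht)
    | @tail a b hab hb ih =>
      intro h'
      obtain ⟨h1, h2⟩ := hb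
      rcases Relation.ReflTransGen.cases_tail h' with h | ⟨c, hc, h3, h4⟩
      · exact (hφ' ⟨a, h1⟩).2.2.2 (h2 ▸ h ▸ ht')
      · have := congrArg Subtype.val (hφi (h2.trans h4.symm))
        exact ih (by rw [show a = c from this]; exact hc)

/-- The fan theorem for a `k`-connected set; the centre `w` may itself be a target. -/
theorem KConn.exists_fan [Fintype V] [DecidableEq V] {G : SimpleGraph V} {W : Set V} {w : V}
    {k : ℕ} (hW : KConn G W k) (hw : w ∈ W) (T : Finset V) (hTW : ↑T ⊆ W)
    (hk : (T.erase w).card ≤ k) :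
    ∃ F : V → Set V, (∀ t ∈ T, t ∈ insert w (F t) ∧ Conn G (insert w (F t)) ∧ F t ⊆ W \ {w}) ∧
      ∀ t ∈ T, ∀ t' ∈ T, t ≠ t' → Disjoint (F t) (F t') := by
  obtain ⟨F, hF, hd⟩ := exists_fan_of_separators (G := G) (W := W) (w := w) (T.erase w)
    (fun t ht => hTW (Finset.mem_of_mem_erase ht)) (by simp) (by
      intro S hS hwS
      obtain ⟨t, ht, htS⟩ : ∃ t ∈ T.erase w, t ∉ S := by
        by_contra! h
        exact absurd (Finset.card_le_card h) (not_le.2 hS)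
      exact ⟨t, ht, htS, hW S (hS.trans_le hk) t ⟨hTW (Finset.mem_of_mem_erase ht), htS⟩ w
        ⟨hw, hwS⟩⟩)
  refine ⟨fun t => if t = w then ∅ else F t, fun t ht => ?_, fun t ht t' ht' hne => ?_⟩
  · by_cases h : t = w
    · subst h
      simpa using conn_singleton t
    · simp only [h, if_false]
      have := hF t (by simp [h, ht])
      exact ⟨Or.inr this.1, this.2⟩
  · by_cases h : t = w
    · simp [h]
    · by_cases h' : t' = w
      · simp [h']
      · simp only [h, h', if_false]
        exact hd t (by simp [h, ht]) t' (by simp [h', ht']) hne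

section Clusters

variable {V : Type*} {G : SimpleGraph V}

theorem KConn.conn_diff {W : Set V} {k : ℕ} (h : KConn G W k) {X : Finset V} {x : V}
    (hX : X.card ≤ k) (hx : x ∈ X) (hxW : x ∉ W) : Conn G (W \ X) := by
  classical
  have := h (X.erase x) ((Finset.card_erase_lt_of_mem hx).trans_le hX)
  convert this using 1
  ext u
  have : u ∈ W → u ≠ x := fun h h' => hxW (h' ▸ h)
  simp only [Set.mem_sdiff, Finset.mem_coe, Finset.mem_erase]
  tauto

/-- If all colour classes stay connected and there are enough colours, the whole set stays
connected after deleting `X`. -/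
theorem conn_of_clusters {C : Type*} [DecidableEq C] {W : Set V} {Γ : Finset C} (χ : V → C)
    (g : V → V) (hg : ∀ u, g (g u) = u) (hadj : ∀ u, G.Adj u (g u)) (hχ : ∀ u ∈ W, χ u ∈ Γ)
    (hcross : ∀ a ∈ Γ, ∀ b ∈ Γ, a ≠ b → ∃ u ∈ W, χ u = a ∧ g u ∈ W ∧ χ (g u) = b)
    (X : Finset V) (hc : ∀ c ∈ Γ, Conn G ({u ∈ W | χ u = c} \ X)) (hX : X.card + 1 < Γ.card) :
    Conn G (W \ X) := by
  have step : ∀ a ∈ Γ, ∀ b ∈ Γ, ∀ u v y, u ∈ W \ X → χ u = a → y ∈ W \ X → χ y = a →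
      g y ∈ W \ X → χ (g y) = b → v ∈ W \ X → χ v = b → ReachIn G (W \ X) u v := by
    intro a ha b hb u v y hu hua hy hya hgy hgyb hv hvb
    have h1 : ReachIn G (W \ X) u y := (hc a ha u ⟨⟨hu.1, hua⟩, hu.2⟩ y ⟨⟨hy.1, hya⟩, hy.2⟩).mono
      fun _ h => ⟨h.1.1, h.2⟩
    have h2 : ReachIn G (W \ X) (g y) v :=
      (hc b hb _ ⟨⟨hgy.1, hgyb⟩, hgy.2⟩ v ⟨⟨hv.1, hvb⟩, hv.2⟩).mono fun _ h => ⟨h.1.1, h.2⟩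
    exact (h1.trans (ReachIn.of_adj (hadj y) hy hgy)).trans h2
  intro u hu v hv
  by_cases hab : χ u = χ v
  · exact (hc _ (hχ u hu.1) u ⟨⟨hu.1, rfl⟩, hu.2⟩ v ⟨⟨hv.1, hab.symm⟩, hv.2⟩).mono
      fun _ h => ⟨h.1.1, h.2⟩
  set a := χ u with ha
  set b := χ v with hb
  have haΓ : a ∈ Γ := hχ u hu.1
  have hbΓ : b ∈ Γ := hχ v hv.1
  let l : V → C := fun x =>
    let c := if χ x = a ∨ χ x = b then χ (g x) else χ x
    if c = a then b else c
  obtain ⟨c, hcΓ, hcl⟩ : ∃ c ∈ Γ.erase a, c ∉ X.image l := by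
    by_contra! h
    have h1 := Finset.card_le_card h
    have h2 : (X.image l).card ≤ X.card := Finset.card_image_le
    rw [Finset.card_erase_of_mem haΓ] at h1
    omega
  have hcl' : ∀ x, l x = c → x ∉ X := fun x h hx => hcl (Finset.mem_image.2 ⟨x, hx, h⟩)
  have hca : c ≠ a := Finset.ne_of_mem_erase hcΓ
  have hcΓ' := Finset.mem_of_mem_erase hcΓ
  by_cases hcb : c = b
  · obtain ⟨y, hyW, hya, hgyW, hgyb⟩ := hcross a haΓ b hbΓ hab
    refine step a haΓ b hbΓ u v y hu rfl ⟨hyW, hcl' _ ?_⟩ hya ⟨hgyW, hcl' _ ?_⟩ hgyb hv rfl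
    · simp [l, hya, hgyb, hcb]
    · simp [l, hya, hgyb, hcb, hg]
  · obtain ⟨y, hyW, hya, hgyW, hgyb⟩ := hcross a haΓ c hcΓ' (Ne.symm hca)
    obtain ⟨z, hzW, hza, hgzW, hgzb⟩ := hcross c hcΓ' b hbΓ hcb
    have h1 : z ∈ W \ X := ⟨hzW, hcl' _ (by simp [l, hza, hca, hcb])⟩
    refine (step a haΓ c hcΓ' u z y hu rfl ⟨hyW, hcl' _ ?_⟩ hya ⟨hgyW, hcl' _ ?_⟩ hgyb h1 hza).trans
      (step c hcΓ' b hbΓ z v z h1 hza h1 hza ⟨hgzW, hcl' _ ?_⟩ hgzb hv rfl)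
    · simp [l, hya, hgyb, hca]
    · simp [l, hgyb, hca, hcb]
    · simp [l, hza, hgzb, hca, hg]

theorem KConn.of_clusters {C : Type*} [DecidableEq C] {W : Set V} {Γ : Finset C} {k : ℕ}
    (χ : V → C) (g : V → V) (hg : ∀ u, g (g u) = u) (hadj : ∀ u, G.Adj u (g u))
    (hχ : ∀ u ∈ W, χ u ∈ Γ)
    (hcross : ∀ a ∈ Γ, ∀ b ∈ Γ, a ≠ b → ∃ u ∈ W, χ u = a ∧ g u ∈ W ∧ χ (g u) = b)
    (hc : ∀ c ∈ Γ, KConn G {u ∈ W | χ u = c} k) (hΓ : k < Γ.card) : KConn G W k :=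
  fun X hX => conn_of_clusters χ g hg hadj hχ hcross X (fun c hcΓ => hc c hcΓ X hX) (by omega)

theorem KConn.succ_of_clusters {C : Type*} [DecidableEq C] {W : Set V} {Γ : Finset C} {k : ℕ}
    (χ : V → C) (g : V → V) (hg : ∀ u, g (g u) = u) (hadj : ∀ u, G.Adj u (g u))
    (hχ : ∀ u ∈ W, χ u ∈ Γ)
    (hcross : ∀ a ∈ Γ, ∀ b ∈ Γ, a ≠ b → ∃ u ∈ W, χ u = a ∧ g u ∈ W ∧ χ (g u) = b)
    (hc : ∀ c ∈ Γ, KConn G {u ∈ W | χ u = c} k) (hout : ∀ u ∈ W, g u ∈ W ∧ χ (g u) ≠ χ u)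
    (hk : 1 ≤ k) (hΓ : k + 1 < Γ.card) : KConn G W (k + 1) := by
  classical
  intro X hX
  by_cases h : ∀ c ∈ Γ, Conn G ({u ∈ W | χ u = c} \ X)
  · exact conn_of_clusters χ g hg hadj hχ hcross X h (by omega)
  · push Not at h
    obtain ⟨z, hz, hbad⟩ := h
    have hXz : ∀ x ∈ X, x ∈ W ∧ χ x = z := by
      by_contra! hno
      obtain ⟨x, hx, hxz⟩ := hno
      exact hbad ((hc z hz).conn_diff (by omega) hx fun h => hxz h.1 h.2)
    have hA : Conn G ({u ∈ W | χ u ≠ z} \ (∅ : Finset V)) := by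
      refine conn_of_clusters (Γ := Γ.erase z) χ g hg hadj ?_ ?_ ∅ ?_ ?_
      · exact fun u hu => Finset.mem_erase.2 ⟨hu.2, hχ u hu.1⟩
      · intro a ha b hb hab
        rw [Finset.mem_erase] at ha hb
        obtain ⟨u, h1, h2, h3, h4⟩ := hcross a ha.2 b hb.2 hab
        exact ⟨u, ⟨h1, h2 ▸ ha.1⟩, h2, ⟨h3, h4 ▸ hb.1⟩, h4⟩
      · intro c hcΓ
        rw [Finset.mem_erase] at hcΓ
        have := (hc c hcΓ.2).conn hk
        convert this using 1
        ext u
        simp only [Finset.coe_empty, Set.sdiff_empty, Set.mem_ofPred_eq]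
        constructor
        · exact fun h => ⟨h.1.1, h.2⟩
        · exact fun h => ⟨⟨h.1, h.2 ▸ hcΓ.1⟩, h.2⟩
      · rw [Finset.card_erase_of_mem hz, Finset.card_empty]
        omega
    rw [Finset.coe_empty, Set.sdiff_empty] at hA
    have := hA.union_of_adj (B := {u ∈ W | χ u = z} \ X) (by
      rintro u ⟨⟨huW, huz⟩, hu⟩
      exact ⟨g u, ⟨(hout u huW).1, huz ▸ (hout u huW).2⟩, hadj u⟩)
    convert this using 1
    ext u
    simp only [Set.mem_sdiff, Finset.mem_coe, Set.mem_union, Set.mem_ofPred_eq]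
    have := hXz u
    tauto

theorem KConn.succ_of_matching {W₀ W₁ : Set V} {k : ℕ} (τ : V → V) (hτ : ∀ u, τ (τ u) = u)
    (hadj : ∀ u, G.Adj u (τ u)) (hd : Disjoint W₀ W₁) (h01 : ∀ u ∈ W₀, τ u ∈ W₁)
    (h10 : ∀ u ∈ W₁, τ u ∈ W₀) (h0 : KConn G W₀ k) (h1 : KConn G W₁ k)
    (hk0 : 1 ≤ k)
    (hk : ∃ A : Finset V, ↑A ⊆ W₀ ∧ k < A.card) : KConn G (W₀ ∪ W₁) (k + 1) := by
  classical
  have main : ∀ P Q : Set V, (∀ u ∈ Q, τ u ∈ P) → KConn G P k → KConn G Q k → Disjoint P Q →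
      ∀ X : Finset V, X.card < k + 1 → ¬ Conn G (Q \ X) → Conn G ((P ∪ Q) \ X) := by
    intro P Q hQP hP hQ hd X hX hbad
    have hXQ : ∀ x ∈ X, x ∈ Q := by
      by_contra! hno
      obtain ⟨x, hx, hxz⟩ := hno
      exact hbad (hQ.conn_diff (by omega) hx hxz)
    have := (hP.conn hk0).union_of_adj (B := Q \ X) (fun u hu => ⟨τ u, hQP u hu.1, hadj u⟩)
    convert this using 1
    ext u
    have h1 := hXQ u
    have h2 : u ∈ P → u ∉ Q := fun h h' => Set.disjoint_left.1 hd h h'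
    simp only [Set.mem_sdiff, Finset.mem_coe, Set.mem_union]
    tauto
  intro X hX
  by_cases hb1 : Conn G (W₁ \ X)
  · by_cases hb0 : Conn G (W₀ \ X)
    · obtain ⟨A, hA, hAk⟩ := hk
      let l : V → V := fun x => if x ∈ W₀ then x else τ x
      obtain ⟨u, huA, hul⟩ : ∃ u ∈ A, u ∉ X.image l := by
        by_contra! h
        have h1 := Finset.card_le_card h
        have h2 : (X.image l).card ≤ X.card := Finset.card_image_le
        omega
      have hul' : ∀ x, l x = u → x ∉ X := fun x h hx => hul (Finset.mem_image.2 ⟨x, hx, h⟩)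
      have hu0 := hA huA
      have hτu : τ u ∉ W₀ := fun h => Set.disjoint_left.1 hd h (h01 u hu0)
      rw [Set.union_sdiff_distrib]
      refine hb0.union_adj hb1 (u := u) (v := τ u) ⟨hu0, hul' _ ?_⟩ ⟨h01 u hu0, hul' _ ?_⟩ (hadj u)
      · simp [l, hu0]
      · simp [l, hτu, hτ]
    · rw [Set.union_comm]
      exact main W₁ W₀ h01 h1 h0 hd.symm X hX hb0
  · exact main W₀ W₁ h10 h0 h1 hd X hX hb1

end Clusters

/-- Three distinguished positions. -/
structure Frame (α : Type*) where
  (p₀ p₁ p₂ : α)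
  h₀₁ : p₀ ≠ p₁
  h₀₂ : p₀ ≠ p₂
  h₁₂ : p₁ ≠ p₂

namespace Frame

variable {α : Type*} [DecidableEq α] (P : Frame α)

/-- `r` is none of the three distinguished positions. -/
def Out (r : α) : Prop := r ≠ P.p₀ ∧ r ≠ P.p₁ ∧ r ≠ P.p₂

/-- The transposition of the first two distinguished positions. -/
def t : Perm α := swap P.p₀ P.p₁

/-- The 3-cycle on the distinguished positions. -/
def ρ : Perm α := swap P.p₀ P.p₂ * swap P.p₀ P.p₁

/-- The double transposition attached to a position `r`. -/
def g (r : α) : Perm α := swap P.p₀ P.p₁ * swap P.p₂ r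

variable {P} {r q : α} (u v : Perm α)

@[simp] theorem t_p₀ : P.t P.p₀ = P.p₁ := by simp [t]
@[simp] theorem t_p₁ : P.t P.p₁ = P.p₀ := by simp [t]
@[simp] theorem t_p₂ : P.t P.p₂ = P.p₂ := swap_apply_of_ne_of_ne P.h₀₂.symm P.h₁₂.symm
theorem t_out (h : P.Out q) : P.t q = q := swap_apply_of_ne_of_ne h.1 h.2.1
@[simp] theorem ρ_p₀ : P.ρ P.p₀ = P.p₁ := by
  simp [ρ, swap_apply_of_ne_of_ne P.h₀₁.symm P.h₁₂]
@[simp] theorem ρ_p₁ : P.ρ P.p₁ = P.p₂ := by simp [ρ]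
@[simp] theorem ρ_p₂ : P.ρ P.p₂ = P.p₀ := by
  simp [ρ, swap_apply_of_ne_of_ne P.h₀₂.symm P.h₁₂.symm]
theorem ρ_out (h : P.Out q) : P.ρ q = q := by
  simp [ρ, swap_apply_of_ne_of_ne h.1 h.2.1, swap_apply_of_ne_of_ne h.1 h.2.2]
theorem ρ_inv_p₀ : P.ρ⁻¹ P.p₀ = P.p₂ := by rw [Perm.inv_eq_iff_eq]; simp
theorem ρ_inv_p₁ : P.ρ⁻¹ P.p₁ = P.p₀ := by rw [Perm.inv_eq_iff_eq]; simp
theorem ρ_inv_out (h : P.Out q) : P.ρ⁻¹ q = q := by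
  rw [Perm.inv_eq_iff_eq, ρ_out h]
theorem g_p₀ (h : P.Out r) : P.g r P.p₀ = P.p₁ := by
  simp [g, swap_apply_of_ne_of_ne P.h₀₂ h.1.symm]
theorem g_p₁ (h : P.Out r) : P.g r P.p₁ = P.p₀ := by
  simp [g, swap_apply_of_ne_of_ne P.h₁₂ h.2.1.symm]
theorem g_p₂ (h : P.Out r) : P.g r P.p₂ = r := by
  simp [g, swap_apply_of_ne_of_ne h.1 h.2.1]
theorem g_self : P.g r r = P.p₂ := by
  simp [g, swap_apply_of_ne_of_ne P.h₀₂.symm P.h₁₂.symm]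
theorem g_out (hq : P.Out q) (hqr : q ≠ r) : P.g r q = q := by
  simp [g, swap_apply_of_ne_of_ne hq.2.2 hqr, swap_apply_of_ne_of_ne hq.1 hq.2.1]

omit [DecidableEq α] in
theorem cases_pos (q : α) : q = P.p₀ ∨ q = P.p₁ ∨ q = P.p₂ ∨ P.Out q := by
  unfold Out; tauto

@[simp] theorem t_mul_t : P.t * P.t = 1 := by simp [t]

theorem g_mul_g (h : P.Out r) : P.g r * P.g r = 1 := by
  ext q
  rw [Perm.mul_apply, Perm.one_apply]
  rcases P.cases_pos q with rfl | rfl | rfl | hq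
  · rw [g_p₀ h, g_p₁ h]
  · rw [g_p₁ h, g_p₀ h]
  · rw [g_p₂ h, g_self]
  · by_cases hqr : q = r
    · subst hqr
      rw [g_self, g_p₂ h]
    · rw [g_out hq hqr, g_out hq hqr]

@[simp] theorem mul_t_t : u * P.t * P.t = u := by rw [mul_assoc, t_mul_t, mul_one]

theorem mul_g_g (h : P.Out r) : u * P.g r * P.g r = u := by rw [mul_assoc, g_mul_g h, mul_one]

variable (P) in
/-- The generalized godan graph. -/
def graph : SimpleGraph (Perm α) where
  Adj u v := v = u * P.t ∨ v = u * P.ρ ∨ u = v * P.ρ ∨ ∃ r, P.Out r ∧ v = u * P.g r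
  symm := ⟨by
    rintro u v (rfl | rfl | rfl | ⟨r, hr, rfl⟩)
    · left; simp [t, mul_assoc]
    · right; right; left; rfl
    · right; left; rfl
    · right; right; right
      exact ⟨r, hr, by rw [mul_assoc, g_mul_g hr, mul_one]⟩⟩
  loopless := ⟨by
    rintro u (h | h | h | ⟨r, hr, h⟩)
    · have := congrArg (fun s => s P.p₀) h
      simp [t, P.h₀₁] at this
    · have := congrArg (fun s => s P.p₁) h
      simp [ρ, P.h₁₂] at this
    · have := congrArg (fun s => s P.p₁) h
      simp [ρ, P.h₁₂] at this
    · have := congrArg (fun s => s P.p₂) h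
      simp [g, swap_apply_of_ne_of_ne hr.1 hr.2.1, hr.2.2.symm] at this⟩

theorem adj_t : P.graph.Adj u (u * P.t) := Or.inl rfl
theorem adj_ρ : P.graph.Adj u (u * P.ρ) := Or.inr (Or.inl rfl)
theorem adj_ρ_inv : P.graph.Adj u (u * P.ρ⁻¹) := Or.inr (Or.inr (Or.inl (by simp)))
theorem adj_g (h : P.Out r) : P.graph.Adj u (u * P.g r) := Or.inr (Or.inr (Or.inr ⟨r, h, rfl⟩))

variable [Fintype α]

@[simp] theorem sign_t : Perm.sign P.t = -1 := Perm.sign_swap P.h₀₁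
@[simp] theorem sign_ρ : Perm.sign P.ρ = 1 := by
  simp [ρ, Perm.sign_swap P.h₀₁, Perm.sign_swap P.h₀₂]
theorem sign_g (h : P.Out r) : Perm.sign (P.g r) = 1 := by
  simp [g, Perm.sign_swap P.h₀₁, Perm.sign_swap h.2.2.symm]

/-- Even permutations supported on the distinguished positions are rotations. -/
theorem eq_rotation {w : Perm α} (hw : ∀ q, P.Out q → w q = q) (hs : Perm.sign w = 1) :
    w = 1 ∨ w = P.ρ ∨ w = P.ρ⁻¹ := by
  have key : ∀ w : Perm α, (∀ q, P.Out q → w q = q) → Perm.sign w = 1 → w P.p₀ = P.p₀ →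
      w = 1 := by
    intro w hw hs h0
    have hO : ∀ q, ¬ P.Out (w q) ∨ P.Out q := by
      intro q
      by_cases h : P.Out (w q)
      · right
        have := w.injective (hw _ h)
        rwa [this] at h
      · exact Or.inl h
    have h01 := P.h₀₁
    have h02 := P.h₀₂
    have h12 := P.h₁₂
    rcases P.cases_pos (w P.p₁) with h | h | h | h
    · exact absurd (w.injective (h.trans h0.symm)) h01.symm
    · rcases P.cases_pos (w P.p₂) with h' | h' | h' | h'
      · exact absurd (w.injective (h'.trans h0.symm)) h02.symm
      · exact absurd (w.injective (h'.trans h.symm)) h12.symm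
      · ext q
        rcases P.cases_pos q with rfl | rfl | rfl | hq
        · simp [h0]
        · simp [h]
        · simp [h']
        · simp [hw q hq]
      · exact absurd rfl (((hO _).resolve_left (not_not.2 h')).2.2)
    · have h2 : w P.p₂ = P.p₁ := by
        rcases P.cases_pos (w P.p₂) with h' | h' | h' | h'
        · exact absurd (w.injective (h'.trans h0.symm)) h02.symm
        · exact h'
        · exact absurd (w.injective (h'.trans h.symm)) h12.symm
        · exact absurd rfl (((hO _).resolve_left (not_not.2 h')).2.2)
      have : w = swap P.p₁ P.p₂ := by
        ext q
        rcases P.cases_pos q with rfl | rfl | rfl | hq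
        · simp [h0, swap_apply_of_ne_of_ne h01 h02]
        · simp [h]
        · simp [h2]
        · simp [hw q hq, swap_apply_of_ne_of_ne hq.2.1 hq.2.2]
      rw [this, Perm.sign_swap h12] at hs
      exact absurd hs (by decide)
    · exact absurd rfl (((hO _).resolve_left (not_not.2 h)).2.1)
  rcases P.cases_pos (w P.p₀) with h | h | h | h
  · exact Or.inl (key w hw hs h)
  · right; left
    have := key (P.ρ⁻¹ * w) (fun q hq => by rw [Perm.mul_apply, hw q hq, ρ_inv_out hq])
      (by simp [hs]) (by rw [Perm.mul_apply, h, ρ_inv_p₁])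
    exact (inv_mul_eq_one.1 this).symm
  · right; right
    have := key (P.ρ * w) (fun q hq => by simp [hw q hq, ρ_out hq]) (by simp [hs]) (by simp [h])
    exact eq_inv_of_mul_eq_one_right this
  · exact absurd (w.injective (hw _ h)).symm h.1.symm

end Frame

theorem units_eq_or_eq_neg (a b : ℤˣ) : a = b ∨ a = -b := by
  revert a b; decide

theorem units_ne_neg (a : ℤˣ) : a ≠ -a := by
  revert a; decide

namespace Frame

variable {α : Type*} [DecidableEq α]

/-- The permutations agreeing with `v` on `D` for which each symbol of `I` is at one of the first
two distinguished positions. -/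
def base (P : Frame α) (I D : Finset α) (v : Perm α) : Set (Perm α) :=
  {u | (∀ q ∈ D, u q = v q) ∧ ∀ s ∈ I, u P.p₀ = s ∨ u P.p₁ = s}

/-- The elements of `P.base I D v` with the sign of `v`. -/
def layer [Fintype α] (P : Frame α) (I D : Finset α) (v : Perm α) : Set (Perm α) :=
  {u | u ∈ P.base I D v ∧ Perm.sign u = Perm.sign v}

variable {P : Frame α} {I D : Finset α} {u v w : Perm α} {r q a b : α}

omit [DecidableEq α] in
theorem base_congr (h : u ∈ P.base I D v) : P.base I D v = P.base I D u := by
  ext w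
  refine and_congr_left fun _ => forall₂_congr fun q hq => ?_
  rw [h.1 q hq]

theorem base_mul_t (hD : ∀ q ∈ D, P.Out q) (h : u ∈ P.base I D v) : u * P.t ∈ P.base I D v :=
  ⟨fun q hq => by rw [Perm.mul_apply, t_out (hD q hq), h.1 q hq], fun s hs => by
    rw [Perm.mul_apply, Perm.mul_apply, t_p₀, t_p₁]; exact (h.2 s hs).symm⟩

theorem base_mul_g (hD : ∀ q ∈ D, P.Out q) (hr : P.Out r) (hrD : r ∉ D)
    (h : u ∈ P.base I D v) : u * P.g r ∈ P.base I D v :=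
  ⟨fun q hq => by
    rw [Perm.mul_apply, g_out (hD q hq) (ne_of_mem_of_not_mem hq hrD), h.1 q hq], fun s hs => by
    rw [Perm.mul_apply, Perm.mul_apply, g_p₀ hr, g_p₁ hr]; exact (h.2 s hs).symm⟩

/-- One may change the symbol at a position outside `D`. -/
theorem base_swap_mul (hu : u ∈ P.base I D v) (hq : q ∉ D) (hq0 : q ≠ P.p₀) (hq1 : q ≠ P.p₁)
    (ha : a ∉ I) (haD : ∀ q ∈ D, v q ≠ a) : swap (u q) a * u ∈ P.base I D v := by
  refine ⟨fun q' hq' => ?_, fun s hs => ?_⟩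
  · rw [Perm.mul_apply, swap_apply_of_ne_of_ne, hu.1 q' hq']
    · exact fun h => hq (u.injective h ▸ hq')
    · rw [hu.1 q' hq']; exact haD q' hq'
  · have hsa : s ≠ a := fun h => ha (h ▸ hs)
    refine (hu.2 s hs).imp (fun h => ?_) fun h => ?_
    · rw [Perm.mul_apply, h, swap_apply_of_ne_of_ne (fun h' => hq0 (u.injective (h.trans h')).symm)
        hsa]
    · rw [Perm.mul_apply, h, swap_apply_of_ne_of_ne (fun h' => hq1 (u.injective (h.trans h')).symm)
        hsa]

variable [Fintype α]

theorem layer_congr (h : u ∈ P.layer I D v) : P.layer I D v = P.layer I D u := by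
  ext w
  unfold layer
  rw [base_congr h.1, ← h.2]

/-- The sign can be prescribed freely. -/
theorem exists_sign (hD : ∀ q ∈ D, P.Out q) (hu : u ∈ P.base I D v) (ε : ℤˣ) :
    ∃ u' ∈ P.base I D v, Perm.sign u' = ε ∧ ∀ q, q ≠ P.p₀ → q ≠ P.p₁ → u' q = u q := by
  rcases units_eq_or_eq_neg (Perm.sign u) ε with h | h
  · exact ⟨u, hu, h, fun _ _ _ => rfl⟩
  · exact ⟨u * P.t, base_mul_t hD hu, by simp [h], fun q h0 h1 => by
      rw [Perm.mul_apply]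
      congr 1
      exact swap_apply_of_ne_of_ne h0 h1⟩

theorem exists_base_one (hD : ∀ q ∈ D, P.Out q) (hu : u ∈ P.base I D v) (ε : ℤˣ)
    (hq : q ∉ D) (hq0 : q ≠ P.p₀) (hq1 : q ≠ P.p₁) (ha : a ∉ I) (haD : ∀ q ∈ D, v q ≠ a) :
    ∃ u' ∈ P.base I D v, Perm.sign u' = ε ∧ u' q = a := by
  obtain ⟨w, h1, h2, h3⟩ := exists_sign hD (base_swap_mul hu hq hq0 hq1 ha haD) ε
  exact ⟨w, h1, h2, by rw [h3 q hq0 hq1]; simp⟩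

theorem exists_base_two (hD : ∀ q ∈ D, P.Out q) (hu : u ∈ P.base I D v) (ε : ℤˣ)
    (hr : P.Out r) (hrD : r ∉ D) (hab : a ≠ b) (ha : a ∉ I) (haD : ∀ q ∈ D, v q ≠ a)
    (hb : b ∉ I) (hbD : ∀ q ∈ D, v q ≠ b) :
    ∃ u' ∈ P.base I D v, Perm.sign u' = ε ∧ u' r = a ∧ u' P.p₂ = b := by
  have h2D : P.p₂ ∉ D := fun h => (hD _ h).2.2 rfl
  have h1 := base_swap_mul hu hrD hr.1 hr.2.1 ha haD
  obtain ⟨w, h2, h3, h4⟩ := exists_sign hD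
    (base_swap_mul h1 h2D P.h₀₂.symm P.h₁₂.symm hb hbD) ε
  refine ⟨w, h2, h3, ?_, ?_⟩
  · rw [h4 r hr.1 hr.2.1, Perm.mul_apply, swap_apply_of_ne_of_ne]
    · simp
    · exact fun h => hr.2.2 (Equiv.injective _ h)
    · simpa using hab
  · rw [h4 _ P.h₀₂.symm P.h₁₂.symm]; simp

theorem layer_cluster (hr : u r = a) (hu : u ∈ P.layer I D v) :
    {w ∈ P.layer I D v | w r = a} = P.layer I (insert r D) u := by
  rw [layer_congr hu]
  ext w
  simp only [layer, base, Set.mem_ofPred_eq, Finset.forall_mem_insert, ← hr]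
  tauto

/-- The symbols that can occur at a free position. -/
def free (I D : Finset α) (v : Perm α) : Finset α := Dᶜ.image v \ I

theorem mem_free : a ∈ free I D v ↔ (∀ q ∈ D, v q ≠ a) ∧ a ∉ I := by
  simp only [free, Finset.mem_sdiff, Finset.mem_image, Finset.mem_compl, and_congr_left_iff]
  intro _
  constructor
  · rintro ⟨q, hq, rfl⟩ q' hq' h
    exact hq (v.injective h ▸ hq')
  · intro h
    exact ⟨v⁻¹ a, fun h' => h _ h' (by simp), by simp⟩

theorem mem_free_of_base (hu : u ∈ P.base I D v) (hq : q ∉ D) (hq0 : q ≠ P.p₀)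
    (hq1 : q ≠ P.p₁) : u q ∈ free I D v := by
  refine mem_free.2 ⟨fun q' hq' h => hq ?_, fun h => ?_⟩
  · rw [← hu.1 q' hq'] at h
    exact u.injective h ▸ hq'
  · rcases hu.2 _ h with h | h
    · exact hq0 (u.injective h).symm
    · exact hq1 (u.injective h).symm

theorem card_free : D.card + I.card + (free I D v).card ≥ Fintype.card α := by
  have h1 := Finset.le_card_sdiff I (Dᶜ.image v)
  rw [Finset.card_image_of_injective _ v.injective, Finset.card_compl] at h1
  have := D.card_le_univ
  unfold free
  omega

theorem layer_kconn (hI : I.card ≤ 1) {f : ℕ} : ∀ {D : Finset α} (v : Perm α),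
    (∀ q ∈ D, P.Out q) → D.card + f + 3 = Fintype.card α →
    KConn P.graph (P.layer I D v) (f + 2 - I.card) := by
  induction f with
  | zero =>
    intro D v hD hcard X _ u hu w hw
    by_cases huw : w = u
    · rw [huw]; exact ReachIn.refl _
    refine ReachIn.of_adj ?_ hu hw
    have hall : ∀ q, P.Out q → q ∈ D := by
      have h1 : D ⊆ ({P.p₀, P.p₁, P.p₂} : Finset α)ᶜ := fun q hq => by
        have := hD q hq
        simp only [Out] at this
        simp [this]
      have h2 : ({P.p₀, P.p₁, P.p₂} : Finset α).card = 3 :=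
        Finset.card_eq_three.2 ⟨_, _, _, P.h₀₁, P.h₀₂, P.h₁₂, rfl⟩
      have h3 := Finset.eq_of_subset_of_card_le h1 (by rw [Finset.card_compl, h2]; omega)
      intro q hq
      rw [h3]
      simpa [Out] using hq
    rcases eq_rotation (P := P) (w := u⁻¹ * w) (fun q hq => by
        rw [Perm.mul_apply, hw.1.1.1 q (hall q hq), ← hu.1.1.1 q (hall q hq)]; simp)
        (by rw [map_mul, map_inv, hw.1.2, hu.1.2]; simp) with h | h | h
    · exact absurd (inv_mul_eq_one.1 h).symm huw
    · rw [← eq_inv_mul_iff_mul_eq.1 h.symm]; exact adj_ρ u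
    · rw [← eq_inv_mul_iff_mul_eq.1 h.symm]; exact adj_ρ_inv u
  | succ f ih =>
    intro D v hD hcard
    rcases Set.eq_empty_or_nonempty (P.layer I D v) with hem | ⟨v', hv'⟩
    · rw [hem]; intro X _ u hu; simp at hu
    rw [layer_congr hv']
    have hv : v' ∈ P.base I D v' := ⟨fun _ _ => rfl, hv'.1.2⟩
    clear hv' v
    rename' v' => v
    obtain ⟨r, hr⟩ : ∃ r, r ∉ (insert P.p₀ (insert P.p₁ (insert P.p₂ D))) := by
      by_contra! h
      have := Finset.card_le_card (fun q _ => h q : (Finset.univ : Finset α) ⊆ _)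
      have h1 := Finset.card_insert_le P.p₀ (insert P.p₁ (insert P.p₂ D))
      have h2 := Finset.card_insert_le P.p₁ (insert P.p₂ D)
      have h3 := Finset.card_insert_le P.p₂ D
      rw [Finset.card_univ] at this
      omega
    simp only [Finset.mem_insert, not_or] at hr
    have hrD := hr.2.2.2
    have hr : P.Out r := ⟨hr.1, hr.2.1, hr.2.2.1⟩
    have h2D : P.p₂ ∉ D := fun h => (hD _ h).2.2 rfl
    have hsign : ∀ u : Perm α, Perm.sign (u * P.g r) = Perm.sign u := fun u => by simp [sign_g hr]
    have hmul : ∀ u ∈ P.layer I D v, u * P.g r ∈ P.layer I D v := fun u hu =>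
      ⟨base_mul_g hD hr hrD hu.1, (hsign u).trans hu.2⟩
    have hval : ∀ u : Perm α, (u * P.g r) r = u P.p₂ := fun u => by rw [Perm.mul_apply, g_self]
    rw [show f + 1 + 2 - I.card = f + 2 - I.card + 1 by omega]
    refine KConn.succ_of_clusters (Γ := free I D v) (fun u : Perm α => u r) (fun u => u * P.g r)
      (fun u => mul_g_g u hr) (fun u => adj_g u hr)
      (fun u hu => mem_free_of_base hu.1 hrD hr.1 hr.2.1) ?_ ?_ ?_ (by omega) ?_
    · intro a ha b hb hab
      rw [mem_free] at ha hb
      obtain ⟨u, h1, h2, h3, h4⟩ := exists_base_two hD hv (Perm.sign v) hr hrD hab ha.2 ha.1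
        hb.2 hb.1
      exact ⟨u, ⟨h1, h2⟩, h3, hmul u ⟨h1, h2⟩, by rw [hval, h4]⟩
    · intro c _
      rcases Set.eq_empty_or_nonempty {u ∈ P.layer I D v | u r = c} with hem | ⟨u, hu, huc⟩
      · rw [hem]; intro X _ u hu; simp at hu
      · rw [layer_cluster huc hu]
        refine ih _ (fun q hq => ?_) ?_
        · rcases Finset.mem_insert.1 hq with rfl | hq
          · exact hr
          · exact hD q hq
        · rw [Finset.card_insert_of_notMem hrD]; omega
    · intro u hu
      exact ⟨hmul u hu, by rw [hval]; exact fun h => hr.2.2 (u.injective h).symm⟩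
    · have := card_free (D := D) (I := I) (v := v)
      omega

/-- Every layer has many elements. -/
theorem exists_subset_layer (hD : ∀ q ∈ D, P.Out q) (hv : v ∈ P.base I D v) :
    ∃ A : Finset (Perm α), ↑A ⊆ P.layer I D v ∧ Fintype.card α ≤ D.card + I.card + A.card := by
  have h2D : P.p₂ ∉ D := fun h => (hD _ h).2.2 rfl
  have : ∀ a : free I D v, ∃ u ∈ P.base I D v, Perm.sign u = Perm.sign v ∧ u P.p₂ = a := by
    rintro ⟨a, ha⟩
    rw [mem_free] at ha
    exact exists_base_one hD hv _ h2D P.h₀₂.symm P.h₁₂.symm ha.2 ha.1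
  choose F h1 h2 h3 using this
  have hF : Function.Injective F := fun a b h => by
    have := congrArg (fun u : Perm α => u P.p₂) h
    simp only [h3] at this
    exact Subtype.ext this
  refine ⟨Finset.univ.map ⟨F, hF⟩, ?_, ?_⟩
  · intro u hu
    obtain ⟨a, -, rfl⟩ := Finset.mem_map.1 (Finset.mem_coe.1 hu)
    exact ⟨h1 a, h2 a⟩
  · rw [Finset.card_map, Finset.card_univ, Fintype.card_coe]
    exact card_free

theorem base_eq_union : P.base I D v = P.layer I D v ∪ {u ∈ P.base I D v |
    Perm.sign u = -Perm.sign v} := by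
  ext u
  simp only [layer, Set.mem_union, Set.mem_ofPred_eq]
  rcases units_eq_or_eq_neg (Perm.sign u) (Perm.sign v) with h | h <;> simp [h]

theorem opposite_layer (hD : ∀ q ∈ D, P.Out q) (hv : v ∈ P.base I D v) :
    {u ∈ P.base I D v | Perm.sign u = -Perm.sign v} = P.layer I D (v * P.t) := by
  unfold layer
  rw [base_congr (base_mul_t hD hv)]
  simp

theorem base_kconn (hI : I.card ≤ 1) {f : ℕ} (v : Perm α) (hD : ∀ q ∈ D, P.Out q)
    (hcard : D.card + f + 3 = Fintype.card α) :
    KConn P.graph (P.base I D v) (f + 3 - I.card) := by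
  rcases Set.eq_empty_or_nonempty (P.base I D v) with hem | ⟨v', hv'⟩
  · rw [hem]; intro X _ u hu; simp at hu
  rw [base_congr hv']
  have hv : v' ∈ P.base I D v' := ⟨fun _ _ => rfl, hv'.2⟩
  rw [base_eq_union, show f + 3 - I.card = f + 2 - I.card + 1 by omega]
  refine KConn.succ_of_matching (fun u => u * P.t) mul_t_t adj_t ?_ ?_ ?_
    (layer_kconn hI _ hD hcard) ?_ (by omega) ?_
  · rw [Set.disjoint_left]
    rintro u ⟨-, h⟩ ⟨-, h'⟩
    rw [h] at h'
    exact units_ne_neg _ h'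
  · rintro u ⟨h, h'⟩
    exact ⟨base_mul_t hD h, by simp [h']⟩
  · rintro u ⟨h, h'⟩
    exact ⟨base_mul_t hD h, by simp [h']⟩
  · rw [opposite_layer hD hv]
    exact layer_kconn hI _ hD hcard
  · obtain ⟨A, h1, h2⟩ := exists_subset_layer hD hv
    exact ⟨A, h1, by omega⟩

end Frame

namespace Frame

variable {α : Type*} [DecidableEq α] {P : Frame α} {u v w : Perm α} {r q a b m : α}

theorem mul_g_self (u : Perm α) : (u * P.g r) r = u P.p₂ := by rw [Perm.mul_apply, g_self]
theorem mul_g_p₂ (h : P.Out r) (u : Perm α) : (u * P.g r) P.p₂ = u r := by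
  rw [Perm.mul_apply, g_p₂ h]
theorem mul_g_out (hq : P.Out q) (hqr : q ≠ r) (u : Perm α) : (u * P.g r) q = u q := by
  rw [Perm.mul_apply, g_out hq hqr]
theorem mul_t_out (hq : P.Out q) (u : Perm α) : (u * P.t) q = u q := by
  rw [Perm.mul_apply, t_out hq]
theorem mul_t_p₂ (u : Perm α) : (u * P.t) P.p₂ = u P.p₂ := by
  rw [Perm.mul_apply, t_p₂]
theorem mul_ρ_p₁ (u : Perm α) : (u * P.ρ) P.p₁ = u P.p₂ := by
  rw [Perm.mul_apply, ρ_p₁]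
theorem mul_ρ_inv_p₀ (u : Perm α) : (u * P.ρ⁻¹) P.p₀ = u P.p₂ := by
  rw [Perm.mul_apply, ρ_inv_p₀]

theorem g_mul_t (hr : P.Out r) (u : Perm α) : u * P.g r * P.t = u * P.t * P.g r := by
  have h : P.g r * P.t = P.t * P.g r := by
    ext q
    rw [Perm.mul_apply, Perm.mul_apply]
    rcases P.cases_pos q with rfl | rfl | rfl | hq
    · rw [t_p₀, g_p₁ hr, g_p₀ hr, t_p₁]
    · rw [t_p₁, g_p₁ hr, g_p₀ hr, t_p₀]
    · rw [t_p₂, g_p₂ hr, t_out hr]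
    · rw [t_out hq]
      by_cases hqr : q = r
      · rw [hqr, g_self, t_p₂]
      · rw [g_out hq hqr, t_out hq]
  rw [mul_assoc, h, mul_assoc]

omit [DecidableEq α] in
theorem ne_of_apply {q q' : α} {s : α} (h : u q = s) (hq : q' ≠ q) : u q' ≠ s :=
  fun h' => hq (u.injective (h'.trans h.symm))

variable [Fintype α]

/-- The positions other than the distinguished ones and `m`. -/
def spare (P : Frame α) (m : α) : Finset α := {P.p₀, P.p₁, P.p₂, m}ᶜ

theorem mem_spare : q ∈ P.spare m ↔ P.Out q ∧ q ≠ m := by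
  simp [spare, Out, and_assoc]

theorem card_spare (hm : P.Out m) : (P.spare m).card + 4 = Fintype.card α := by
  have h4 : ({P.p₀, P.p₁, P.p₂, m} : Finset α).card = 4 := by
    have h := hm.1.symm
    have h' := hm.2.1.symm
    have h'' := hm.2.2.symm
    simp [P.h₀₁, P.h₀₂, P.h₁₂, h, h', h'']
  have := Finset.card_le_univ ({P.p₀, P.p₁, P.p₂, m} : Finset α)
  rw [spare, Finset.card_compl]
  omega

/-- The permutations with symbol `i` at position `q`. -/
def sect (q i : α) : Set (Perm α) := {u | u q = i}

/-- The permutations with symbol `i` at one of the first two distinguished positions. -/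
def front (P : Frame α) (i : α) : Set (Perm α) := {u | u P.p₀ = i ∨ u P.p₁ = i}

variable {i : α}

omit [DecidableEq α] [Fintype α] in
theorem sect_eq_base (h : v q = i) : sect q i = P.base ∅ {q} v := by
  ext u
  simp [sect, base, h]

theorem sect_kconn (hn : 4 ≤ Fintype.card α) (hq : P.Out q) :
    KConn P.graph (sect q i) (Fintype.card α - 1) := by
  rw [sect_eq_base (P := P) (swap_apply_left q i), show Fintype.card α - 1 =
    (Fintype.card α - 4) + 3 - (∅ : Finset α).card by rw [Finset.card_empty]; omega]
  exact base_kconn (by simp) _ (by simpa using hq) (by simp; omega)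

theorem front_kconn (hn : 3 ≤ Fintype.card α) :
    KConn P.graph (P.front i) (Fintype.card α - 1) := by
  rw [show P.front i = P.base {i} ∅ 1 by ext; simp [front, base], show Fintype.card α - 1 =
    (Fintype.card α - 3) + 3 - ({i} : Finset α).card by rw [Finset.card_singleton]; omega]
  exact base_kconn (by simp) _ (by simp) (by simp; omega)

theorem sect_conn (hn : 4 ≤ Fintype.card α) (hq : P.Out q) : Conn P.graph (sect q i) :=
  (sect_kconn hn hq).conn (by omega)

end Frame

/-- A fan from `w` to `T` together with one more connected piece `FU` joining `w` to `Y`. -/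
structure IsDoubleFan {V : Type*} (G : SimpleGraph V) (H : Set V) (w : V) (T Y : Finset V)
    (F : V → Set V) (FU : Set V) : Prop where
  mem : ∀ t ∈ T, t ∈ insert w (F t)
  conn : ∀ t ∈ T, Conn G (insert w (F t))
  sub : ∀ t ∈ T, F t ⊆ H \ {w}
  disj : ∀ t ∈ T, ∀ t' ∈ T, t ≠ t' → Disjoint (F t) (F t')
  memU : ↑Y ⊆ insert w FU
  connU : Conn G (insert w FU)
  subU : FU ⊆ H \ {w}
  disjU : ∀ t ∈ T, Disjoint (F t) FU

theorem exists_doubleFan_of_kconn {V : Type*} [Fintype V] [DecidableEq V] {G : SimpleGraph V}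
    {A H R R' : Set V} {w : V} {T Y : Finset V} {k : ℕ} (hAH : A ⊆ H) (hRH : R ⊆ H)
    (hRH' : R' ⊆ H) (hAR : Disjoint A R) (hAR' : Disjoint A R') (hRR : Disjoint R R')
    (hw : w ∈ R) (hR : KConn G R k) (hR' : Conn G R')
    (θ θ' : V → V) (hθi : Function.Injective θ) (hθR : ∀ u ∈ A, θ u ∈ R)
    (hθ : ∀ u, G.Adj u (θ u)) (hθR' : ∀ u ∈ A, θ' u ∈ R') (hθ' : ∀ u, G.Adj u (θ' u))
    (hT : ↑T ⊆ A) (hY : ↑Y ⊆ A) (hTk : T.card + 1 ≤ k) (hYne : Y.Nonempty)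
    (hTY : Disjoint T Y) : ∃ F FU, IsDoubleFan G H w T Y F FU := by
  obtain ⟨y, hy⟩ := hYne
  obtain ⟨F, hF, hFd⟩ := hR.exists_fan hw ((insert y T).image θ) (by
    intro u hu
    obtain ⟨a, ha, rfl⟩ := Finset.mem_image.1 (Finset.mem_coe.1 hu)
    rcases Finset.mem_insert.1 ha with rfl | ha
    · exact hθR _ (hY hy)
    · exact hθR _ (hT ha)) (by
    have h1 := Finset.card_erase_le (s := (insert y T).image θ) (a := w)
    have h2 := Finset.card_image_le (s := insert y T) (f := θ)
    have h3 := Finset.card_insert_le y T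
    omega)
  have hF' : ∀ t ∈ insert y T, θ t ∈ insert w (F (θ t)) ∧ Conn G (insert w (F (θ t))) ∧
    F (θ t) ⊆ R \ {w} := fun t ht => hF _ (Finset.mem_image_of_mem θ ht)
  have hFd' : ∀ t ∈ insert y T, ∀ t' ∈ insert y T, t ≠ t' → Disjoint (F (θ t)) (F (θ t')) :=
    fun t ht t' ht' h => hFd _ (Finset.mem_image_of_mem θ ht) _ (Finset.mem_image_of_mem θ ht')
      fun h' => h (hθi h')
  have hwA : w ∉ A := fun h => Set.disjoint_left.1 hAR h hw
  have hwR' : w ∉ R' := fun h => Set.disjoint_left.1 hRR hw h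
  have hsubT : ∀ t ∈ T, t ∈ insert y T := fun t ht => Finset.mem_insert_of_mem ht
  have hyT : y ∈ insert y T := Finset.mem_insert_self y T
  have hnT : ∀ t ∈ T, t ∉ Y := fun t ht ht' => Finset.disjoint_left.1 hTY ht ht'
  have hAF : ∀ t ∈ A, ∀ t' ∈ insert y T, t ∉ F (θ t') := fun t ht t' ht' h =>
    Set.disjoint_left.1 hAR ht ((hF' t' ht').2.2 h).1
  refine ⟨fun t => insert t (F (θ t)), ↑Y ∪ R' ∪ F (θ y), ⟨?_, ?_, ?_, ?_, ?_, ?_, ?_, ?_⟩⟩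
  · intro t ht; simp
  · intro t ht
    rw [Set.insert_comm]
    exact (hF' t (hsubT t ht)).2.1.insert_adj (hF' t (hsubT t ht)).1 (hθ t)
  · rintro t ht u (rfl | hu)
    · exact ⟨hAH (hT ht), fun h => hwA (h ▸ hT ht)⟩
    · have := (hF' t (hsubT t ht)).2.2 hu
      exact ⟨hRH this.1, this.2⟩
  · intro t ht t' ht' hne
    rw [Set.disjoint_left]
    rintro u (rfl | hu) (rfl | hu')
    · exact hne rfl
    · exact hAF _ (hT ht) t' (hsubT t' ht') hu'
    · exact hAF _ (hT ht') t (hsubT t ht) hu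
    · exact Set.disjoint_left.1 (hFd' t (hsubT t ht) t' (hsubT t' ht') hne) hu hu'
  · exact fun u hu => Or.inr (Or.inl (Or.inl hu))
  · have h1 : Conn G (R' ∪ Y) := hR'.union_of_adj fun u hu => ⟨θ' u, hθR' u (hY hu), hθ' u⟩
    have h2 := h1.union_adj (hF' y hyT).2.1 (Or.inr hy) (hF' y hyT).1 (hθ y)
    convert h2 using 1
    ext u
    simp only [Set.mem_insert_iff, Set.mem_union]
    tauto
  · rintro u ((hu | hu) | hu)
    · exact ⟨hAH (hY hu), fun h => hwA (h ▸ hY hu)⟩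
    · exact ⟨hRH' hu, fun h => hwR' (h ▸ hu)⟩
    · have := (hF' y hyT).2.2 hu
      exact ⟨hRH this.1, this.2⟩
  · intro t ht
    rw [Set.disjoint_left]
    rintro u (rfl | hu) ((hu' | hu') | hu')
    · exact hnT _ ht hu'
    · exact Set.disjoint_left.1 hAR' (hT ht) hu'
    · exact hAF _ (hT ht) y hyT hu'
    · exact hAF _ (hY hu') t (hsubT t ht) hu
    · exact Set.disjoint_left.1 hRR ((hF' t (hsubT t ht)).2.2 hu).1 hu'
    · have : t ≠ y := fun h => hnT t ht (h ▸ hy)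
      exact Set.disjoint_left.1 (hFd' t (hsubT t ht) y hyT this) hu hu'

namespace Frame

variable {α : Type*} [DecidableEq α] [Fintype α] {P : Frame α} {w : Perm α} {m q i : α}

/-- Two channels from `w` to two further elements of its section run through the front. -/
theorem front_insert_kconn (hn : 4 ≤ Fintype.card α) (hw : w P.p₂ = i) :
    KConn P.graph (insert w (P.front i)) 2 := by
  classical
  intro X hX
  have hB : Conn P.graph (P.front i \ X) := front_kconn (by omega) X (by omega)
  by_cases hwX : w ∈ X
  · convert hB using 1
    ext u
    simp only [Set.mem_sdiff, Set.mem_insert_iff, Finset.mem_coe]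
    constructor
    · rintro ⟨rfl | h, h'⟩
      · exact absurd hwX h'
      · exact ⟨h, h'⟩
    · exact fun h => ⟨Or.inr h.1, h.2⟩
  have hne : w * P.ρ ≠ w * P.ρ⁻¹ := fun h => by
    have := congrArg (fun u : Perm α => u P.p₁) h
    simp only [Perm.mul_apply, ρ_p₁, ρ_inv_p₁] at this
    exact P.h₀₂.symm (w.injective this)
  obtain ⟨z, hzB, hzX, hwz⟩ : ∃ z, z ∈ P.front i ∧ z ∉ X ∧ P.graph.Adj w z := by
    by_cases h : w * P.ρ ∈ X
    · refine ⟨w * P.ρ⁻¹, Or.inl ((mul_ρ_inv_p₀ w).trans hw), fun h' => ?_, adj_ρ_inv w⟩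
      exact hne (Finset.card_le_one.1 (by omega : X.card ≤ 1) _ h _ h')
    · exact ⟨w * P.ρ, Or.inr ((mul_ρ_p₁ w).trans hw), h, adj_ρ w⟩
  have := hB.insert_adj (v := z) ⟨hzB, hzX⟩ hwz
  convert this using 1
  ext u
  simp only [Set.mem_sdiff, Set.mem_insert_iff, Finset.mem_coe]
  constructor
  · rintro ⟨h | h, h'⟩
    · exact Or.inl h
    · exact Or.inr ⟨h, h'⟩
  · rintro (rfl | h)
    · exact ⟨Or.inl rfl, hwX⟩
    · exact ⟨Or.inr h.1, h.2⟩

/-- Disjoint channels from `w` to `n - 3` further elements of its section, avoiding a prescribed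
section `q`. -/
theorem exists_channels (hn : 5 ≤ Fintype.card α) (hm : P.Out m) (hq : q ∈ P.spare m)
    (hw : w P.p₂ = i) (T : Finset (Perm α)) (hT : ∀ u ∈ T, u P.p₂ = i ∧ u ≠ w)
    (hTc : T.card + 3 = Fintype.card α) :
    ∃ K : Perm α → Set (Perm α), (∀ t ∈ T, (∃ a ∈ insert w (K t), P.graph.Adj t a) ∧
      Conn P.graph (insert w (K t)) ∧ K t ⊆ {u | u m ≠ i ∧ u P.p₂ ≠ i ∧ u q ≠ i}) ∧
      ∀ t ∈ T, ∀ t' ∈ T, t ≠ t' → Disjoint (K t) (K t') := by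
  classical
  obtain ⟨T₂, hT₂, hT₂c⟩ := Finset.exists_subset_card_eq (show 2 ≤ T.card by omega)
  have hwB : w ∉ P.front i := fun h => h.elim (ne_of_apply hw P.h₀₂) (ne_of_apply hw P.h₁₂)
  have hinj : Function.Injective fun u : Perm α => u * P.ρ := mul_left_injective _
  have hρB : ∀ u : Perm α, u P.p₂ = i → u * P.ρ ∈ P.front i := fun u hu =>
    Or.inr ((mul_ρ_p₁ u).trans hu)
  obtain ⟨F, hF, hFd⟩ := (front_insert_kconn (by omega) hw).exists_fan (Set.mem_insert w _)
    (T₂.image fun u => u * P.ρ) (by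
      intro u hu
      obtain ⟨a, ha, rfl⟩ := Finset.mem_image.1 (Finset.mem_coe.1 hu)
      exact Or.inr (hρB a (hT a (hT₂ ha)).1)) (by
      rw [← hT₂c]
      exact (Finset.card_erase_le).trans Finset.card_image_le)
  have hQ : ((P.spare m).erase q).card + 5 = Fintype.card α := by
    have := card_spare hm
    have := Finset.card_pos.2 ⟨q, hq⟩
    rw [Finset.card_erase_of_mem hq]
    omega
  have hTT : (T \ T₂).card = ((P.spare m).erase q).card := by
    rw [Finset.card_sdiff_of_subset hT₂]; omega
  let e := Finset.equivOfCardEq hTT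
  let K : Perm α → Set (Perm α) := fun t => if h : t ∈ T \ T₂ then sect (e ⟨t, h⟩).1 i else
    F (t * P.ρ)
  have he : ∀ t (h : t ∈ T \ T₂), P.Out (e ⟨t, h⟩).1 ∧ (e ⟨t, h⟩).1 ≠ m ∧ (e ⟨t, h⟩).1 ≠ q := by
    intro t h
    have := Finset.mem_erase.1 (e ⟨t, h⟩).2
    rw [mem_spare] at this
    exact ⟨this.2.1, this.2.2, this.1⟩
  have hTcase : ∀ t ∈ T, t ∉ T \ T₂ → t ∈ T₂ := fun t ht h => by
    by_contra h'
    exact h (Finset.mem_sdiff.2 ⟨ht, h'⟩)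
  have hFT : ∀ t ∈ T₂, F (t * P.ρ) ⊆ P.front i := fun t ht u hu => by
    have := (hF _ (Finset.mem_image_of_mem _ ht)).2.2 hu
    exact this.1.resolve_left this.2
  refine ⟨K, fun t ht => ?_, fun t ht t' ht' hne => ?_⟩
  · by_cases h : t ∈ T \ T₂
    · obtain ⟨h1, h2, h3⟩ := he t h
      simp only [K, dif_pos h]
      refine ⟨⟨t * P.g _, Or.inr ?_, adj_g t h1⟩, (sect_conn (by omega) h1).insert_adj
        (v := w * P.g _) ?_ (adj_g w h1), fun u hu => ?_⟩
      · exact (mul_g_self t).trans (hT t ht).1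
      · exact (mul_g_self w).trans hw
      · exact ⟨ne_of_apply hu h2.symm, ne_of_apply hu h1.2.2.symm, ne_of_apply hu h3.symm⟩
    · have h2 := hTcase t ht h
      obtain ⟨h3, h4, h5⟩ := hF _ (Finset.mem_image_of_mem _ h2)
      simp only [K, dif_neg h]
      refine ⟨⟨_, h3, adj_ρ t⟩, h4, fun u hu => ?_⟩
      rw [mem_spare] at hq
      rcases hFT t h2 hu with h | h
      · exact ⟨ne_of_apply h hm.1, ne_of_apply h P.h₀₂.symm, ne_of_apply h hq.1.1⟩
      · exact ⟨ne_of_apply h hm.2.1, ne_of_apply h P.h₁₂.symm, ne_of_apply h hq.1.2.1⟩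
  · have hmix : ∀ t ∈ T, ∀ t' ∈ T, ∀ h : t ∈ T \ T₂, t' ∉ T \ T₂ →
        Disjoint (sect (e ⟨t, h⟩).1 i) (F (t' * P.ρ)) := by
      intro t ht t' ht' h h'
      rw [Set.disjoint_left]
      intro u hu hu'
      rcases hFT t' (hTcase t' ht' h') hu' with h3 | h3
      · exact ne_of_apply h3 (he t h).1.1 hu
      · exact ne_of_apply h3 (he t h).1.2.1 hu
    by_cases h : t ∈ T \ T₂ <;> by_cases h' : t' ∈ T \ T₂
    · simp only [K, dif_pos h, dif_pos h']
      rw [Set.disjoint_left]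
      intro u hu hu'
      have : (e ⟨t, h⟩).1 ≠ (e ⟨t', h'⟩).1 := fun h => hne (by
        have := e.injective (Subtype.ext h)
        exact congrArg Subtype.val this)
      exact ne_of_apply hu this.symm hu'
    · simp only [K, dif_pos h, dif_neg h']
      exact hmix t ht t' ht' h h'
    · simp only [K, dif_neg h, dif_pos h']
      exact (hmix t' ht' t ht h' h).symm
    · simp only [K, dif_neg h, dif_neg h']
      exact hFd _ (Finset.mem_image_of_mem _ (hTcase t ht h)) _
        (Finset.mem_image_of_mem _ (hTcase t' ht' h')) fun h => hne (hinj h)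

end Frame

namespace Frame

variable {α : Type*} [DecidableEq α] [Fintype α] {P : Frame α} {w s : Perm α} {m q i : α}
  {T Y : Finset (Perm α)}

theorem doubleFan_of_special (hn : 5 ≤ Fintype.card α) (hm : P.Out m) (hq : q ∈ P.spare m)
    (hw : w P.p₂ = i) (hT : ∀ u ∈ T, u P.p₂ = i) (hTc : T.card + 2 = Fintype.card α)
    (hs : s ∈ T) (hwT : ∀ t ∈ T, t ≠ s → t ≠ w) {Fs FU : Set (Perm α)}
    (hsF : s ∈ insert w Fs) (hFs : Conn P.graph (insert w Fs))
    (hFsub : ∀ u ∈ Fs, u ≠ w ∧ (u P.p₂ = i ∨ u q = i)) (hYF : ↑Y ⊆ insert w FU)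
    (hFU : Conn P.graph (insert w FU)) (hUsub : ∀ u ∈ FU, u ≠ w ∧ (u P.p₂ = i ∨ u q = i))
    (hd : Disjoint Fs FU) (hTF : ∀ t ∈ T, t ≠ s → t ∉ Fs ∧ t ∉ FU) :
    ∃ F FU, IsDoubleFan P.graph {u | u m ≠ i} w T Y F FU := by
  have hTs : ∀ t ∈ T, t ≠ s → t ∈ T.erase s := fun t ht h => Finset.mem_erase.2 ⟨h, ht⟩
  obtain ⟨K, hK, hKd⟩ := exists_channels hn hm hq hw (T.erase s) (fun u hu => by
    rw [Finset.mem_erase] at hu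
    exact ⟨hT u hu.2, hwT u hu.2 hu.1⟩) (by rw [Finset.card_erase_of_mem hs]; omega)
  rw [mem_spare] at hq
  have hH : ∀ u : Perm α, u P.p₂ = i ∨ u q = i → u m ≠ i := fun u hu =>
    hu.elim (fun h => ne_of_apply h hm.2.2) fun h => ne_of_apply h hq.2.symm
  have hKF : ∀ t ∈ T, t ≠ s → ∀ A : Set (Perm α), (∀ u ∈ A, u ≠ w ∧ (u P.p₂ = i ∨ u q = i)) →
      t ∉ A → Disjoint (insert t (K t)) A := by
    intro t ht hts A hA htA
    rw [Set.disjoint_left]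
    rintro u (rfl | hu) hu'
    · exact htA hu'
    · have := (hK t (hTs t ht hts)).2.2 hu
      exact (hA u hu').2.elim this.2.1 this.2.2
  refine ⟨fun t => if t = s then Fs else insert t (K t), FU, ⟨?_, ?_, ?_, ?_, hYF, hFU,
    fun u hu => ⟨hH u (hUsub u hu).2, (hUsub u hu).1⟩, ?_⟩⟩
  · intro t ht
    by_cases h : t = s
    · subst h; simpa using hsF
    · simp [h]
  · intro t ht
    by_cases h : t = s
    · subst h; simpa using hFs
    · simp only [h, if_false]
      obtain ⟨⟨a, ha, hta⟩, hc, -⟩ := hK t (hTs t ht h)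
      rw [Set.insert_comm]
      exact hc.insert_adj ha hta
  · intro t ht
    by_cases h : t = s
    · subst h
      simp only [if_true]
      exact fun u hu => ⟨hH u (hFsub u hu).2, (hFsub u hu).1⟩
    · simp only [h, if_false]
      rintro u (rfl | hu)
      · exact ⟨hH u (Or.inl (hT u ht)), hwT u ht h⟩
      · have := (hK t (hTs t ht h)).2.2 hu
        exact ⟨this.1, fun h' => this.2.1 (by rw [Set.mem_singleton_iff.1 h', hw])⟩
  · intro t ht t' ht' hne
    by_cases h : t = s <;> by_cases h' : t' = s
    · exact absurd (h.trans h'.symm) hne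
    · simp only [h, h', if_false, if_true]
      exact (hKF t' ht' h' Fs hFsub (hTF t' ht' h').1).symm
    · simp only [h, h', if_false, if_true]
      exact hKF t ht h Fs hFsub (hTF t ht h).1
    · simp only [h, h', if_false]
      rw [Set.disjoint_left]
      have h1 := (hK t (hTs t ht h)).2.2
      have h2 := (hK t' (hTs t' ht' h')).2.2
      rintro u (rfl | hu) (rfl | hu')
      · exact hne rfl
      · exact (h2 hu').2.1 (hT u ht)
      · exact (h1 hu).2.1 (hT u ht')
      · exact Set.disjoint_left.1 (hKd t (hTs t ht h) t' (hTs t' ht' h') hne) hu hu'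
  · intro t ht
    by_cases h : t = s
    · simpa [h] using hd
    · simp only [h, if_false]
      exact hKF t ht h FU hUsub (hTF t ht h).2

theorem exists_doubleFan_of_adj (hn : 5 ≤ Fintype.card α) (hm : P.Out m) (hq : q ∈ P.spare m)
    (hw : w P.p₂ = i) (hT : ∀ u ∈ T, u P.p₂ = i) (hY : ∀ u ∈ Y, u P.p₂ = i)
    (hTc : T.card + 2 = Fintype.card α) (hTY : Disjoint T Y)
    (hs : s ∈ T) (hsw : s = w ∨ w ∉ T ∧ P.graph.Adj s w) :
    ∃ F FU, IsDoubleFan P.graph {u | u m ≠ i} w T Y F FU := by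
  have hq' := (mem_spare.1 hq).1
  have h2q : ∀ u : Perm α, u P.p₂ = i → u q ≠ i := fun u hu => ne_of_apply hu hq'.2.2
  have hTYn : ∀ t ∈ T, t ∉ Y := fun t ht ht' => Finset.disjoint_left.1 hTY ht ht'
  refine doubleFan_of_special hn hm hq hw hT hTc hs (Fs := {s} \ {w}) (FU := sect q i ∪ (Y \ {w}))
    ?_ ?_ ?_ ?_ ?_ ?_ ?_ ?_ ?_
  · rcases hsw with rfl | h
    · exact fun t _ h => h
    · exact fun t ht _ h' => h.1 (h' ▸ ht)
  · by_cases h : s = w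
    · exact Or.inl h
    · exact Or.inr ⟨rfl, h⟩
  · rw [Set.insert_sdiff_singleton]
    rcases hsw with rfl | h
    · simpa using conn_singleton s
    · exact (conn_singleton s).insert_adj rfl h.2.symm
  · rintro u ⟨h, h'⟩
    exact ⟨h', Or.inl (by rw [Set.mem_singleton_iff.1 h, hT s hs])⟩
  · intro u hu
    by_cases h : u = w
    · exact Or.inl h
    · exact Or.inr (Or.inr ⟨hu, h⟩)
  · have := (sect_conn (i := i) (by omega) hq').union_of_adj (B := insert w (↑Y \ {w}))
      (fun u hu => ⟨u * P.g q, (mul_g_self u).trans (by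
        rcases hu with rfl | hu
        · exact hw
        · exact hY u hu.1), adj_g u hq'⟩)
    convert this using 1
    ext u
    simp only [Set.mem_insert_iff, Set.mem_union]
    tauto
  · rintro u (h | h)
    · exact ⟨fun h' => h2q u (h' ▸ hw) h, Or.inr h⟩
    · exact ⟨h.2, Or.inl (hY u h.1)⟩
  · rw [Set.disjoint_left]
    rintro u ⟨rfl, h⟩ (h' | h')
    · exact h2q u (hT u hs) h'
    · exact hTYn u hs h'.1
  · intro t ht hts
    refine ⟨fun h => hts h.1, ?_⟩
    rintro (h | h)
    · exact h2q t (hT t ht) h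
    · exact hTYn t ht h.1

theorem exists_doubleFan_of_mem (hn : 5 ≤ Fintype.card α) (hm : P.Out m) (hq : q ∈ P.spare m)
    (hw : w P.p₂ = i) (hT : ∀ u ∈ T, u P.p₂ = i) (hY : ∀ u ∈ Y, u P.p₂ = i)
    (hTc : T.card + 2 = Fintype.card α) (hYc : Y.card ≤ 3) (hTY : Disjoint T Y)
    (hwY : w ∈ Y) (hwT : w * P.t ∉ T) :
    ∃ F FU, IsDoubleFan P.graph {u | u m ≠ i} w T Y F FU := by
  have hq' := (mem_spare.1 hq).1
  have h2q : ∀ u : Perm α, u P.p₂ = i → u q ≠ i := fun u hu => ne_of_apply hu hq'.2.2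
  have hTYn : ∀ t ∈ T, t ∉ Y := fun t ht ht' => Finset.disjoint_left.1 hTY ht ht'
  let γ : Perm α → Perm α := fun u => u * P.g q
  have hγγ : ∀ u, γ (γ u) = u := fun u => mul_g_g u hq'
  have hγi : Function.Injective γ := fun a b h => by rw [← hγγ a, h, hγγ]
  have hγt : ∀ u, γ u * P.t = γ (u * P.t) := g_mul_t hq'
  have hγa : ∀ u, P.graph.Adj u (γ u) := fun u => adj_g u hq'
  have hγV : ∀ u : Perm α, u P.p₂ = i → γ u ∈ sect q i := fun u hu => (mul_g_self u).trans hu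
  have hti : Function.Injective fun u : Perm α => u * P.t := mul_left_injective _
  let Z := (Y.erase w).erase (w * P.t)
  have hZ : ∀ z, z ∈ Z ↔ z ∈ Y ∧ z ≠ w ∧ z ≠ w * P.t := fun z => by
    simp only [Z, Finset.mem_erase]; tauto
  have hZc : Z.card ≤ 2 := Finset.card_erase_le.trans (by
    rw [Finset.card_erase_of_mem hwY]; omega)
  obtain ⟨s, hs, hsZ⟩ : ∃ s ∈ T, s * P.t ∉ Z := by
    by_contra! h
    have h1 := Finset.card_le_card_of_injOn (fun u => u * P.t) h hti.injOn
    omega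
  have hsw : s ≠ w := fun h => hTYn s hs (h ▸ hwY)
  have hsw' : s ≠ w * P.t := fun h => hwT (h ▸ hs)
  have hwbar : w * P.t ≠ w := fun h => by simpa using (adj_t (P := P) w).ne h.symm
  have hsY := hTYn s hs
  have hD : ∀ r ∈ ({q} : Finset α), P.Out r := by simpa using hq'
  have hVb : P.base ∅ {q} (γ w) = sect q i := (sect_eq_base (hγV w hw)).symm
  have hL : ∀ v : Perm α, KConn P.graph (P.layer ∅ {q} v) 3 := fun v =>
    (layer_kconn (f := Fintype.card α - 4) (by simp) v hD (by simp; omega)).mono (by simp; omega)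
  have hL1 : P.layer ∅ {q} (γ w * P.t) = {u | u ∈ sect q i ∧ Perm.sign u = -Perm.sign (γ w)} := by
    rw [← opposite_layer hD ⟨fun _ _ => rfl, by simp⟩, hVb]
  have hL0 : P.layer ∅ {q} (γ w) = {u | u ∈ sect q i ∧ Perm.sign u = Perm.sign (γ w)} := by
    rw [layer, hVb]
  have hA0 : Conn P.graph ({u | u ∈ sect q i ∧ Perm.sign u = Perm.sign (γ w)} \ (Z.image γ)) := by
    rw [← hL0]; exact hL _ _ (Finset.card_image_le.trans_lt (by omega))
  have hA1 : Conn P.graph ({u | u ∈ sect q i ∧ Perm.sign u = -Perm.sign (γ w)} \ ({γ s} :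
      Finset (Perm α))) := by
    rw [← hL1]; exact hL _ _ (by simp)
  set A0 := {u | u ∈ sect q i ∧ Perm.sign u = Perm.sign (γ w)} with hA0d
  set A1 := {u | u ∈ sect q i ∧ Perm.sign u = -Perm.sign (γ w)} with hA1d
  have hVt : ∀ u, u ∈ sect q i → u * P.t ∈ sect q i := fun u hu => (mul_t_out hq' u).trans hu
  have h01 : ∀ u, u ∈ sect q i → u ∈ A0 ∨ u ∈ A1 := fun u hu =>
    (units_eq_or_eq_neg (Perm.sign u) (Perm.sign (γ w))).imp (fun h => ⟨hu, h⟩) fun h => ⟨hu, h⟩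
  have h0t : ∀ u, u ∈ A0 → u * P.t ∈ A1 := fun u hu => ⟨hVt u hu.1, by simp [hu.2]⟩
  have h1t : ∀ u, u ∈ A1 → u * P.t ∈ A0 := fun u hu => ⟨hVt u hu.1, by simp [hu.2]⟩
  have hd01 : ∀ u, u ∈ A0 → u ∉ A1 := fun u h h' => units_ne_neg _ (h.2.symm.trans h'.2)
  have hγZ : ∀ u, γ u ∈ Z.image γ ↔ u ∈ Z := fun u =>
    ⟨fun h => by
      obtain ⟨z, hz, h⟩ := Finset.mem_image.1 h
      exact hγi h ▸ hz, fun h => Finset.mem_image_of_mem _ h⟩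
  have hZV : ∀ z ∈ Z, z P.p₂ = i := fun z hz => hY z ((hZ z).1 hz).1
  have hγZV : ∀ u ∈ Z.image γ, u ∈ sect q i := fun u hu => by
    obtain ⟨z, hz, rfl⟩ := Finset.mem_image.1 hu
    exact hγV z (hZV z hz)
  have hsi := hT s hs
  refine doubleFan_of_special hn hm hq hw hT hTc hs
    (Fs := insert s (insert (γ s) (A0 \ Z.image γ)))
    (FU := insert (w * P.t) (↑Z ∪ (Z.image γ ∪ (A1 \ ({γ s} : Finset (Perm α))))))
    ?_ ?_ ?_ ?_ ?_ ?_ ?_ ?_ ?_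
  · rintro t ht - rfl
    exact hTYn t ht hwY
  · simp
  · have hγs : Conn P.graph (insert (γ s) (A0 \ Z.image γ)) := by
      rcases h01 _ (hγV s hsi) with h | h
      · rw [Set.insert_eq_of_mem]
        · exact hA0
        · exact ⟨h, fun h' => hsY ((hZ s).1 ((hγZ s).1 h')).1⟩
      · refine hA0.insert_adj (v := γ s * P.t) ⟨h1t _ h, fun h' => ?_⟩ (adj_t _)
        rw [hγt, Finset.mem_coe, hγZ] at h'
        exact hsZ h'
    refine (hγs.insert_adj (v := γ s) (Set.mem_insert _ _) (hγa s)).insert_adj (v := γ w) ?_ (hγa w)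
    refine Or.inr (Or.inr ⟨⟨hγV w hw, rfl⟩, fun h => ?_⟩)
    exact ((hZ w).1 ((hγZ w).1 h)).2.1 rfl
  · rintro u (rfl | rfl | h)
    · exact ⟨hsw, Or.inl hsi⟩
    · exact ⟨fun h => h2q w hw (h ▸ hγV s hsi), Or.inr (hγV s hsi)⟩
    · exact ⟨fun h' => h2q w hw (h' ▸ h.1.1), Or.inr h.1.1⟩
  · intro u hu
    by_cases h : u = w
    · exact Or.inl h
    · by_cases h' : u = w * P.t
      · exact Or.inr (Or.inl h')
      · exact Or.inr (Or.inr (Or.inl ((hZ u).2 ⟨hu, h, h'⟩)))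
  · have hA1mem : ∀ u : Perm α, u P.p₂ = i → γ u ∈ A1 → s ≠ u → γ u ∈ A1 \ ({γ s} : Finset _) :=
      fun u _ h h' => ⟨h, by simpa using fun h'' => h' (hγi h'').symm⟩
    have h1 : Conn P.graph ((A1 \ ({γ s} : Finset (Perm α))) ∪ Z.image γ) := by
      refine hA1.union_of_adj_or_mem fun u hu => ?_
      obtain ⟨z, hz, rfl⟩ := Finset.mem_image.1 (Finset.mem_coe.1 hu)
      rcases h01 _ (hγZV _ hu) with h | h
      · refine Or.inr ⟨_, ?_, adj_t _⟩
        rw [hγt]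
        refine hA1mem _ ((mul_t_p₂ z).trans (hZV z hz)) (hγt z ▸ h0t _ h) fun h' => hsZ ?_
        rw [h', mul_t_t]
        exact hz
      · exact Or.inl (hA1mem _ (hZV z hz) h fun h' => hsY ((hZ s).1 (h' ▸ hz)).1)
    have h2 := (h1.union_of_adj (B := Z) fun z hz =>
      ⟨γ z, Or.inr (Finset.mem_image_of_mem γ hz), hγa z⟩).insert_adj (u := w * P.t)
        (v := γ (w * P.t)) (Or.inl (Or.inl (hA1mem _ ((mul_t_p₂ w).trans hw)
          (hγt w ▸ h0t _ ⟨hγV w hw, rfl⟩) hsw'))) (hγa _)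
    convert h2.insert_adj (Set.mem_insert _ _) (adj_t w) using 3
    ext u
    simp only [Set.mem_union]
    tauto
  · rintro u (rfl | h | h | h)
    · exact ⟨hwbar, Or.inl ((mul_t_p₂ w).trans hw)⟩
    · exact ⟨((hZ u).1 h).2.1, Or.inl (hZV u h)⟩
    · exact ⟨fun h' => h2q w hw (h' ▸ hγZV u h), Or.inr (hγZV u h)⟩
    · exact ⟨fun h' => h2q w hw (h' ▸ h.1.1), Or.inr h.1.1⟩
  · rw [Set.disjoint_left]
    rintro u (rfl | rfl | h) (h' | h' | h' | h')
    · exact hsw' h'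
    · exact hsY ((hZ u).1 h').1
    · exact h2q u hsi (hγZV u h')
    · exact h2q u hsi h'.1.1
    · exact h2q _ ((mul_t_p₂ w).trans hw) (h' ▸ hγV s hsi)
    · exact h2q _ (hZV _ h') (hγV s hsi)
    · exact hsY ((hZ s).1 ((hγZ s).1 h')).1
    · exact h'.2 (by simp)
    · exact h2q _ ((mul_t_p₂ w).trans hw) (h' ▸ h.1.1)
    · exact h2q _ (hZV _ h') h.1.1
    · exact h.2 h'
    · exact hd01 _ h.1 h'.1
  · intro t ht hts
    have hti := hT t ht
    constructor
    · rintro (h | rfl | h)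
      · exact hts h
      · exact h2q _ hti (hγV s hsi)
      · exact h2q _ hti h.1.1
    · rintro (rfl | h | h | h)
      · exact hwT ht
      · exact hTYn t ht ((hZ t).1 h).1
      · exact h2q _ hti (hγZV _ h)
      · exact h2q _ hti h.1.1

end Frame

namespace Frame

variable {α : Type*} [DecidableEq α] [Fintype α] {P : Frame α} {w : Perm α} {m i : α}
  {T Y : Finset (Perm α)}

theorem exists_doubleFan (hn : 5 ≤ Fintype.card α) (hm : P.Out m)
    (hwm : w m ≠ i) (hT : ∀ u ∈ T, u P.p₂ = i) (hY : ∀ u ∈ Y, u P.p₂ = i)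
    (hTc : T.card + 2 = Fintype.card α) (hYc : Y.card ≤ 3) (hYne : Y.Nonempty)
    (hTY : Disjoint T Y) (hw : w P.p₂ = i → w ∈ T ∨ w ∈ Y) :
    ∃ F FU, IsDoubleFan P.graph {u | u m ≠ i} w T Y F FU := by
  obtain ⟨q, hq⟩ : (P.spare m).Nonempty := by
    have := card_spare hm
    rw [← Finset.card_pos]; omega
  have hAH : sect P.p₂ i ⊆ {u : Perm α | u m ≠ i} := fun u hu => ne_of_apply hu hm.2.2
  have hBH : P.front i ⊆ {u : Perm α | u m ≠ i} := fun u hu =>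
    hu.elim (fun h => ne_of_apply h hm.1) fun h => ne_of_apply h hm.2.1
  have hAB : Disjoint (sect P.p₂ i) (P.front i) := Set.disjoint_left.2 fun u hu h =>
    h.elim (ne_of_apply hu P.h₀₂) (ne_of_apply hu P.h₁₂)
  have hqH : ∀ q ∈ P.spare m, sect q i ⊆ {u : Perm α | u m ≠ i} := fun q hq u hu =>
    ne_of_apply hu (mem_spare.1 hq).2.symm
  have hAq : ∀ q ∈ P.spare m, Disjoint (sect P.p₂ i) (sect q i) := fun q hq =>
    Set.disjoint_left.2 fun u hu h => ne_of_apply hu (mem_spare.1 hq).1.2.2 h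
  have hBq : ∀ q ∈ P.spare m, Disjoint (P.front i) (sect q i) := fun q hq =>
    Set.disjoint_left.2 fun u hu h => hu.elim
      (fun h' => ne_of_apply h' (mem_spare.1 hq).1.1 h)
      fun h' => ne_of_apply h' (mem_spare.1 hq).1.2.1 h
  have hθB : ∀ u ∈ sect P.p₂ i, u * P.ρ ∈ P.front i := fun u hu => Or.inr ((mul_ρ_p₁ u).trans hu)
  have hθq : ∀ (q : α), ∀ u ∈ sect P.p₂ i, u * P.g q ∈ sect q i := fun q u hu =>
    (mul_g_self u).trans hu
  have hcases : w ∈ P.front i ∨ w P.p₂ = i ∨ ∃ q ∈ P.spare m, w ∈ sect q i := by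
    have h : w (w⁻¹ i) = i := by simp
    rcases P.cases_pos (w⁻¹ i) with h' | h' | h' | h'
    · exact Or.inl (Or.inl (h' ▸ h))
    · exact Or.inl (Or.inr (h' ▸ h))
    · exact Or.inr (Or.inl (h' ▸ h))
    · exact Or.inr (Or.inr ⟨w⁻¹ i, mem_spare.2 ⟨h', fun h'' => hwm (h'' ▸ h)⟩, h⟩)
  rcases hcases with hwB | hw2 | ⟨r, hr, hwr⟩
  · exact exists_doubleFan_of_kconn hAH hBH (hqH q hq) hAB (hAq q hq) (hBq q hq) hwB
      (front_kconn (by omega)) (sect_conn (by omega) (mem_spare.1 hq).1) (fun u => u * P.ρ)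
      (fun u => u * P.g q) (mul_left_injective _) hθB adj_ρ (hθq q)
      (fun u => adj_g u (mem_spare.1 hq).1) hT hY (by omega) hYne hTY
  · rcases hw hw2 with h | h
    · exact exists_doubleFan_of_adj hn hm hq hw2 hT hY hTc hTY h (Or.inl rfl)
    · by_cases h' : w * P.t ∈ T
      · exact exists_doubleFan_of_adj hn hm hq hw2 hT hY hTc hTY h'
          (Or.inr ⟨fun h'' => Finset.disjoint_left.1 hTY h'' h, (adj_t w).symm⟩)
      · exact exists_doubleFan_of_mem hn hm hq hw2 hT hY hTc hYc hTY h h'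
  · exact exists_doubleFan_of_kconn hAH (hqH r hr) hBH (hAq r hr) hAB (hBq r hr).symm hwr
      (sect_kconn (by omega) (mem_spare.1 hr).1) ((front_kconn (by omega)).conn (by omega))
      (fun u => u * P.g r) (fun u => u * P.ρ) (mul_left_injective _) (hθq r)
      (fun u => adj_g u (mem_spare.1 hr).1) hθB adj_ρ hT hY (by omega) hYne hTY

end Frame

section Systems

variable {V : Type*} {G : SimpleGraph V} {C S : Set V} {ι : Type*}

theorem restrictEdges_adj {E : Set (Sym2 V)} {a b : V} (h : G.Adj a b) (hab : a ∉ S ∨ b ∉ S) :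
    (restrictEdges G S E).Adj a b :=
  ⟨h, fun ha hb => (hab.elim (· ha) (· hb)).elim⟩

/-- Disjoint nonempty subsets of `C \ S`, each connecting `S` with the help of some edges inside
`S`, no edge being used twice. -/
structure IsSystem (G : SimpleGraph V) (C S : Set V) (U : ι → Set V) (E : ι → Set (Sym2 V)) :
    Prop where
  nonempty : ∀ l, (U l).Nonempty
  sub : ∀ l, U l ⊆ C \ S
  disj : ∀ l k, l ≠ k → Disjoint (U l) (U k)
  edge : ∀ l, ∀ e ∈ E l, ∀ a ∈ e, a ∈ S
  edisj : ∀ l k, l ≠ k → Disjoint (E l) (E k)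
  conn : ∀ l, Conn (restrictEdges G S (E l)) (U l ∪ S)

/-- There is a system with `k` members. -/
def HasSystem (G : SimpleGraph V) (C S : Set V) (k : ℕ) : Prop :=
  ∃ (U : Fin k → Set V) (E : Fin k → Set (Sym2 V)), IsSystem G C S U E

theorem IsSystem.hasSystem [Fintype ι] {k : ℕ} (hk : Fintype.card ι = k) {U : ι → Set V}
    {E : ι → Set (Sym2 V)} (h : IsSystem G C S U E) : HasSystem G C S k := by
  let e := (Fintype.equivFinOfCardEq hk).symm
  exact ⟨U ∘ e, E ∘ e, fun l => h.nonempty _, fun l => h.sub _,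
    fun l k hlk => h.disj _ _ (e.injective.ne hlk), fun l => h.edge _,
    fun l k hlk => h.edisj _ _ (e.injective.ne hlk), fun l => h.conn _⟩

/-- Adding a member which uses no edge inside `S`. -/
theorem HasSystem.succ {C' : Set V} {k : ℕ} (h : HasSystem G C S k) (hC : C ⊆ C') {A : Set V}
    (hA : A.Nonempty) (hAC : A ⊆ C' \ S) (hd : Disjoint A C)
    (hAc : Conn G A) (hS : ∀ s ∈ S, ∃ a ∈ A, G.Adj s a) :
    HasSystem G C' S (k + 1) := by
  obtain ⟨U, E, h⟩ := h
  refine IsSystem.hasSystem (ι := Option (Fin k)) (by simp) (U := fun l => l.elim A U)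
    (E := fun l => l.elim ∅ E) ⟨?_, ?_, ?_, ?_, ?_, ?_⟩
  · rintro (_ | l)
    · exact hA
    · exact h.nonempty l
  · rintro (_ | l)
    · exact hAC
    · exact (h.sub l).trans (Set.sdiff_subset_sdiff_left hC)
  · have hd' : ∀ l, Disjoint A (U l) := fun l => hd.mono_right ((h.sub l).trans Set.sdiff_subset)
    rintro (_ | l) (_ | k) hlk
    · exact absurd rfl hlk
    · exact hd' k
    · exact (hd' l).symm
    · exact h.disj l k fun h => hlk (congrArg some h)
  · rintro (_ | l)
    · intro e he
      exact absurd he (Set.notMem_empty e)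
    · exact h.edge l
  · rintro (_ | l) (_ | k) hlk
    · exact absurd rfl hlk
    · exact Set.empty_disjoint _
    · exact Set.disjoint_empty _
    · exact h.edisj l k fun h => hlk (congrArg some h)
  · rintro (_ | l)
    · refine (hAc.restrictEdges ?_).union_of_adj fun s hs => ?_
      · exact fun a ha => absurd ha.2 (hAC ha.1).2
      · obtain ⟨a, ha, hsa⟩ := hS s hs
        exact ⟨a, ha, restrictEdges_adj hsa (Or.inr (hAC ha).2)⟩
    · exact h.conn l

/-- A system can be enlarged so as to contain a prescribed vertex. -/
theorem IsSystem.exists_mem [Nonempty ι] {U : ι → Set V} {E : ι → Set (Sym2 V)}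
    (h : IsSystem G C S U E) (hC : Conn G (C \ S)) {v : V} (hv : v ∈ C \ S) :
    ∃ U' : ι → Set V, IsSystem G C S U' E ∧ ∃ l, v ∈ U' l := by
  classical
  obtain ⟨l₀⟩ := ‹Nonempty ι›
  obtain ⟨u, hu⟩ := h.nonempty l₀
  have hr := hC u (h.sub l₀ hu) v hv
  clear hv
  induction hr with
  | refl => exact ⟨U, h, l₀, hu⟩
  | @tail b c _ hbc ih =>
    obtain ⟨U', h', l, hl⟩ := ih
    by_cases hc : ∃ k, c ∈ U' k
    · exact ⟨U', h', hc⟩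
    push Not at hc
    refine ⟨Function.update U' l (insert c (U' l)), ⟨?_, ?_, ?_, h'.edge, h'.edisj, ?_⟩, l,
      by simp⟩
    · intro k
      by_cases hk : k = l
      · subst hk; simp
      · simpa [hk] using h'.nonempty k
    · intro k
      by_cases hk : k = l
      · subst hk
        simpa using Set.insert_subset hbc.2.2 (h'.sub k)
      · simpa [hk] using h'.sub k
    · intro j k hjk
      by_cases hj : j = l
      · subst hj
        simpa [hjk.symm, Set.disjoint_insert_left] using ⟨hc k, h'.disj j k hjk⟩
      · by_cases hk : k = l
        · subst hk
          simpa [hjk, Set.disjoint_insert_right] using ⟨hc j, h'.disj j k hjk⟩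
        · simpa [hj, hk] using h'.disj j k hjk
    · intro k
      by_cases hk : k = l
      · subst hk
        rw [Function.update_self, Set.insert_union]
        exact (h'.conn k).insert_adj (Or.inl hl) (restrictEdges_adj hbc.1.symm (Or.inl hbc.2.2.2))
      · simpa [hk] using h'.conn k

end Systems

section TwoOne

variable {V : Type*} [Fintype V] {G : SimpleGraph V}

/-- A fan from `x` to the neighbours of `y` avoiding `y`. -/
theorem exists_fan_neighbors {R : Set V} {k : ℕ} {x y : V} (hx : x ∈ R) (hy : y ∈ R) (hxy : x ≠ y)
    (hR : KConn G R k) (N T : Finset V) (hN : ∀ u, u ∈ N ↔ u ∈ R ∧ G.Adj y u) (hNk : N.card = k)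
    (hT : ∀ u, u ∈ T ↔ u ∈ N ∧ u ≠ x) :
    ∃ F : V → Set V, (∀ t ∈ T, t ∈ F t ∧ Conn G (insert x (F t)) ∧ F t ⊆ (R \ {y}) \ {x}) ∧
      ∀ t ∈ T, ∀ t' ∈ T, t ≠ t' → Disjoint (F t) (F t') := by
  classical
  have hyN : y ∉ N := fun h => G.loopless.irrefl y ((hN y).1 h).2
  have hTR : (T : Set V) ⊆ R \ {y} := fun t ht =>
    ⟨((hN t).1 ((hT t).1 ht).1).1, fun h => hyN (h ▸ ((hT t).1 ht).1)⟩
  refine exists_fan_of_separators T hTR (fun h => ((hT x).1 h).2 rfl) fun S hS hxS => ?_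
  obtain ⟨t, ht, htS⟩ : ∃ t ∈ T, t ∉ S := by
    by_contra! h
    exact absurd (Finset.card_le_card h) (not_le.2 hS)
  by_cases hxN : x ∈ N
  · have hTk : T.card + 1 = k := by
      rw [← hNk, ← Finset.card_erase_add_one hxN]
      congr 2
      ext u
      rw [hT, Finset.mem_erase, and_comm]
    have hc := hR (insert y S) ((Finset.card_insert_le _ _).trans_lt (by omega))
    have hset : R \ (insert y S : Finset V) = (R \ {y}) \ S := by
      ext u
      simp only [Set.mem_sdiff, Finset.coe_insert, Set.mem_insert_iff, Set.mem_singleton_iff,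
        Finset.mem_coe]
      tauto
    rw [hset] at hc
    exact ⟨t, ht, htS, hc t ⟨hTR ht, htS⟩ x ⟨⟨hx, hxy⟩, hxS⟩⟩
  · by_contra! hno
    have hTN : T = N := by
      ext u
      rw [hT]
      exact ⟨And.left, fun h => ⟨h, fun h' => hxN (h' ▸ h)⟩⟩
    have hr := hR (S.erase y) ((Finset.card_erase_le).trans_lt (by rw [← hNk, ← hTN]; exact hS))
      x ⟨hx, fun h => hxS (Finset.mem_of_mem_erase h)⟩ y ⟨hy, by simp⟩
    have : y ∈ {v | v ∈ (R \ {y}) \ (S : Set V) ∧ ReachIn G ((R \ {y}) \ (S : Set V)) x v} := by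
      refine hr.invariant ⟨⟨⟨hx, hxy⟩, hxS⟩, ReachIn.refl x⟩ ?_
      rintro a ⟨ha, hxa⟩ - b hb hab
      by_cases hby : b = y
      · subst hby
        have haT : a ∈ T := hTN ▸ (hN a).2 ⟨ha.1.1, hab.symm⟩
        exact absurd hxa.symm (hno a haT ha.2)
      · have hb' : b ∈ (R \ {y}) \ (S : Set V) :=
          ⟨⟨hb.1, hby⟩, fun h => hb.2 (Finset.mem_erase.2 ⟨hby, h⟩)⟩
        exact ⟨hb', hxa.trans (ReachIn.of_adj hab ha hb')⟩
    exact this.1.1.2 rfl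

theorem hasSystem_two_one {R R' : Set V} {k : ℕ} {x y z : V} (hd : Disjoint R R')
    (hx : x ∈ R) (hy : y ∈ R) (hxy : x ≠ y) (hz : z ∈ R') (hR : KConn G R k) (hR' : KConn G R' k)
    (N : Finset V) (hN : ∀ u, u ∈ N ↔ u ∈ R ∧ G.Adj y u) (hNk : N.card = k) (g : V → V)
    (hgi : Function.Injective g) (hg : ∀ u ∈ R, g u ∈ R') (hadj : ∀ u, G.Adj u (g u)) :
    HasSystem G (R ∪ R') {x, y, z} k := by
  classical
  have hRR : ∀ u ∈ R, u ∉ R' := fun u hu hu' => Set.disjoint_left.1 hd hu hu'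
  obtain ⟨F, hF, hFd⟩ := exists_fan_neighbors hx hy hxy hR N (N.erase x) hN hNk
    (fun u => by rw [Finset.mem_erase, and_comm])
  have hyN : y ∉ N := fun h => G.loopless.irrefl y ((hN y).1 h).2
  obtain ⟨e, he, hez⟩ : ∃ e, (e = x ∨ e = y) ∧ g e ≠ z := by
    by_cases h : g x = z
    · exact ⟨y, Or.inr rfl, fun h' => hxy (hgi (h.trans h'.symm))⟩
    · exact ⟨x, Or.inl rfl, h⟩
  have heR : e ∈ R := he.elim (· ▸ hx) (· ▸ hy)
  let τ : V → V := fun t => if t = x then e else t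
  have hτ : ∀ t, t ≠ x → τ t = t := fun t h => if_neg h
  have hτx : τ x = e := if_pos rfl
  have hτR : ∀ t ∈ N, τ t ∈ R := fun t ht => by
    by_cases h : t = x
    · rw [h, hτx]; exact heR
    · rw [hτ t h]; exact ((hN t).1 ht).1
  have hτi : ∀ t ∈ N, ∀ t' ∈ N, τ t = τ t' → t = t' := by
    have key : ∀ t ∈ N, t ≠ x → t ≠ e := fun t ht h h' =>
      he.elim (fun he => h (h'.trans he)) fun he => hyN (he ▸ h' ▸ ht)
    intro t ht t' ht' h
    by_cases h1 : t = x
    · by_cases h2 : t' = x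
      · rw [h1, h2]
      · rw [h1, hτx, hτ t' h2] at h
        exact absurd h.symm (key t' ht' h2)
    · by_cases h2 : t' = x
      · rw [h2, hτx, hτ t h1] at h
        exact absurd h (key t ht h1)
      · rwa [hτ t h1, hτ t' h2] at h
  obtain ⟨F', hF', hFd'⟩ := hR'.exists_fan hz (N.image fun t => g (τ t))
    (by
      intro u hu
      obtain ⟨t, ht, rfl⟩ := Finset.mem_image.1 (Finset.mem_coe.1 hu)
      exact hg _ (hτR t ht))
    ((Finset.card_erase_le).trans (Finset.card_image_le.trans hNk.le))
  have hF'' : ∀ t ∈ N, _ := fun t ht => hF' (g (τ t)) (Finset.mem_image_of_mem _ ht)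
  have hF1 : ∀ t ∈ N, t ≠ x → _ := fun t ht h => hF t (Finset.mem_erase.2 ⟨h, ht⟩)
  let A : V → Set V := fun t => if t = x then ∅ else F t
  have hAsub : ∀ t ∈ N, A t ⊆ (R \ {y}) \ {x} := fun t ht => by
    by_cases h : t = x
    · simp [A, h]
    · simpa [A, h] using (hF1 t ht h).2.2
  have hSS : ∀ B : Set V, B ⊆ R' → (B ∩ {x, y, z}).Subsingleton := by
    have key : ∀ B : Set V, B ⊆ R' → ∀ a ∈ B ∩ {x, y, z}, a = z := by
      rintro B hB a ⟨ha, rfl | rfl | rfl⟩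
      · exact absurd (hB ha) (hRR _ hx)
      · exact absurd (hB ha) (hRR _ hy)
      · rfl
    exact fun B hB a ha b hb => (key B hB a ha).trans (key B hB b hb).symm
  have hxyz : ∀ u, u ∈ ({x, y, z} : Set V) ↔ u = x ∨ u = y ∨ u = z := fun u => by simp
  have hRS : ∀ u ∈ R, u ≠ x → u ≠ y → u ∉ ({x, y, z} : Set V) := by
    intro u hu h1 h2 h
    rcases (hxyz u).1 h with h | h | h
    · exact h1 h
    · exact h2 h
    · exact hRR u hu (h ▸ hz)
  have hRS' : ∀ u ∈ R', u ≠ z → u ∉ ({x, y, z} : Set V) := by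
    intro u hu h1 h
    rcases (hxyz u).1 h with h | h | h
    · exact hRR x hx (h ▸ hu)
    · exact hRR y hy (h ▸ hu)
    · exact h1 h
  refine IsSystem.hasSystem (ι := {t // t ∈ N}) (by simpa using hNk)
    (U := fun t => A t.1 ∪ F' (g (τ t.1))) (E := fun t => if t.1 = x then {s(x, y)} else ∅)
    ⟨?_, ?_, ?_, ?_, ?_, ?_⟩
  · rintro ⟨t, ht⟩
    by_cases h : t = x
    · refine ⟨g e, Or.inr ?_⟩
      have := (hF'' t ht).1
      simp only [h, hτx] at this ⊢
      exact this.resolve_left hez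
    · exact ⟨t, Or.inl (by simpa [A, h] using (hF1 t ht h).1)⟩
  · rintro ⟨t, ht⟩ u (hu | hu)
    · have := hAsub t ht hu
      exact ⟨Or.inl this.1.1, hRS u this.1.1 this.2 this.1.2⟩
    · have := (hF'' t ht).2.2 hu
      exact ⟨Or.inr this.1, hRS' u this.1 this.2⟩
  · rintro ⟨t, ht⟩ ⟨t', ht'⟩ hne
    have hne' : t ≠ t' := fun h => hne (Subtype.ext h)
    have h1 : ∀ t ∈ N, ∀ t', t' ∈ N → Disjoint (A t) (F' (g (τ t'))) := fun t ht t' ht' =>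
      hd.mono (fun u hu => (hAsub t ht hu).1.1) (fun u hu => ((hF'' t' ht').2.2 hu).1)
    refine Disjoint.union_left (Disjoint.union_right ?_ (h1 t ht t' ht'))
      (Disjoint.union_right (h1 t' ht' t ht).symm ?_)
    · by_cases h : t = x
      · simp [A, h]
      · by_cases h' : t' = x
        · simp [A, h']
        · simpa [A, h, h'] using hFd t (Finset.mem_erase.2 ⟨h, ht⟩) t'
            (Finset.mem_erase.2 ⟨h', ht'⟩) hne'
    · exact hFd' _ (Finset.mem_image_of_mem _ ht) _ (Finset.mem_image_of_mem _ ht')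
        fun h => hne' (hτi t ht t' ht' (hgi h))
  · rintro ⟨t, ht⟩ e he a ha
    by_cases h : t = x
    · simp only [h, if_true, Set.mem_singleton_iff] at he
      rw [he, Sym2.mem_iff] at ha
      rcases ha with rfl | rfl <;> simp
    · simp [h] at he
  · rintro ⟨t, ht⟩ ⟨t', ht'⟩ hne
    have hne' : t ≠ t' := fun h => hne (Subtype.ext h)
    by_cases h : t = x
    · by_cases h' : t' = x
      · exact absurd (h.trans h'.symm) hne'
      · simp [h']
    · simp [h]
  · rintro ⟨t, ht⟩
    have hB := (hF'' t ht)
    have hBs : insert z (F' (g (τ t))) ⊆ R' :=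
      Set.insert_subset hz fun u hu => (hB.2.2 hu).1
    by_cases h : t = x
    · have hxN : x ∈ N := h ▸ ht
      simp only [h, A, if_true, Set.empty_union, hτx] at hB hBs ⊢
      have hyx := ((hN x).1 hxN).2
      have c1 : Conn (restrictEdges G {x, y, z} {s(x, y)}) (insert z (F' (g e))) :=
        hB.2.1.restrictEdges (hSS _ hBs)
      have c2 := c1.insert_adj (u := e) hB.1
        (restrictEdges_adj (hadj e) (Or.inr (hRS' _ (hg e heR) hez)))
      have hA : (restrictEdges G {x, y, z} {s(x, y)}).Adj x y := ⟨hyx.symm, fun _ _ => rfl⟩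
      rcases he with rfl | rfl
      · have c3 := c2.insert_adj (Set.mem_insert _ _) hA.symm
        convert c3 using 1
        ext u
        simp only [Set.mem_union, Set.mem_insert_iff, Set.mem_singleton_iff]
        tauto
      · have c3 := c2.insert_adj (Set.mem_insert _ _) hA
        convert c3 using 1
        ext u
        simp only [Set.mem_union, Set.mem_insert_iff, Set.mem_singleton_iff]
        tauto
    · have hA := hF1 t ht h
      have htN := (hN t).1 ht
      have hty : t ≠ y := fun h => hyN (h ▸ ht)
      simp only [h, A, if_false, hτ t h] at hB hBs ⊢
      have htS := hRS t htN.1 h hty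
      have c1 : Conn (restrictEdges G {x, y, z} ∅) (insert z (F' (g t))) :=
        hB.2.1.restrictEdges (hSS _ hBs)
      have c2 : Conn (restrictEdges G {x, y, z} ∅) (insert x (F t)) := by
        refine hA.2.1.restrictEdges ?_
        have key : ∀ a ∈ insert x (F t) ∩ {x, y, z}, a = x := by
          rintro a ⟨rfl | ha, haS⟩
          · rfl
          · exact absurd haS (hRS a (hA.2.2 ha).1.1 (hA.2.2 ha).2 (hA.2.2 ha).1.2)
        exact fun a ha b hb => (key a ha).trans (key b hb).symm
      have c3 := (c2.union_adj c1 (Or.inr hA.1) hB.1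
        (restrictEdges_adj (hadj t) (Or.inl htS))).insert_adj (u := y) (Or.inl (Or.inr hA.1))
        (restrictEdges_adj htN.2 (Or.inr htS))
      convert c3 using 1
      ext u
      simp only [Set.mem_union, Set.mem_insert_iff, Set.mem_singleton_iff]
      tauto

end TwoOne

namespace Frame

variable {α : Type*} [DecidableEq α] [Fintype α] {P : Frame α} {u v w x y z : Perm α}
  {r q a b m i : α} {D : Finset α}

theorem mem_layer_empty :
    u ∈ P.layer ∅ D v ↔ (∀ q ∈ D, u q = v q) ∧ Perm.sign u = Perm.sign v := by
  simp [layer, base]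

theorem eq_or_adj (h : ∀ q, P.Out q → w q = u q) (hs : Perm.sign w = Perm.sign u) :
    w = u ∨ P.graph.Adj u w := by
  rcases eq_rotation (P := P) (w := u⁻¹ * w) (fun q hq => by
      rw [Perm.mul_apply, h q hq]; simp)
      (by rw [map_mul, map_inv, hs]; simp) with h | h | h
  · exact Or.inl (inv_mul_eq_one.1 h).symm
  · rw [← eq_inv_mul_iff_mul_eq.1 h.symm]; exact Or.inr (adj_ρ u)
  · rw [← eq_inv_mul_iff_mul_eq.1 h.symm]; exact Or.inr (adj_ρ_inv u)

theorem sign_mul_t (u : Perm α) : Perm.sign (u * P.t) = -Perm.sign u := by simp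

theorem sign_mul_g (hr : P.Out r) (u : Perm α) : Perm.sign (u * P.g r) = Perm.sign u := by
  simp [sign_g hr]

/-- The neighbours of `y` in its layer. -/
theorem exists_layer_neighbors (hD : ∀ q ∈ D, P.Out q) (hy : y ∈ P.layer ∅ D v) :
    ∃ N : Finset (Perm α), (∀ u, u ∈ N ↔ u ∈ P.layer ∅ D v ∧ P.graph.Adj y u) ∧
      N.card + D.card + 1 = Fintype.card α := by
  let Q : Finset α := ({P.p₀, P.p₁, P.p₂} : Finset α)ᶜ \ D
  have hQ : ∀ r, r ∈ Q ↔ P.Out r ∧ r ∉ D := fun r => by simp [Q, Out]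
  have h3 : ({P.p₀, P.p₁, P.p₂} : Finset α).card = 3 :=
    Finset.card_eq_three.2 ⟨_, _, _, P.h₀₁, P.h₀₂, P.h₁₂, rfl⟩
  have hDQ : D ⊆ ({P.p₀, P.p₁, P.p₂} : Finset α)ᶜ := fun q hq => by
    have := hD q hq
    simp only [Out] at this
    simp [this]
  have hQc : Q.card + D.card + 3 = Fintype.card α := by
    have h1 := Finset.card_sdiff_add_card_eq_card hDQ
    have h2 := Finset.card_compl_add_card ({P.p₀, P.p₁, P.p₂} : Finset α)
    simp only [Q]
    omega
  rw [layer_congr hy]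
  refine ⟨insert (y * P.ρ) (insert (y * P.ρ⁻¹) (Q.image fun r => y * P.g r)), fun u => ?_, ?_⟩
  · simp only [Finset.mem_insert, Finset.mem_image, hQ, mem_layer_empty]
    constructor
    · rintro (rfl | rfl | ⟨r, ⟨hr, hrD⟩, rfl⟩)
      · exact ⟨⟨fun q hq => by rw [Perm.mul_apply, ρ_out (hD q hq)], by simp⟩, adj_ρ y⟩
      · exact ⟨⟨fun q hq => by rw [Perm.mul_apply, ρ_inv_out (hD q hq)], by simp⟩, adj_ρ_inv y⟩
      · exact ⟨⟨fun q hq => mul_g_out (hD q hq) (ne_of_mem_of_not_mem hq hrD) y, sign_mul_g hr y⟩,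
          adj_g y hr⟩
    · rintro ⟨⟨hu, hs⟩, rfl | rfl | h | ⟨r, hr, rfl⟩⟩
      · rw [sign_mul_t] at hs
        exact absurd hs.symm (units_ne_neg _)
      · exact Or.inl rfl
      · rw [h]
        exact Or.inr (Or.inl (by simp))
      · refine Or.inr (Or.inr ⟨r, ⟨hr, fun h => ?_⟩, rfl⟩)
        have := hu r h
        rw [mul_g_self] at this
        exact hr.2.2 (y.injective this).symm
  · have h1 : ∀ r ∈ Q, P.ρ ≠ P.g r ∧ P.ρ⁻¹ ≠ P.g r := fun r hr => by
      constructor <;> intro h <;> have h' := congrArg (fun s : Perm α => s r) h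
      · simp only [ρ_out ((hQ r).1 hr).1, g_self] at h'
        exact ((hQ r).1 hr).1.2.2 h'
      · simp only [ρ_inv_out ((hQ r).1 hr).1, g_self] at h'
        exact ((hQ r).1 hr).1.2.2 h'
    have h2 : P.ρ ≠ P.ρ⁻¹ := fun h => by
      have h' := congrArg (fun s : Perm α => s P.p₁) h
      simp only [ρ_p₁, ρ_inv_p₁] at h'
      exact P.h₀₂ h'.symm
    rw [Finset.card_insert_of_notMem, Finset.card_insert_of_notMem, Finset.card_image_of_injOn]
    · omega
    · intro r hr r' hr' h
      have hr := ((hQ r).1 hr).1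
      by_contra hne
      have h' := congrArg (fun s : Perm α => s r) (mul_left_cancel h)
      simp only [g_self, g_out hr hne] at h'
      exact hr.2.2 h'.symm
    · simp only [Finset.mem_image, mul_right_inj, not_exists, not_and]
      exact fun r hr h => (h1 r hr).2 h.symm
    · simp only [Finset.mem_insert, Finset.mem_image, mul_right_inj, not_or, not_exists, not_and]
      exact ⟨h2, fun r hr h => (h1 r hr).1 h.symm⟩

theorem layer_minus_kconn {f : ℕ} (hD : ∀ q ∈ D, P.Out q) (hr : P.Out r) (hrD : r ∉ D)
    (hcard : D.card + f + 4 = Fintype.card α) :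
    KConn P.graph {u ∈ P.layer ∅ D v | u r ≠ a} (f + 2) := by
  have hv : v ∈ P.base ∅ D v := ⟨fun _ _ => rfl, by simp⟩
  refine KConn.of_clusters (Γ := (free ∅ D v).erase a) (fun u : Perm α => u r)
    (fun u => u * P.g r) (fun u => mul_g_g u hr) (fun u => adj_g u hr)
    (fun u hu => Finset.mem_erase.2 ⟨hu.2, mem_free_of_base hu.1.1 hrD hr.1 hr.2.1⟩) ?_ ?_ ?_
  · intro c hc d hd hcd
    rw [Finset.mem_erase, mem_free] at hc hd
    obtain ⟨u, h1, h2, h3, h4⟩ := exists_base_two hD hv (Perm.sign v) hr hrD hcd hc.2.2 hc.2.1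
      hd.2.2 hd.2.1
    have h5 : (u * P.g r) r = d := (mul_g_self u).trans h4
    exact ⟨u, ⟨⟨h1, h2⟩, fun h => hc.1 (h3.symm.trans h)⟩, h3,
      ⟨⟨base_mul_g hD hr hrD h1, (sign_mul_g hr u).trans h2⟩, fun h => hd.1 (h5.symm.trans h)⟩, h5⟩
  · intro c hc
    have hset : {u ∈ {u ∈ P.layer ∅ D v | u r ≠ a} | u r = c} = {u ∈ P.layer ∅ D v | u r = c} := by
      ext u
      exact ⟨fun h => ⟨h.1.1, h.2⟩, fun h => ⟨⟨h.1, fun h' =>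
        (Finset.mem_erase.1 hc).1 (h.2.symm.trans h')⟩, h.2⟩⟩
    rw [hset]
    rcases Set.eq_empty_or_nonempty {u ∈ P.layer ∅ D v | u r = c} with hem | ⟨u, hu, huc⟩
    · rw [hem]; exact fun X _ u hu => by simp at hu
    · rw [layer_cluster huc hu]
      refine layer_kconn (f := f) (by simp) _ (fun q hq => ?_) ?_
      · rcases Finset.mem_insert.1 hq with rfl | hq
        · exact hr
        · exact hD q hq
      · rw [Finset.card_insert_of_notMem hrD]; omega
  · have h1 := card_free (D := D) (I := ∅) (v := v)
    have h2 := Finset.pred_card_le_card_erase (s := free ∅ D v) (a := a)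
    rw [Finset.card_empty] at h1
    omega

theorem sect_eq_union (hm : P.Out m) (hv : v m = i) :
    sect m i = P.layer ∅ {m} v ∪ P.layer ∅ {m} (v * P.t) := by
  have hD : ∀ q ∈ ({m} : Finset α), P.Out q := by simpa using hm
  rw [sect_eq_base hv, base_eq_union, opposite_layer hD ⟨fun _ _ => rfl, by simp⟩]

theorem disjoint_layer_mul_t : Disjoint (P.layer ∅ D v) (P.layer ∅ D (v * P.t)) :=
  Set.disjoint_left.2 fun _ hu hu' => units_ne_neg (Perm.sign v)
    (hu.2.symm.trans (hu'.2.trans (sign_mul_t v)))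

theorem mul_t_mem_layer (hD : ∀ q ∈ D, P.Out q) (hu : u ∈ P.layer ∅ D v) :
    u * P.t ∈ P.layer ∅ D (v * P.t) := by
  rw [mem_layer_empty] at hu ⊢
  exact ⟨fun q hq => by rw [mul_t_out (hD q hq), mul_t_out (hD q hq), hu.1 q hq], by
    rw [sign_mul_t, sign_mul_t, hu.2]⟩

theorem mem_layer_self : v ∈ P.layer ∅ D v := mem_layer_empty.2 ⟨fun _ _ => rfl, rfl⟩

/-- Two vertices of one sign and one of the other. -/
theorem hasSystem_of_sign (hn : 4 ≤ Fintype.card α) (hm : P.Out m) (hx : x m = i) (hy : y m = i)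
    (hz : z m = i) (hxy : x ≠ y) (hs : Perm.sign y = Perm.sign x)
    (hs' : Perm.sign z ≠ Perm.sign x) :
    HasSystem P.graph (sect m i) {x, y, z} (Fintype.card α - 2) := by
  have hD : ∀ q ∈ ({m} : Finset α), P.Out q := by simpa using hm
  have hk : ∀ v, KConn P.graph (P.layer ∅ {m} v) (Fintype.card α - 2) := fun v => by
    rw [show Fintype.card α - 2 = Fintype.card α - 4 + 2 - (∅ : Finset α).card by
      rw [Finset.card_empty]; omega]
    exact layer_kconn (by simp) v hD (by simp; omega)
  have hyx : y ∈ P.layer ∅ {m} x := mem_layer_empty.2 ⟨by simp [hx, hy], hs⟩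
  obtain ⟨N, hN, hNc⟩ := exists_layer_neighbors hD hyx
  rw [Finset.card_singleton] at hNc
  rw [sect_eq_union hm hx]
  refine hasSystem_two_one disjoint_layer_mul_t mem_layer_self hyx hxy
    (mem_layer_empty.2 ⟨?_, ?_⟩) (hk x) (hk _) N hN (by omega) (fun u => u * P.t)
    (mul_left_injective _) (fun u hu => mul_t_mem_layer hD hu) adj_t
  · simp only [Finset.mem_singleton, forall_eq]
    rw [mul_t_out hm, hx, hz]
  · rw [sign_mul_t]
    exact (units_eq_or_eq_neg _ _).resolve_left hs'

theorem hasSystem_add_layer {S : Set (Perm α)} {k : ℕ} (hn : 4 ≤ Fintype.card α) (hm : P.Out m)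
    (hx : x m = i) (hS : S ⊆ P.layer ∅ {m} x) (h : HasSystem P.graph (P.layer ∅ {m} x) S k) :
    HasSystem P.graph (sect m i) S (k + 1) := by
  have hD : ∀ q ∈ ({m} : Finset α), P.Out q := by simpa using hm
  have hU := sect_eq_union hm hx
  have hd : Disjoint (P.layer ∅ {m} x) (P.layer ∅ {m} (x * P.t)) := disjoint_layer_mul_t
  refine h.succ (A := P.layer ∅ {m} (x * P.t)) (hU ▸ Set.subset_union_left) ⟨_, mem_layer_self⟩
    (fun u hu => ⟨hU ▸ Or.inr hu, fun h => Set.disjoint_left.1 hd (hS h) hu⟩) hd.symm ?_ ?_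
  · exact (layer_kconn (I := ∅) (f := Fintype.card α - 4) (by simp) _ hD (by simp; omega)).conn
      (by simp)
  · exact fun s hs => ⟨s * P.t, mul_t_mem_layer hD (hS hs), adj_t s⟩

/-- Three vertices of the same sign, exactly two of which agree at some position. -/
theorem hasSystem_of_pos (hn : 5 ≤ Fintype.card α) (hm : P.Out m) (hr : r ∈ P.spare m)
    (hx : x m = i) (hy : y m = i) (hz : z m = i) (hxy : x ≠ y) (hs : Perm.sign y = Perm.sign x)
    (hs' : Perm.sign z = Perm.sign x) (hyr : y r = x r) (hzr : z r ≠ x r) :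
    HasSystem P.graph (sect m i) {x, y, z} (Fintype.card α - 2) := by
  rw [mem_spare] at hr
  have hD : ∀ q ∈ ({m} : Finset α), P.Out q := by simpa using hm
  have hD2 : ∀ q ∈ (insert r {m} : Finset α), P.Out q := by simpa using ⟨hr.1, hm⟩
  have hc2 : (insert r {m} : Finset α).card = 2 := Finset.card_pair hr.2
  have hxx : y ∈ P.layer ∅ {m} x := mem_layer_empty.2 ⟨by simp [hx, hy], hs⟩
  have hzx : z ∈ P.layer ∅ {m} x := mem_layer_empty.2 ⟨by simp [hx, hz], hs'⟩
  have hyx : y ∈ P.layer ∅ (insert r {m}) x := mem_layer_empty.2 ⟨by simp [hx, hy, hyr], hs⟩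
  have hcl : {w ∈ P.layer ∅ {m} x | w r = x r} = P.layer ∅ (insert r {m}) x :=
    layer_cluster rfl mem_layer_self
  obtain ⟨N, hN, hNc⟩ := exists_layer_neighbors hD2 hyx
  rw [show Fintype.card α - 2 = Fintype.card α - 3 + 1 by omega]
  refine hasSystem_add_layer (by omega) hm hx ?_ ?_
  · simp [Set.insert_subset_iff, mem_layer_self, hxx, hzx]
  · have hU : P.layer ∅ {m} x = P.layer ∅ (insert r {m}) x ∪ {u ∈ P.layer ∅ {m} x | u r ≠ x r} := by
      rw [← hcl]
      ext u
      by_cases h : u r = x r <;> simp [h]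
    rw [hU]
    refine hasSystem_two_one ?_ mem_layer_self hyx hxy ⟨hzx, hzr⟩ ?_ ?_ N hN (by omega)
      (fun u => u * P.g r) (mul_left_injective _) ?_ fun u => adj_g u hr.1
    · rw [← hcl]
      exact Set.disjoint_left.2 fun u hu hu' => hu'.2 hu.2
    · rw [show Fintype.card α - 3 = Fintype.card α - 5 + 2 - (∅ : Finset α).card by
        rw [Finset.card_empty]; omega]
      exact layer_kconn (by simp) x hD2 (by omega)
    · rw [show Fintype.card α - 3 = Fintype.card α - 5 + 2 by omega]
      exact layer_minus_kconn hD hr.1 (by simpa using hr.2) (by simp; omega)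
    · intro u hu
      rw [← hcl] at hu
      refine ⟨⟨base_mul_g hD hr.1 (by simpa using hr.2) hu.1.1,
        (sign_mul_g hr.1 u).trans hu.1.2⟩, ?_⟩
      rw [mul_g_self, ← hu.2]
      exact fun h => hr.1.2.2 (u.injective h).symm

end Frame

section Hubs

variable {V ι : Type*} {G : SimpleGraph V}

theorem Conn.union_biUnion {A : Set V} {I : Set ι} {B : ι → Set V} (hA : Conn G A)
    (hB : ∀ s ∈ I, Conn G (B s)) (h : ∀ s ∈ I, ∃ b ∈ B s, ∃ a ∈ A, G.Adj b a) :
    Conn G (A ∪ ⋃ s ∈ I, B s) := by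
  have key : ∀ u ∈ A ∪ ⋃ s ∈ I, B s, ∃ a ∈ A, ReachIn G (A ∪ ⋃ s ∈ I, B s) u a := by
    rintro u (hu | hu)
    · exact ⟨u, hu, ReachIn.refl _⟩
    · obtain ⟨s, hs, hu⟩ := Set.mem_iUnion₂.1 hu
      obtain ⟨b, hb, a, ha, hba⟩ := h s hs
      have hsub : B s ⊆ A ∪ ⋃ s ∈ I, B s := fun v hv => Or.inr (Set.mem_iUnion₂.2 ⟨s, hs, hv⟩)
      exact ⟨a, ha, ((hB s hs u hu b hb).mono hsub).trans
        (ReachIn.of_adj hba (hsub hb) (Or.inl ha))⟩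
  intro u hu v hv
  obtain ⟨a, ha, hua⟩ := key u hu
  obtain ⟨b, hb, hvb⟩ := key v hv
  exact hua.trans (((hA a ha b hb).mono Set.subset_union_left).trans hvb.symm)

/-- A system consisting of hubs, joined to the elements of `S` by disjoint fans. -/
theorem hasSystem_of_hubs [Fintype V] {C S : Set V} {k : ℕ} (B : V → Set V) (H : Fin k → Set V)
    (t : V → Fin k → V) (hSB : ∀ s ∈ S, s ∈ B s) (hBC : ∀ s ∈ S, B s ⊆ C)
    (hBd : ∀ s ∈ S, ∀ s' ∈ S, s ≠ s' → Disjoint (B s) (B s'))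
    (hB : ∀ s ∈ S, KConn G (B s) k) (hHC : ∀ l, H l ⊆ C) (hHn : ∀ l, (H l).Nonempty)
    (hHc : ∀ l, Conn G (H l)) (hHd : ∀ l l', l ≠ l' → Disjoint (H l) (H l'))
    (hHB : ∀ s ∈ S, ∀ l, Disjoint (H l) (B s)) (ht : ∀ s ∈ S, ∀ l, t s l ∈ B s)
    (hti : ∀ s ∈ S, Function.Injective (t s)) (htH : ∀ s ∈ S, ∀ l, ∃ a ∈ H l, G.Adj (t s l) a) :
    HasSystem G C S k := by
  classical
  have hfan : ∀ s, ∃ F : V → Set V, s ∈ S → (∀ l, t s l ∈ insert s (F (t s l)) ∧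
      Conn G (insert s (F (t s l))) ∧ F (t s l) ⊆ B s \ {s}) ∧
      ∀ l l', l ≠ l' → Disjoint (F (t s l)) (F (t s l')) := by
    intro s
    by_cases hs : s ∈ S
    · obtain ⟨F, hF, hd⟩ := (hB s hs).exists_fan (hSB s hs) (Finset.univ.image (t s))
        (by
          intro u hu
          obtain ⟨l, -, rfl⟩ := Finset.mem_image.1 (Finset.mem_coe.1 hu)
          exact ht s hs l)
        ((Finset.card_erase_le).trans (Finset.card_image_le.trans (by simp)))
      exact ⟨F, fun _ => ⟨fun l => hF _ (by simp), fun l l' hl => hd _ (by simp) _ (by simp)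
        ((hti s hs).ne hl)⟩⟩
    · exact ⟨fun _ => ∅, fun h => absurd h hs⟩
  choose F hF using hfan
  have hFS : ∀ s ∈ S, ∀ l, ∀ u ∈ F s (t s l), u ∉ S := by
    intro s hs l u hu huS
    have h1 := ((hF s hs).1 l).2.2 hu
    exact Set.disjoint_left.1 (hBd s hs u huS fun h => h1.2 h.symm) h1.1 (hSB u huS)
  have hHS : ∀ l, ∀ u ∈ H l, u ∉ S := fun l u hu huS =>
    Set.disjoint_left.1 (hHB u huS l) hu (hSB u huS)
  refine ⟨fun l => H l ∪ ⋃ s ∈ S, F s (t s l), fun _ => ∅, ⟨?_, ?_, ?_, ?_, ?_, ?_⟩⟩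
  · exact fun l => (hHn l).mono Set.subset_union_left
  · rintro l u (hu | hu)
    · exact ⟨hHC l hu, hHS l u hu⟩
    · obtain ⟨s, hs, hu⟩ := Set.mem_iUnion₂.1 hu
      exact ⟨hBC s hs (((hF s hs).1 l).2.2 hu).1, hFS s hs l u hu⟩
  · have h1 : ∀ l l', Disjoint (H l) (⋃ s ∈ S, F s (t s l')) := by
      intro l l'
      simp only [Set.disjoint_iUnion_right]
      exact fun s hs => (hHB s hs l).mono_right fun u hu => (((hF s hs).1 l').2.2 hu).1
    intro l l' hne
    refine Disjoint.union_left (Disjoint.union_right (hHd l l' hne) (h1 l l'))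
      (Disjoint.union_right (h1 l' l).symm ?_)
    simp only [Set.disjoint_iUnion_right, Set.disjoint_iUnion_left]
    intro s hs s' hs'
    by_cases h : s' = s
    · subst h
      exact (hF s' hs').2 l l' hne
    · exact (hBd s' hs' s hs h).mono (fun u hu => (((hF s' hs').1 l).2.2 hu).1)
        fun u hu => (((hF s hs).1 l').2.2 hu).1
  · exact fun l e he => absurd he (Set.notMem_empty e)
  · exact fun l l' _ => Set.disjoint_empty _
  · intro l
    have hc : Conn (restrictEdges G S ∅) (H l ∪ ⋃ s ∈ S, insert s (F s (t s l))) := by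
      refine Conn.union_biUnion ((hHc l).restrictEdges ?_) (fun s hs => ?_) fun s hs => ?_
      · exact fun a ha => absurd ha.2 (hHS l a ha.1)
      · refine ((hF s hs).1 l).2.1.restrictEdges ?_
        have key : ∀ a ∈ insert s (F s (t s l)) ∩ S, a = s := by
          rintro a ⟨rfl | ha, haS⟩
          · rfl
          · exact absurd haS (hFS s hs l a ha)
        exact fun a ha b hb => (key a ha).trans (key b hb).symm
      · obtain ⟨a, ha, hta⟩ := htH s hs l
        exact ⟨_, ((hF s hs).1 l).1, a, ha, restrictEdges_adj hta (Or.inr (hHS l a ha))⟩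
    convert hc using 1
    ext u
    simp only [Set.mem_union, Set.mem_iUnion, Set.mem_insert_iff, exists_prop]
    constructor
    · rintro ((h | ⟨s, hs, h⟩) | h)
      · exact Or.inl h
      · exact Or.inr ⟨s, hs, Or.inr h⟩
      · exact Or.inr ⟨u, h, Or.inl rfl⟩
    · rintro (h | ⟨s, hs, rfl | h⟩)
      · exact Or.inl (Or.inl h)
      · exact Or.inr hs
      · exact Or.inl (Or.inr ⟨s, hs, h⟩)

end Hubs

namespace Frame

variable {α : Type*} [DecidableEq α] [Fintype α] {P : Frame α} {u v w x y z : Perm α}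
  {r q a b m i : α} {D : Finset α} {S : Set (Perm α)}

theorem hasSystem_of_injOn (hn : 6 ≤ Fintype.card α) (hm : P.Out m) (hr : r ∈ P.spare m)
    (hS : ∀ s ∈ S, s m = i) (hSr : ∀ s ∈ S, ∀ s' ∈ S, s r = s' r → s = s') (Q : Finset α)
    (hQ : ∀ d ∈ Q, d ≠ i ∧ ∀ s ∈ S, s r ≠ d) (hQc : Fintype.card α ≤ Q.card + 4) :
    HasSystem P.graph (sect m i) S (Fintype.card α - 2) := by
  rw [mem_spare] at hr
  have hD : ∀ q ∈ ({m} : Finset α), P.Out q := by simpa using hm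
  have hD2 : ∀ q ∈ (insert r {m} : Finset α), P.Out q := by simpa using ⟨hr.1, hm⟩
  have hc2 : (insert r {m} : Finset α).card = 2 := Finset.card_pair hr.2
  have hcard : Fintype.card (Fin (Fintype.card α - 2)) ≤ Fintype.card ({d // d ∈ Q} × ℤˣ) := by
    rw [Fintype.card_prod, Fintype.card_fin, Fintype.card_units_int, Fintype.card_coe]
    omega
  obtain ⟨φ⟩ := Function.Embedding.nonempty_of_card_le hcard
  let d : Fin (Fintype.card α - 2) → α := fun l => (φ l).1.1
  let ε : Fin (Fintype.card α - 2) → ℤˣ := fun l => (φ l).2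
  have hd : ∀ l, d l ≠ i ∧ ∀ s ∈ S, s r ≠ d l := fun l => hQ _ (φ l).1.2
  have hφ : ∀ l l', d l = d l' → ε l = ε l' → l = l' := fun l l' h h' =>
    φ.injective (Prod.ext (Subtype.ext h) h')
  have ht : ∀ s l, ∃ u : Perm α, s ∈ S → u ∈ P.base ∅ (insert r {m}) s ∧ Perm.sign u = ε l ∧
      u P.p₂ = d l := by
    intro s l
    by_cases hs : s ∈ S
    · obtain ⟨u, h1, h2, h3⟩ := exists_base_one (q := P.p₂) (a := d l) hD2
        (⟨fun _ _ => rfl, by simp⟩ : s ∈ P.base ∅ (insert r {m}) s) (ε l)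
        (fun h => (hD2 _ h).2.2 rfl) P.h₀₂.symm P.h₁₂.symm (by simp) (by
          simp only [Finset.mem_insert, Finset.mem_singleton, forall_eq_or_imp, forall_eq]
          exact ⟨(hd l).2 s hs, fun h => (hd l).1 (h.symm.trans (hS s hs))⟩)
      exact ⟨u, fun _ => ⟨h1, h2, h3⟩⟩
    · exact ⟨1, fun h => absurd h hs⟩
  choose t ht using ht
  have hbase : ∀ s ∈ S, ∀ u, u ∈ P.base ∅ (insert r {m}) s ↔ u m = i ∧ u r = s r := by
    intro s hs u
    simp [base, hS s hs, and_comm]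
  have hH : ∀ l, ∃ v : Perm α, v m = i ∧ v r = d l ∧ Perm.sign v = ε l := by
    intro l
    obtain ⟨u, h1, h2, h3⟩ := exists_base_one (q := r) (a := d l) hD
        (⟨fun _ _ => rfl, by simp⟩ : swap m i ∈ P.base ∅ {m} (swap m i)) (ε l)
        (by simpa using hr.2) hr.1.1 hr.1.2.1 (by simp) (by
          simpa using fun h => (hd l).1 h.symm)
    exact ⟨u, by simpa using h1.1 m (by simp), h3, h2⟩
  choose v hvm hvr hvs using hH
  have hlayer : ∀ l u, u ∈ P.layer ∅ (insert r {m}) (v l) ↔ (u m = i ∧ u r = d l) ∧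
      Perm.sign u = ε l := by
    intro l u
    simp [mem_layer_empty, hvm, hvr, hvs, and_comm]
  refine hasSystem_of_hubs (fun s => P.base ∅ (insert r {m}) s)
    (fun l => P.layer ∅ (insert r {m}) (v l)) t (fun s hs => (hbase s hs s).2 ⟨hS s hs, rfl⟩)
    (fun s hs u hu => ((hbase s hs u).1 hu).1) ?_ ?_ (fun l u hu => ((hlayer l u).1 hu).1.1)
    (fun l => ⟨_, mem_layer_self⟩) ?_ ?_ ?_ (fun s hs l => (ht s l hs).1) ?_ ?_
  · exact fun s hs s' hs' hne => Set.disjoint_left.2 fun u hu hu' => hne (hSr s hs s' hs'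
      (((hbase s hs u).1 hu).2.symm.trans ((hbase s' hs' u).1 hu').2))
  · intro s hs
    rw [show Fintype.card α - 2 = Fintype.card α - 5 + 3 - (∅ : Finset α).card by
        rw [Finset.card_empty]; omega]
    exact base_kconn (by simp) s hD2 (by omega)
  · exact fun l => (layer_kconn (I := ∅) (f := Fintype.card α - 5) (by simp) (v l) hD2
      (by omega)).conn (by simp)
  · exact fun l l' hne => Set.disjoint_left.2 fun u hu hu' => hne (hφ l l'
      (((hlayer l u).1 hu).1.2.symm.trans ((hlayer l' u).1 hu').1.2)
      (((hlayer l u).1 hu).2.symm.trans ((hlayer l' u).1 hu').2))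
  · exact fun s hs l => Set.disjoint_left.2 fun u hu hu' => (hd l).2 s hs
      (((hbase s hs u).1 hu').2.symm.trans ((hlayer l u).1 hu).1.2)
  · intro s hs l l' h
    refine hφ l l' ?_ ?_
    · rw [← (ht s l hs).2.2, h, (ht s l' hs).2.2]
    · rw [← (ht s l hs).2.1, h, (ht s l' hs).2.1]
  · intro s hs l
    obtain ⟨h1, h2, h3⟩ := ht s l hs
    refine ⟨_, (hlayer l _).2 ⟨⟨?_, ?_⟩, ?_⟩, adj_g _ hr.1⟩
    · rw [mul_g_out hm hr.2.symm]
      exact ((hbase s hs _).1 h1).1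
    · rw [mul_g_self, h3]
    · rw [sign_mul_g hr.1, h2]

end Frame

namespace Frame

variable {α : Type*} [DecidableEq α] [Fintype α] {P : Frame α} {u v w x y z : Perm α}
  {r q a b d m i : α} {D : Finset α} {S : Set (Perm α)}

/-- With five positions, three vertices of the same sign lying in different clusters: each of the
two members inside their layer is a union of parts of clusters. -/
theorem hasSystem_two_of_injOn (hn : Fintype.card α = 5) (hm : P.Out m) (hr : r ∈ P.spare m)
    (hx : x m = i) (hxS : x ∈ S) (hS : S ⊆ P.layer ∅ {m} x)
    (hSr : ∀ s ∈ S, ∀ s' ∈ S, s r = s' r → s = s') (hdi : d ≠ i) (hdS : ∀ s ∈ S, s r ≠ d) :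
    HasSystem P.graph (P.layer ∅ {m} x) S 2 := by
  have hspare := card_spare hm
  have hOut : ∀ q, P.Out q → q = m ∨ q = r := by
    intro q hq
    by_contra! h
    exact h.2 (Finset.card_le_one.1 (by omega) q (mem_spare.2 ⟨hq, h.1⟩) r hr)
  rw [mem_spare] at hr
  have hD : ∀ q ∈ ({m} : Finset α), P.Out q := by simpa using hm
  have hrD : r ∉ ({m} : Finset α) := by simpa using hr.2
  have hL : ∀ u, u ∈ P.layer ∅ {m} x ↔ u m = i ∧ Perm.sign u = Perm.sign x := by
    intro u
    simp [mem_layer_empty, hx]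
  have hadj : ∀ u ∈ P.layer ∅ {m} x, ∀ v ∈ P.layer ∅ {m} x, u r = v r →
      u = v ∨ P.graph.Adj v u := by
    intro u hu v hv huv
    rw [hL] at hu hv
    refine eq_or_adj (fun q hq => ?_) (hu.2.trans hv.2.symm)
    rcases hOut q hq with rfl | rfl
    · exact hu.1.trans hv.1.symm
    · exact huv
  have hgL : ∀ u ∈ P.layer ∅ {m} x, u * P.g r ∈ P.layer ∅ {m} x := fun u hu =>
    ⟨base_mul_g hD hr.1 hrD hu.1, (sign_mul_g hr.1 u).trans hu.2⟩
  have htwo : ∀ a b, a ≠ b → a ≠ i → b ≠ i → ∃ u ∈ P.layer ∅ {m} x, u r = a ∧ u P.p₂ = b := by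
    intro a b hab ha hb
    obtain ⟨u, h1, h2, h3⟩ := exists_base_two hD (⟨fun _ _ => rfl, by simp⟩ : x ∈ P.base ∅ {m} x)
      (Perm.sign x) hr.1 hrD hab (Finset.notMem_empty a) (by simpa [hx] using ha.symm)
      (Finset.notMem_empty b) (by simpa [hx] using hb.symm)
    exact ⟨u, ⟨h1, h2⟩, h3⟩
  have hthird : ∀ a b c : α, ∃ e, e ≠ a ∧ e ≠ b ∧ e ≠ c := by
    intro a b c
    obtain ⟨e, he⟩ : ∃ e, e ∉ ({a, b, c} : Finset α) := by
      by_contra! h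
      have h1 := Finset.card_le_card (fun e _ => h e : Finset.univ ⊆ ({a, b, c} : Finset α))
      have h2 := Finset.card_le_three (a := a) (b := b) (c := c)
      rw [Finset.card_univ] at h1
      omega
    exact ⟨e, by simpa using he⟩
  have hri : ∀ u ∈ P.layer ∅ {m} x, u r ≠ i := fun u hu =>
    ne_of_apply ((hL u).1 hu).1 hr.2
  have h2i : ∀ u ∈ P.layer ∅ {m} x, u P.p₂ ≠ i := fun u hu =>
    ne_of_apply ((hL u).1 hu).1 hm.2.2.symm
  let A : Set (Perm α) := {u ∈ P.layer ∅ {m} x | u r = d}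
  let B : Set (Perm α) := {u ∈ P.layer ∅ {m} x | u r ≠ d ∧ u P.p₂ = d} \ S
  let W : Set (Perm α) := {u ∈ P.layer ∅ {m} x | u r ≠ d ∧ u P.p₂ ≠ d}
  have hAS : ∀ u ∈ A, u ∉ S := fun u hu huS => hdS u huS hu.2
  have hA : Conn P.graph A := by
    intro u hu v hv
    rcases hadj u hu.1 v hv.1 (hu.2.trans hv.2.symm) with rfl | h
    · exact ReachIn.refl _
    · exact ReachIn.of_adj h.symm hu hv
  have hgA : ∀ u ∈ P.layer ∅ {m} x, u P.p₂ = d → u * P.g r ∈ A := fun u hu h =>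
    ⟨hgL u hu, (mul_g_self u).trans h⟩
  have hW : Conn P.graph W := by
    have := conn_of_clusters (G := P.graph) (W := W) (Γ := (free ∅ {m} x).erase d)
      (fun u : Perm α => u r) (fun u => u * P.g r) (fun u => mul_g_g u hr.1)
      (fun u => adj_g u hr.1) (fun u hu => Finset.mem_erase.2 ⟨hu.2.1,
        mem_free_of_base hu.1.1 hrD hr.1.1 hr.1.2.1⟩) ?_ ∅ ?_ ?_
    · simpa using this
    · intro a ha b hb hab
      simp only [Finset.mem_erase, mem_free, Finset.mem_singleton, forall_eq, hx] at ha hb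
      obtain ⟨u, hu, hua, hub⟩ := htwo a b hab ha.2.1.symm hb.2.1.symm
      have h1 : (u * P.g r) r = b := (mul_g_self u).trans hub
      have h2 : (u * P.g r) P.p₂ = a := (mul_g_p₂ hr.1 u).trans hua
      exact ⟨u, ⟨hu, by rw [hua]; exact ha.1, by rw [hub]; exact hb.1⟩, hua,
        ⟨hgL u hu, by rw [h1]; exact hb.1, by rw [h2]; exact ha.1⟩, h1⟩
    · rintro c - u ⟨⟨hu, huc⟩, -⟩ v ⟨⟨hv, hvc⟩, -⟩
      rcases hadj u hu.1 v hv.1 (huc.trans hvc.symm) with rfl | h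
      · exact ReachIn.refl _
      · exact ReachIn.of_adj h.symm ⟨⟨hu, huc⟩, by simp⟩ ⟨⟨hv, hvc⟩, by simp⟩
    · have h1 := card_free (D := {m}) (I := ∅) (v := x)
      have h2 := Finset.pred_card_le_card_erase (s := free ∅ {m} x) (a := d)
      rw [Finset.card_empty, Finset.card_singleton] at h1
      rw [Finset.card_empty]
      omega
  have hWS : Conn P.graph (W ∪ S) := by
    refine hW.union_of_adj_or_mem fun s hs => ?_
    by_cases h : s P.p₂ = d
    · obtain ⟨e, he1, he2, he3⟩ := hthird (s r) i d
      obtain ⟨u, hu, hur, hue⟩ := htwo (s r) e he1.symm (hri s (hS hs)) he2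
      refine Or.inr ⟨u, ⟨hu, by rw [hur]; exact hdS s hs, by rw [hue]; exact he3⟩, ?_⟩
      refine (hadj u hu s (hS hs) hur).resolve_left ?_
      rintro rfl
      exact he3 (hue.symm.trans h)
    · exact Or.inl ⟨hS hs, hdS s hs, h⟩
  have hAB : Conn P.graph (A ∪ B) := by
    refine hA.union_of_adj fun u hu => ?_
    exact ⟨_, hgA u hu.1.1 hu.1.2.2, adj_g u hr.1⟩
  have hABS : ∀ u ∈ A ∪ B, u ∉ S := fun u hu => hu.elim (hAS u) And.right
  refine IsSystem.hasSystem (ι := Bool) (by simp) (U := fun l => bif l then A ∪ B else W \ S)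
    (E := fun l => bif l then ∅ else {e | ∀ a ∈ e, a ∈ S}) ⟨?_, ?_, ?_, ?_, ?_, ?_⟩
  · rintro (_ | _)
    · obtain ⟨e, he1, he2, he3⟩ := hthird (x r) i d
      obtain ⟨e', he1', he2', he3'⟩ : ∃ e', e' ≠ i ∧ (e' ≠ x r ∧ e' ≠ d) ∧ e' ≠ e := by
        obtain ⟨e', he⟩ : ∃ e', e' ∉ ({i, x r, d, e} : Finset α) := by
          by_contra! h
          have h1 := Finset.card_le_card (fun e' _ => h e' :
            Finset.univ ⊆ ({i, x r, d, e} : Finset α))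
          have h2 := Finset.card_le_four (a := i) (b := x r) (c := d) (d := e)
          rw [Finset.card_univ] at h1
          omega
        exact ⟨e', by simp only [Finset.mem_insert, Finset.mem_singleton] at he; tauto⟩
      have hxL := hri x (hS hxS)
      obtain ⟨u, hu, hur, hue⟩ := htwo (x r) e he1.symm hxL he2
      obtain ⟨u', hu', hur', hue'⟩ := htwo (x r) e' he2'.1.symm hxL he1'
      have hxd := hdS x hxS
      by_cases huS : u ∈ S
      · refine ⟨u', ⟨hu', by rw [hur']; exact hxd, by rw [hue']; exact he2'.2⟩, fun h => ?_⟩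
        have := hSr u huS u' h (hur.trans hur'.symm)
        exact he3' (hue'.symm.trans ((congrArg (fun s : Perm α => s P.p₂) this).symm.trans hue))
      · exact ⟨u, ⟨hu, by rw [hur]; exact hxd, by rw [hue]; exact he3⟩, huS⟩
    · obtain ⟨e, he1, he2, -⟩ := hthird d i i
      obtain ⟨u, hu, hur, -⟩ := htwo d e he1.symm hdi he2
      exact ⟨u, Or.inl ⟨hu, hur⟩⟩
  · rintro (_ | _) u hu
    · exact ⟨hu.1.1, hu.2⟩
    · exact ⟨hu.elim And.left fun h => h.1.1, hABS u hu⟩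
  · have key : Disjoint (A ∪ B) (W \ S) := by
      rw [Set.disjoint_left]
      rintro u (hu | hu) h
      · exact h.1.2.1 hu.2
      · exact h.1.2.2 hu.1.2.2
    rintro (_ | _) (_ | _) h
    · exact absurd rfl h
    · exact key.symm
    · exact key
    · exact absurd rfl h
  · rintro (_ | _) e he
    · exact he
    · exact absurd he (Set.notMem_empty e)
  · rintro (_ | _) (_ | _) h
    · exact absurd rfl h
    · exact Set.disjoint_empty _
    · exact Set.empty_disjoint _
    · exact absurd rfl h
  · rintro (_ | _)
    · change Conn (restrictEdges P.graph S _) (W \ S ∪ S)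
      rw [Set.sdiff_union_self]
      refine hWS.mono_graph fun u _ v _ huv => ⟨huv, fun hu hv e he => ?_⟩
      rcases Sym2.mem_iff.1 he with rfl | rfl
      · exact hu
      · exact hv
    · refine (hAB.restrictEdges fun u hu => absurd hu.2 (hABS u hu.1)).union_of_adj_or_mem ?_
      intro s hs
      right
      by_cases h : s P.p₂ = d
      · exact ⟨_, Or.inl (hgA s (hS hs) h), restrictEdges_adj (adj_g s hr.1)
          (Or.inr (hAS _ (hgA s (hS hs) h)))⟩
      · obtain ⟨u, hu, hur, hue⟩ := htwo (s r) d (hdS s hs) (hri s (hS hs)) hdi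
        have hne : u ≠ s := by
          rintro rfl
          exact h hue
        have huS : u ∉ S := fun huS => hne (hSr u huS s hs hur)
        exact ⟨u, Or.inr ⟨⟨hu, by rw [hur]; exact hdS s hs, hue⟩, huS⟩, restrictEdges_adj
          ((hadj u hu s (hS hs) hur).resolve_left hne) (Or.inr huS)⟩

end Frame

/-- A system of partial trees in `C`, each with an exit `ex l`, where the elements of `S` outside
`Y` are joined to `Y` by unused edges in `E₀`; a prescribed vertex `w` is an exit or in `Y`. -/
structure IsPartialSystem {V ι : Type*} (G : SimpleGraph V) (C S : Set V) (w : V) (U : ι → Set V)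
    (E : ι → Set (Sym2 V)) (ex : ι → V) (Y : Finset V) (E₀ : Set (Sym2 V)) : Prop where
  sub : ∀ l, U l ⊆ C \ S
  disj : ∀ l k, l ≠ k → Disjoint (U l) (U k)
  edge : ∀ l, ∀ e ∈ E l, ∀ a ∈ e, a ∈ S
  edisj : ∀ l k, l ≠ k → Disjoint (E l) (E k)
  conn : ∀ l, Conn (restrictEdges G S (E l)) (U l ∪ S)
  exit_inj : Function.Injective ex
  exit_mem : ∀ l, ex l ∈ U l ∪ S
  subY : ↑Y ⊆ S
  nonemptyY : Y.Nonempty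
  exit_notMem : ∀ l, ex l ∉ Y
  adjY : ∀ s ∈ S, s ∈ Y ∨ ∃ y ∈ Y, G.Adj s y ∧ s(s, y) ∈ E₀
  edge₀ : ∀ e ∈ E₀, ∀ a ∈ e, a ∈ S
  edisj₀ : ∀ l, Disjoint (E l) E₀
  mem : w ∈ C → w ∈ Y ∨ ∃ l, ex l = w

section Partial

variable {V ι : Type*} {G : SimpleGraph V} {C : Set V} {U : ι → Set V} {E : ι → Set (Sym2 V)}

theorem IsPartialSystem.comp_equiv {κ : Type*} {S : Set V} {w : V} {ex : ι → V} {Y : Finset V}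
    {E₀ : Set (Sym2 V)} (h : IsPartialSystem G C S w U E ex Y E₀) (e : κ ≃ ι) :
    IsPartialSystem G C S w (U ∘ e) (E ∘ e) (ex ∘ e) Y E₀ where
  sub _ := h.sub _
  disj _ _ hlk := h.disj _ _ (e.injective.ne hlk)
  edge _ := h.edge _
  edisj _ _ hlk := h.edisj _ _ (e.injective.ne hlk)
  conn _ := h.conn _
  exit_inj := h.exit_inj.comp e.injective
  exit_mem _ := h.exit_mem _
  subY := h.subY
  nonemptyY := h.nonemptyY
  exit_notMem _ := h.exit_notMem _
  adjY := h.adjY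
  edge₀ := h.edge₀
  edisj₀ _ := h.edisj₀ _
  mem hw := (h.mem hw).imp_right fun ⟨l, hl⟩ => ⟨e.symm l, by simpa using hl⟩

/-- A system can be chosen to contain `w`, together with representatives of its members. -/
theorem IsSystem.exists_exits {S : Set V} [Nonempty ι] (h : IsSystem G C S U E)
    (hC : Conn G (C \ S)) (w : V) : ∃ (U' : ι → Set V) (ex : ι → V), IsSystem G C S U' E ∧
      (∀ l, ex l ∈ U' l) ∧ (w ∈ C \ S → ∃ l, ex l = w) := by
  classical
  by_cases hw : w ∈ C \ S
  · obtain ⟨U', h', l, hl⟩ := h.exists_mem hC hw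
    choose ex hex using h'.nonempty
    refine ⟨U', Function.update ex l w, h', fun k => ?_, fun _ => ⟨l, by simp⟩⟩
    by_cases hk : k = l
    · subst hk; simpa using hl
    · simpa [hk] using hex k
  · choose ex hex using h.nonempty
    exact ⟨U, ex, h, hex, fun h => absurd h hw⟩

theorem IsSystem.exit_injective {S : Set V} (h : IsSystem G C S U E) {ex : ι → V}
    (hex : ∀ l, ex l ∈ U l) : Function.Injective ex := fun l k hlk => by
  by_contra hne
  exact Set.disjoint_left.1 (h.disj l k hne) (hex l) (hlk ▸ hex k)

theorem IsSystem.isPartialSystem [Nonempty ι] {S : Finset V} (h : IsSystem G C S U E)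
    (hS : S.Nonempty) (hC : Conn G (C \ S)) (w : V) :
    ∃ (U' : ι → Set V) (ex : ι → V), IsPartialSystem G C S w U' E ex S ∅ := by
  obtain ⟨U', ex, h', hex, hw⟩ := h.exists_exits hC w
  refine ⟨U', ex, h'.sub, h'.disj, h'.edge, h'.edisj, h'.conn, h'.exit_injective hex,
    fun l => Or.inl (hex l), subset_rfl, hS, fun l hl => (h'.sub l (hex l)).2 hl,
    fun s hs => Or.inl hs, fun e he => absurd he (Set.notMem_empty e),
    fun l => Set.disjoint_empty _, fun hwC => ?_⟩
  by_cases hwS : w ∈ S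
  · exact Or.inl hwS
  · exact Or.inr (hw ⟨hwC, hwS⟩)

/-- A path inside a triangle provides one more member. -/
theorem IsSystem.isPartialSystem_triangle [DecidableEq V] [Nonempty ι] {x y z : V}
    (h : IsSystem G C {x, y, z} U fun _ => ∅) (hC : Conn G (C \ {x, y, z})) (w : V)
    (hxy : G.Adj x y) (hyz : G.Adj y z) (hxz : G.Adj x z) :
    ∃ (U' : Option ι → Set V) (E' : Option ι → Set (Sym2 V)) (ex : Option ι → V),
      IsPartialSystem G C {x, y, z} w U' E' ex {y, z} {s(x, z)} := by
  obtain ⟨U', ex, h', hex, hw⟩ := h.exists_exits hC w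
  have hexS : ∀ l, ex l ≠ x ∧ ex l ≠ y ∧ ex l ≠ z := fun l => by
    have := (h'.sub l (hex l)).2
    simpa using this
  refine ⟨fun l => l.elim ∅ U', fun l => l.elim {s(x, y), s(y, z)} fun _ => ∅,
    fun l => l.elim x ex, ?_, ?_, ?_, ?_, ?_, ?_, ?_, ?_, ?_, ?_, ?_, ?_, ?_, ?_⟩
  · rintro (_ | l)
    · exact Set.empty_subset _
    · exact h'.sub l
  · rintro (_ | l) (_ | k) hlk
    · exact absurd rfl hlk
    · exact Set.empty_disjoint _
    · exact Set.disjoint_empty _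
    · exact h'.disj l k fun h => hlk (congrArg some h)
  · rintro (_ | l) e he a ha
    · rcases he with rfl | he
      · rcases Sym2.mem_iff.1 ha with rfl | rfl <;> simp
      · rw [Set.mem_singleton_iff.1 he] at ha
        rcases Sym2.mem_iff.1 ha with rfl | rfl <;> simp
    · exact absurd he (Set.notMem_empty e)
  · rintro (_ | l) (_ | k) hlk
    · exact absurd rfl hlk
    · exact Set.disjoint_empty _
    · exact Set.empty_disjoint _
    · exact Set.disjoint_empty _
  · rintro (_ | l)
    · have h1 : (restrictEdges G {x, y, z} {s(x, y), s(y, z)}).Adj x y :=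
        ⟨hxy, fun _ _ => Or.inl rfl⟩
      have h2 : (restrictEdges G {x, y, z} {s(x, y), s(y, z)}).Adj y z :=
        ⟨hyz, fun _ _ => Or.inr rfl⟩
      have h3 := ((conn_singleton z).insert_adj (Set.mem_singleton z) h2).insert_adj
        (Set.mem_insert _ _) h1
      simpa using h3
    · exact h'.conn l
  · rintro (_ | l) (_ | k) hlk
    · rfl
    · exact absurd hlk.symm (hexS k).1
    · exact absurd hlk (hexS l).1
    · rw [h'.exit_injective hex hlk]
  · rintro (_ | l)
    · simp
    · exact Or.inl (hex l)
  · intro u hu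
    simp only [Finset.coe_insert, Finset.coe_singleton] at hu
    exact Or.inr hu
  · simp
  · rintro (_ | l)
    · simpa using ⟨hxy.ne, hxz.ne⟩
    · simpa using (hexS l).2
  · rintro s (rfl | rfl | rfl)
    · exact Or.inr ⟨z, by simp, hxz, rfl⟩
    · simp
    · simp
  · rintro e he a ha
    rw [Set.mem_singleton_iff.1 he] at ha
    rcases Sym2.mem_iff.1 ha with rfl | rfl <;> simp
  · rintro (_ | l)
    · have hxy := hxy.ne
      have hyz := hyz.ne
      have hxz := hxz.ne
      simp only [Option.elim, Set.disjoint_singleton_right, Set.mem_insert_iff,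
        Set.mem_singleton_iff, Sym2.eq_iff]
      tauto
    · exact Set.empty_disjoint _
  · intro hwC
    by_cases hwS : w ∈ ({x, y, z} : Set V)
    · rcases hwS with rfl | rfl | rfl
      · exact Or.inr ⟨none, rfl⟩
      · simp
      · simp
    · obtain ⟨l, hl⟩ := hw ⟨hwC, hwS⟩
      exact Or.inr ⟨some l, hl⟩

end Partial

namespace Frame

variable {α : Type*} [DecidableEq α] [Fintype α] {P : Frame α} {u v w x y z : Perm α}
  {r q a b d m i : α} {S : Set (Perm α)}

theorem hasSystem_of_layer (hn : 5 ≤ Fintype.card α) (hm : P.Out m) (hr : r ∈ P.spare m)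
    (hx : x m = i) (hy : y m = i) (hz : z m = i) (hs : Perm.sign y = Perm.sign x)
    (hs' : Perm.sign z = Perm.sign x) (hxy : x r ≠ y r) (hxz : x r ≠ z r) (hyz : y r ≠ z r) :
    HasSystem P.graph (sect m i) {x, y, z} (Fintype.card α - 2) := by
  have hinj : ∀ s ∈ ({x, y, z} : Set (Perm α)), ∀ s' ∈ ({x, y, z} : Set (Perm α)),
      s r = s' r → s = s' := by
    rintro s (rfl | rfl | rfl) s' (rfl | rfl | rfl) h <;> first | rfl | skip
    exacts [absurd h hxy, absurd h hxz, absurd h.symm hxy, absurd h hyz, absurd h.symm hxz,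
      absurd h.symm hyz]
  have hsect : ∀ s ∈ ({x, y, z} : Set (Perm α)), s m = i := by
    rintro s (rfl | rfl | rfl) <;> assumption
  have hQ : ∀ d ∈ ({i, x r, y r, z r} : Finset α)ᶜ, d ≠ i ∧
      ∀ s ∈ ({x, y, z} : Set (Perm α)), s r ≠ d := by
    intro d hd
    simp only [Finset.mem_compl, Finset.mem_insert, Finset.mem_singleton, not_or] at hd
    refine ⟨hd.1, ?_⟩
    rintro s (rfl | rfl | rfl)
    exacts [Ne.symm hd.2.1, Ne.symm hd.2.2.1, Ne.symm hd.2.2.2]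
  have hQc : Fintype.card α ≤ (({i, x r, y r, z r} : Finset α)ᶜ).card + 4 := by
    have h1 := Finset.card_compl_add_card ({i, x r, y r, z r} : Finset α)
    have h2 := Finset.card_le_four (a := i) (b := x r) (c := y r) (d := z r)
    omega
  by_cases hn6 : 6 ≤ Fintype.card α
  · exact hasSystem_of_injOn hn6 hm hr hsect hinj _ hQ hQc
  · obtain ⟨d, hd⟩ : (({i, x r, y r, z r} : Finset α)ᶜ).Nonempty := by
      rw [← Finset.card_pos]; omega
    have hS : ({x, y, z} : Set (Perm α)) ⊆ P.layer ∅ {m} x := by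
      simp [Set.insert_subset_iff, mem_layer_empty, hx, hy, hz, hs, hs']
    rw [show Fintype.card α - 2 = 2 + 1 by omega]
    exact hasSystem_add_layer (by omega) hm hx hS (hasSystem_two_of_injOn (by omega) hm hr hx
      (by simp) hS hinj (hQ d hd).1 (hQ d hd).2)

/-- Three vertices of a cluster not forming a triangle have a system. -/
theorem hasSystem_of_not_triangle (hn : 5 ≤ Fintype.card α) (hm : P.Out m) (hx : x m = i)
    (hy : y m = i) (hz : z m = i) (hxy : x ≠ y) (hxz : x ≠ z) (hyz : y ≠ z)
    (h : ¬ ∀ u ∈ ({x, y, z} : Set (Perm α)), Perm.sign u = Perm.sign x ∧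
      ∀ r ∈ P.spare m, u r = x r) :
    HasSystem P.graph (sect m i) {x, y, z} (Fintype.card α - 2) := by
  have hp1 : ({x, y, z} : Set (Perm α)) = {x, z, y} := by
    ext; simp only [Set.mem_insert_iff, Set.mem_singleton_iff]; tauto
  have hp2 : ({x, y, z} : Set (Perm α)) = {y, z, x} := by
    ext; simp only [Set.mem_insert_iff, Set.mem_singleton_iff]; tauto
  by_cases hs : Perm.sign y = Perm.sign x
  · by_cases hs' : Perm.sign z = Perm.sign x
    · obtain ⟨r, hr, hne⟩ : ∃ r ∈ P.spare m, ¬ (y r = x r ∧ z r = x r) := by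
        by_contra! hno
        refine h ?_
        rintro u (rfl | rfl | rfl)
        · exact ⟨rfl, fun _ _ => rfl⟩
        · exact ⟨hs, fun r hr => (hno r hr).1⟩
        · exact ⟨hs', fun r hr => (hno r hr).2⟩
      by_cases h1 : y r = x r
      · exact hasSystem_of_pos hn hm hr hx hy hz hxy hs hs' h1 fun h => hne ⟨h1, h⟩
      · by_cases h2 : z r = x r
        · rw [hp1]
          exact hasSystem_of_pos hn hm hr hx hz hy hxz hs' hs h2 h1
        · by_cases h3 : z r = y r
          · rw [hp2]
            exact hasSystem_of_pos hn hm hr hy hz hx hyz (hs'.trans hs.symm) hs.symm h3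
              (Ne.symm h1)
          · exact hasSystem_of_layer hn hm hr hx hy hz hs hs' (Ne.symm h1) (Ne.symm h2)
              (Ne.symm h3)
    · exact hasSystem_of_sign (by omega) hm hx hy hz hxy hs hs'
  · by_cases hs' : Perm.sign z = Perm.sign x
    · rw [hp1]
      exact hasSystem_of_sign (by omega) hm hx hz hy hxz hs' hs
    · rw [hp2]
      refine hasSystem_of_sign (by omega) hm hy hz hx hyz ?_ (Ne.symm hs)
      rw [(units_eq_or_eq_neg _ _).resolve_left hs, (units_eq_or_eq_neg _ _).resolve_left hs']

theorem exists_isSystem_of_agree (hm : P.Out m) (hx : x m = i) (hxS : x ∈ S)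
    (hS : ∀ u ∈ S, Perm.sign u = Perm.sign x ∧ ∀ q, P.Out q → u q = x q) :
    ∃ U : Option {r // r ∈ P.spare m} → Set (Perm α),
      IsSystem P.graph (sect m i) S U fun _ => ∅ := by
  let D : α → Finset α := fun r => insert m ((P.spare m).erase r)
  have hD : ∀ r, ∀ q ∈ D r, P.Out q := by
    intro r q hq
    rcases Finset.mem_insert.1 hq with rfl | hq
    · exact hm
    · exact (mem_spare.1 (Finset.mem_of_mem_erase hq)).1
  let Q : α → Set (Perm α) := fun r => {u ∈ P.layer ∅ (D r) x | u r ≠ x r}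
  let T : Set (Perm α) := {u | ∃ s ∈ S, u = s * P.t}
  have hQc : ∀ r ∈ P.spare m, Conn P.graph (Q r) := by
    intro r hr
    have hc := card_spare hm
    have h1 := Finset.card_erase_add_one hr
    have hrm := (mem_spare.1 hr).2
    exact (layer_minus_kconn (f := 0) (hD r) (mem_spare.1 hr).1 (by simp [D, hrm])
      (by rw [Finset.card_insert_of_notMem (by simp [mem_spare])]; omega)).conn (by simp)
  have hgQ : ∀ r ∈ P.spare m, ∀ s ∈ S, s * P.g r ∈ Q r := by
    intro r hr s hs
    have hr' := mem_spare.1 hr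
    refine ⟨mem_layer_empty.2 ⟨fun q hq => ?_, ?_⟩, ?_⟩
    · have hqr : q ≠ r := by
        rintro rfl
        rcases Finset.mem_insert.1 hq with rfl | hq
        · exact hr'.2 rfl
        · exact Finset.notMem_erase _ _ hq
      rw [mul_g_out (hD r q hq) hqr, (hS s hs).2 q (hD r q hq)]
    · rw [sign_mul_g hr'.1, (hS s hs).1]
    · rw [mul_g_self, ← (hS s hs).2 r hr'.1]
      exact fun h => hr'.1.2.2 (s.injective h).symm
  have hTs : ∀ u ∈ T, Perm.sign u = -Perm.sign x := by
    rintro u ⟨s, hs, rfl⟩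
    rw [sign_mul_t, (hS s hs).1]
  have hTc : Conn P.graph T := by
    intro u hu v hv
    have huv : u = v ∨ P.graph.Adj v u := by
      refine eq_or_adj (fun q hq => ?_) ((hTs u hu).trans (hTs v hv).symm)
      obtain ⟨s, hs, rfl⟩ := hu
      obtain ⟨s', hs', rfl⟩ := hv
      rw [mul_t_out hq, mul_t_out hq, (hS s hs).2 q hq, (hS s' hs').2 q hq]
    rcases huv with rfl | h
    · exact ReachIn.refl _
    · exact ReachIn.of_adj h.symm hu hv
  have hTS : ∀ u ∈ T, u ∉ S := fun u hu huS =>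
    units_ne_neg _ ((hS u huS).1.symm.trans (hTs u hu))
  have hQS : ∀ r ∈ P.spare m, ∀ u ∈ Q r, u ∉ S := fun r hr u hu huS =>
    hu.2 ((hS u huS).2 r (mem_spare.1 hr).1)
  have hTQ : ∀ r, Disjoint T (Q r) := fun r => Set.disjoint_left.2 fun u hu hu' =>
    units_ne_neg _ (hu'.1.2.symm.trans (hTs u hu))
  refine ⟨fun l => l.elim T fun r => Q r.1, ?_, ?_, ?_, ?_, ?_, ?_⟩
  · rintro (_ | ⟨r, hr⟩)
    · exact ⟨_, x, hxS, rfl⟩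
    · exact ⟨_, hgQ r hr x hxS⟩
  · rintro (_ | ⟨r, hr⟩) u hu
    · refine ⟨?_, hTS u hu⟩
      obtain ⟨s, hs, rfl⟩ := hu
      change (s * P.t) m = i
      rw [mul_t_out hm, (hS s hs).2 m hm, hx]
    · exact ⟨((mem_layer_empty.1 hu.1).1 m (by simp [D])).trans hx, hQS r hr u hu⟩
  · rintro (_ | ⟨r, hr⟩) (_ | ⟨r', hr'⟩) h
    · exact absurd rfl h
    · exact hTQ r'
    · exact (hTQ r).symm
    · have hne : r ≠ r' := fun h' => h (congrArg some (Subtype.ext h'))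
      refine Set.disjoint_left.2 fun u hu hu' => hu.2 ?_
      exact (mem_layer_empty.1 hu'.1).1 r (by simp [D, hne, hr])
  · exact fun l e he => absurd he (Set.notMem_empty e)
  · exact fun l k _ => Set.disjoint_empty _
  · rintro (_ | ⟨r, hr⟩)
    · refine (hTc.restrictEdges fun u hu => absurd hu.2 (hTS u hu.1)).union_of_adj fun s hs => ?_
      exact ⟨s * P.t, ⟨s, hs, rfl⟩, restrictEdges_adj (adj_t s) (Or.inr (hTS _ ⟨s, hs, rfl⟩))⟩
    · refine ((hQc r hr).restrictEdges fun u hu => absurd hu.2 (hQS r hr u hu.1)).union_of_adj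
        fun s hs => ?_
      exact ⟨_, hgQ r hr s hs, restrictEdges_adj (adj_g s (mem_spare.1 hr).1)
        (Or.inr (hQS r hr _ (hgQ r hr s hs)))⟩

/-- Three vertices of a cluster always have a partial system. -/
theorem exists_isPartialSystem (hn : 5 ≤ Fintype.card α) (hm : P.Out m) (hx : x m = i)
    (hy : y m = i) (hz : z m = i) (hxy : x ≠ y) (hxz : x ≠ z) (hyz : y ≠ z) (w : Perm α) :
    ∃ (U : Fin (Fintype.card α - 2) → Set (Perm α)) (E : _ → Set (Sym2 (Perm α)))
      (ex : _ → Perm α) (Y : Finset (Perm α)) (E₀ : Set (Sym2 (Perm α))),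
      IsPartialSystem P.graph (sect m i) {x, y, z} w U E ex Y E₀ := by
  have hC : Conn P.graph (sect m i \ {x, y, z}) := by
    have h := (sect_kconn (i := i) (by omega) hm) {x, y, z}
      (by have := Finset.card_le_three (a := x) (b := y) (c := z); omega)
    simpa using h
  by_cases h : ∀ u ∈ ({x, y, z} : Set (Perm α)), Perm.sign u = Perm.sign x ∧
      ∀ r ∈ P.spare m, u r = x r
  · have hm' : ∀ u ∈ ({x, y, z} : Set (Perm α)), u m = x m := by
      rintro u (rfl | rfl | rfl)
      exacts [rfl, hy.trans hx.symm, hz.trans hx.symm]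
    have h' : ∀ u ∈ ({x, y, z} : Set (Perm α)), Perm.sign u = Perm.sign x ∧
        ∀ q, P.Out q → u q = x q := fun u hu => ⟨(h u hu).1, fun q hq => by
      by_cases hqm : q = m
      · exact hqm ▸ hm' u hu
      · exact (h u hu).2 q (mem_spare.2 ⟨hq, hqm⟩)⟩
    have hadj : ∀ u ∈ ({x, y, z} : Set (Perm α)), ∀ v ∈ ({x, y, z} : Set (Perm α)), u ≠ v →
        P.graph.Adj u v := fun u hu v hv huv =>
      (eq_or_adj (fun q hq => ((h' v hv).2 q hq).trans ((h' u hu).2 q hq).symm)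
        ((h' v hv).1.trans (h' u hu).1.symm)).resolve_left huv.symm
    obtain ⟨U, hU⟩ := exists_isSystem_of_agree hm hx (Set.mem_insert x {y, z}) h'
    obtain ⟨U', E', ex, h''⟩ := hU.isPartialSystem_triangle hC w (hadj x (by simp) y (by simp) hxy)
      (hadj y (by simp) z (by simp) hyz) (hadj x (by simp) z (by simp) hxz)
    have hcard : Fintype.card (Option (Option {r // r ∈ P.spare m})) = Fintype.card α - 2 := by
      have := card_spare hm
      simp only [Fintype.card_option, Fintype.card_coe]
      omega
    exact ⟨_, _, _, _, _, h''.comp_equiv (Fintype.equivFinOfCardEq hcard).symm⟩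
  · obtain ⟨U, E, hU⟩ := hasSystem_of_not_triangle hn hm hx hy hz hxy hxz hyz h
    have : Nonempty (Fin (Fintype.card α - 2)) := ⟨⟨0, by omega⟩⟩
    have hS : (({x, y, z} : Finset (Perm α)) : Set (Perm α)) = {x, y, z} := by simp
    rw [← hS] at hU hC ⊢
    obtain ⟨U', ex, h'⟩ := hU.isPartialSystem ⟨x, by simp⟩ hC w
    exact ⟨_, _, _, _, _, h'⟩

end Frame

section Assembly

variable {V ι : Type*} [DecidableEq V] {G : SimpleGraph V} {C H S : Set V} {w w' : V}
  {U : ι → Set V} {E : ι → Set (Sym2 V)} {ex : ι → V} {Y : Finset V} {E₀ : Set (Sym2 V)}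
  {F : V → Set V} {FU : Set V}

/-- A partial system in `C` and a double fan in `H` are glued along the edges `u — γ u`. -/
theorem IsPartialSystem.exists_isIDSTFamily [Fintype ι] (h : IsPartialSystem G C S w' U E ex Y E₀)
    (hSC : S ⊆ C) (hCH : Disjoint C H) (hw : w ∈ H) {γ : V → V} (hγ : Function.Injective γ)
    (hadj : ∀ u, G.Adj u (γ u))
    (hF : IsDoubleFan G H w (Finset.univ.image (γ ∘ ex)) (Y.image γ) F FU) :
    ∃ T : Fin (Fintype.card ι + 1) → G.Subgraph, IsIDSTFamily G (insert w S) T := by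
  have hwS : w ∉ S := fun h => Set.disjoint_left.1 hCH (hSC h) hw
  have hT : ∀ l, γ (ex l) ∈ Finset.univ.image (γ ∘ ex) := fun l =>
    Finset.mem_image_of_mem (γ ∘ ex) (Finset.mem_univ l)
  have hHS : ∀ u ∈ H \ {w}, u ∉ insert w S := by
    rintro u ⟨hu, huw⟩ (rfl | huS)
    · exact huw rfl
    · exact Set.disjoint_left.1 hCH (hSC huS) hu
  have hinsert : ∀ {A : Set V} {D : Set (Sym2 V)}, Conn G (insert w A) → A ⊆ H \ {w} →
      Conn (restrictEdges G (insert w S) D) (insert w A) := fun hA hAH =>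
    hA.restrictEdges fun a ha b hb => by
      have key : ∀ a, a ∈ insert w _ ∩ insert w S → a = w := fun a ha =>
        ha.1.resolve_right fun h => hHS a (hAH h) ha.2
      rw [key a ha, key b hb]
  have hew : ∀ {D : Set (Sym2 V)} {e : Sym2 V} {a : V}, (∀ e ∈ D, ∀ a ∈ e, a ∈ S) → e ∈ D →
      e ≠ s(a, w) := by
    rintro D e a hD he rfl
    exact hwS (hD _ he w (by simp))
  let U' : Option ι → Set V := fun l => l.elim FU fun l => U l ∪ F (γ (ex l))
  let E' : Option ι → Set (Sym2 V) :=
    fun l => l.elim (E₀ ∪ {e | ∃ y ∈ Y, e = s(y, w)}) fun l => E l ∪ {s(ex l, w)}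
  have hUF : ∀ l {A : Set V}, A ⊆ H \ {w} → Disjoint (U l) A := fun l A hA =>
    (hCH.mono_left fun u hu => (h.sub l hu).1).mono_right fun u hu => (hA hu).1
  have hUdisj : ∀ l k, l ≠ k → Disjoint (U' l) (U' k) := by
    have key : ∀ l, Disjoint (U' (some l)) (U' none) := fun l =>
      Disjoint.sup_left (hUF l hF.subU) (hF.disjU _ (hT l))
    rintro (_ | l) (_ | k) hlk
    · exact absurd rfl hlk
    · exact (key k).symm
    · exact key l
    · have hlk' : l ≠ k := fun h => hlk (congrArg some h)
      refine Disjoint.sup_left (Disjoint.sup_right (h.disj l k hlk') (hUF l (hF.sub _ (hT k))))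
        (Disjoint.sup_right (hUF k (hF.sub _ (hT l))).symm (hF.disj _ (hT l) _ (hT k) ?_))
      exact (hγ.comp h.exit_inj).ne hlk'
  have hEdisj : ∀ l k, l ≠ k → Disjoint (E' l) (E' k) := by
    have key : ∀ l, Disjoint (E' (some l)) (E' none) := by
      refine fun l => Set.disjoint_left.2 ?_
      rintro e (he | rfl) (he' | ⟨y, hy, he'⟩)
      · exact Set.disjoint_left.1 (h.edisj₀ l) he he'
      · exact hew (h.edge l) he he'
      · exact hew h.edge₀ he' rfl
      · rw [Sym2.congr_left] at he'
        exact h.exit_notMem l (he' ▸ hy)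
    rintro (_ | l) (_ | k) hlk
    · exact absurd rfl hlk
    · exact (key k).symm
    · exact key l
    · have hlk' : l ≠ k := fun h => hlk (congrArg some h)
      refine Set.disjoint_left.2 ?_
      rintro e (he | rfl) (he' | he')
      · exact Set.disjoint_left.1 (h.edisj l k hlk') he he'
      · exact hew (h.edge l) he he'
      · exact hew (h.edge k) he' rfl
      · exact hlk' (h.exit_inj (Sym2.congr_left.1 he'))
  refine Godan.exists_isIDSTFamily (by simp) G (Set.insert_nonempty w S) U' E' hUdisj hEdisj ?_
  rintro (_ | l)
  · have h1 : Conn (restrictEdges G (insert w S) (E' none)) (insert w FU ∪ Y) := by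
      refine (hinsert hF.connU hF.subU).union_of_adj fun y hy => ?_
      refine ⟨γ y, hF.memU (by simpa using ⟨y, hy, rfl⟩), hadj y, fun _ hγS => Or.inr ?_⟩
      have : γ y = w := (hF.memU (Finset.mem_coe.2 (Finset.mem_image_of_mem γ hy))).resolve_right
        fun h => hHS _ (hF.subU h) hγS
      exact ⟨y, hy, by rw [this]⟩
    have h2 : Conn (restrictEdges G (insert w S) (E' none)) (insert w FU ∪ Y ∪ S) := by
      refine h1.union_of_adj_or_mem fun s hs => ?_
      rcases h.adjY s hs with hs' | ⟨y, hy, hsy, he⟩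
      · exact Or.inl (Or.inr hs')
      · exact Or.inr ⟨y, Or.inr hy, hsy, fun _ _ => Or.inl he⟩
    convert h2 using 1
    ext u
    have := @h.subY u
    simp only [U', Option.elim, Set.mem_union, Set.mem_insert_iff, Finset.mem_coe] at this ⊢
    tauto
  · have h1 : Conn (restrictEdges G (insert w S) (E' (some l))) (U l ∪ S) :=
      (h.conn l).mono_graph fun a ha b hb hab => by
        have hne : ∀ a ∈ U l ∪ S, a ≠ w := by
          rintro a (ha | ha) rfl
          · exact Set.disjoint_left.1 hCH (h.sub l ha).1 hw
          · exact hwS ha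
        exact ⟨hab.1, fun ha' hb' => Or.inl
          (hab.2 (ha'.resolve_left (hne a ha)) (hb'.resolve_left (hne b hb)))⟩
    have h2 := h1.union_adj (hinsert (D := E' (some l)) (hF.conn _ (hT l)) (hF.sub _ (hT l)))
      (h.exit_mem l) (hF.mem _ (hT l)) ⟨hadj (ex l), fun _ hγS => Or.inr ?_⟩
    · convert h2 using 1
      ext u
      simp only [U', Option.elim, Set.mem_union, Set.mem_insert_iff]
      tauto
    · have : γ (ex l) = w := (hF.mem _ (hT l)).resolve_right fun h => hHS _ (hF.sub _ (hT l) h) hγS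
      rw [this]
      rfl

end Assembly

namespace Frame

variable {α : Type*} [Fintype α] [DecidableEq α] {P : Frame α} {m i : α} {x y z w : Perm α}

theorem exists_isIDSTFamily (hn : 5 ≤ Fintype.card α) (hm : P.Out m) (hx : x m = i)
    (hy : y m = i) (hz : z m = i) (hxy : x ≠ y) (hxz : x ≠ z) (hyz : y ≠ z) (hw : w m ≠ i) :
    ∃ T : Fin (Fintype.card α - 1) → P.graph.Subgraph,
      IsIDSTFamily P.graph {w, x, y, z} T := by
  obtain ⟨U, E, ex, Y, E₀, h⟩ := exists_isPartialSystem hn hm hx hy hz hxy hxz hyz (w * P.g m)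
  have hγ : Function.Injective fun u : Perm α => u * P.g m := mul_left_injective _
  have hSC : ({x, y, z} : Set (Perm α)) ⊆ sect m i := by
    rintro u (rfl | rfl | rfl) <;> assumption
  have hexC : ∀ l, ex l ∈ sect m i := fun l =>
    (h.exit_mem l).elim (fun hl => (h.sub l hl).1) fun hl => hSC hl
  have hYC : Y.card ≤ 3 := by
    refine (Finset.card_le_card (t := {x, y, z}) fun u hu => ?_).trans Finset.card_le_three
    simpa using h.subY hu
  obtain ⟨F, FU, hF⟩ := exists_doubleFan (w := w) hn hm hw
    (T := Finset.univ.image ((fun u => u * P.g m) ∘ ex)) (Y := Y.image fun u => u * P.g m)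
    (by
      intro u hu
      obtain ⟨l, -, rfl⟩ := Finset.mem_image.1 hu
      exact (mul_g_p₂ hm _).trans (hexC l))
    (by
      intro u hu
      obtain ⟨y, hy, rfl⟩ := Finset.mem_image.1 hu
      exact (mul_g_p₂ hm _).trans (hSC (h.subY hy)))
    (by
      rw [Finset.card_image_of_injective _ (hγ.comp h.exit_inj), Finset.card_univ, Fintype.card_fin]
      omega)
    (Finset.card_image_le.trans hYC) (h.nonemptyY.image _)
    (by
      rw [Finset.disjoint_left]
      intro u hu hu'
      obtain ⟨l, -, rfl⟩ := Finset.mem_image.1 hu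
      obtain ⟨y, hy, hyl⟩ := Finset.mem_image.1 hu'
      exact h.exit_notMem l (hγ hyl ▸ hy))
    (fun hw2 => (h.mem ((mul_g_self w).trans hw2)).symm.imp
      (fun ⟨l, hl⟩ => Finset.mem_image.2 ⟨l, Finset.mem_univ _, by
        rw [Function.comp_apply, hl, mul_g_g _ hm]⟩)
      fun hY => Finset.mem_image.2 ⟨_, hY, mul_g_g w hm⟩)
  have hCH : Disjoint (sect m i) {u : Perm α | u m ≠ i} :=
    Set.disjoint_left.2 fun u hu hu' => hu' hu
  have := h.exists_isIDSTFamily hSC hCH hw hγ (fun u => adj_g u hm) hF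
  rwa [Fintype.card_fin, show Fintype.card α - 2 + 1 = Fintype.card α - 1 by omega] at this

end Frame

section Growth

variable {V X : Type*}

/-- The edges `(child, parent)` of the tree grown from the root `r`: a step `e` applies `a (e % 4)`
to the vertex number `e / 4` of the tree built so far. -/
def growth (a : ℕ → X → X) (r : X) : List ℕ → List (X × X)
  | [] => []
  | e :: L =>
    let p := ((growth a r L).map Prod.fst).getD (e / 4) r
    (a (e % 4) p, p) :: growth a r L

/-- Three grown trees meeting only in `S` and the root. -/
def IsCertificate (a : ℕ → X → X) (r : X) (S : List X) (c : Fin 3 → List ℕ) : Prop :=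
  (∀ k, ∀ s ∈ S, s ∈ (growth a r (c k)).map Prod.fst) ∧ ∀ k l, k ≠ l →
    (∀ v ∈ (growth a r (c k)).map Prod.fst, v ∈ (growth a r (c l)).map Prod.fst → v ∈ S) ∧
    ∀ e ∈ growth a r (c k), e ∉ growth a r (c l) ∧ e.swap ∉ growth a r (c l)

instance [DecidableEq X] (a : ℕ → X → X) (r : X) (S : List X) (c : Fin 3 → List ℕ) :
    Decidable (IsCertificate a r S c) :=
  inferInstanceAs (Decidable (_ ∧ _))

theorem growth_map {a : ℕ → V → V} {b : ℕ → X → X} {φ : V → X}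
    (h : ∀ k u, φ (a k u) = b k (φ u)) (r : V) (L : List ℕ) :
    growth b (φ r) L = (growth a r L).map (Prod.map φ φ) := by
  induction L with
  | nil => rfl
  | cons e L ih =>
    have hp : ((growth b (φ r) L).map Prod.fst).getD (e / 4) (φ r) =
        φ (((growth a r L).map Prod.fst).getD (e / 4) r) := by
      rw [ih, List.map_map, ← List.getD_map (f := φ), List.map_map]
      rfl
    simp only [growth, List.map_cons, Prod.map_apply, hp, h]
    rw [ih]

theorem conn_growth {G : SimpleGraph V} {a : ℕ → V → V} (h : ∀ k u, G.Adj u (a k u)) (S : Set V)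
    (r : V) (L : List ℕ) :
    Conn (restrictEdges G S {e | ∃ p ∈ growth a r L, e = s(p.1, p.2)})
      (insert r {v | v ∈ (growth a r L).map Prod.fst}) := by
  induction L with
  | nil => simpa [growth] using conn_singleton r
  | cons e L ih =>
    set p := ((growth a r L).map Prod.fst).getD (e / 4) r with hp
    have hmem : p ∈ insert r {v | v ∈ (growth a r L).map Prod.fst} := by
      rcases lt_or_ge (e / 4) ((growth a r L).map Prod.fst).length with h | h
      · rw [hp, List.getD_eq_getElem _ _ h]
        exact Or.inr (List.getElem_mem h)
      · exact Or.inl (List.getD_eq_default _ _ h)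
    have hgr : growth a r (e :: L) = (a (e % 4) p, p) :: growth a r L := rfl
    have h1 : Conn (restrictEdges G S {f | ∃ p ∈ growth a r (e :: L), f = s(p.1, p.2)})
        (insert r {v | v ∈ (growth a r L).map Prod.fst}) := by
      refine ih.mono_graph ?_
      rintro x - y - ⟨hxy, h'⟩
      refine ⟨hxy, fun hx hy => ?_⟩
      obtain ⟨q, hq, hq'⟩ := h' hx hy
      exact ⟨q, hgr ▸ List.mem_cons_of_mem _ hq, hq'⟩
    have h2 := h1.insert_adj (u := a (e % 4) p) hmem
      ⟨(h _ p).symm, fun _ _ => ⟨(a (e % 4) p, p), hgr ▸ List.mem_cons_self, rfl⟩⟩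
    convert h2 using 1
    ext v
    simp only [hgr, List.map_cons, List.mem_cons, Set.mem_insert_iff, Set.mem_ofPred_eq]
    tauto

theorem IsCertificate.exists_isIDSTFamily {G : SimpleGraph V} {a : ℕ → V → V} {b : ℕ → X → X}
    {φ : V → X} (hφ : Function.Injective φ) (hab : ∀ k u, φ (a k u) = b k (φ u))
    (hadj : ∀ k u, G.Adj u (a k u)) {w : V} {S : Set V} {L : List X} (hS : ∀ u, u ∈ S ↔ φ u ∈ L)
    {c : Fin 3 → List ℕ} (hc : IsCertificate b (φ w) L c) :
    ∃ T : Fin 3 → G.Subgraph, IsIDSTFamily G (insert w S) T := by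
  let W : Fin 3 → Set V := fun k => {v | v ∈ (growth a w (c k)).map Prod.fst}
  have hW : ∀ k v, v ∈ W k ↔ φ v ∈ (growth b (φ w) (c k)).map Prod.fst := by
    intro k v
    rw [growth_map hab, List.map_map, show Prod.fst ∘ Prod.map φ φ = φ ∘ Prod.fst from rfl,
      ← List.map_map, List.mem_map_of_injective hφ]
    rfl
  have hE : ∀ k p, p ∈ growth a w (c k) ↔ Prod.map φ φ p ∈ growth b (φ w) (c k) := fun k p => by
    rw [growth_map hab, List.mem_map_of_injective (hφ.prodMap hφ)]
  refine Godan.exists_isIDSTFamily (Fintype.card_fin 3) G (Set.insert_nonempty w S)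
    (fun k => W k \ insert w S) (fun k => {e | ∃ p ∈ growth a w (c k), e = s(p.1, p.2)}) ?_ ?_ ?_
  · refine fun k l hkl => Set.disjoint_left.2 fun v hv hv' => hv.2 (Or.inr ((hS v).2 ?_))
    exact (hc.2 k l hkl).1 _ ((hW k v).1 hv.1) ((hW l v).1 hv'.1)
  · refine fun k l hkl => Set.disjoint_left.2 ?_
    rintro _ ⟨p, hp, rfl⟩ ⟨q, hq, hpq⟩
    have h := (hc.2 k l hkl).2 _ ((hE k p).1 hp)
    rw [Sym2.eq_iff] at hpq
    rcases hpq with ⟨h1, h2⟩ | ⟨h1, h2⟩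
    · exact h.1 ((hE l p).1 ((Prod.ext h1 h2 : p = q) ▸ hq))
    · exact h.2 ((hE l p.swap).1 ((Prod.ext h2 h1 : p.swap = q) ▸ hq))
  · intro k
    convert conn_growth hadj (insert w S) w (c k) using 1
    have hSW : S ⊆ W k := fun u hu => (hW k u).2 (hc.1 k _ ((hS u).1 hu))
    ext v
    have := @hSW v
    simp only [Set.mem_union, Set.mem_sdiff, Set.mem_insert_iff]
    change _ ↔ v = w ∨ v ∈ W k
    tauto

end Growth

section Four

/-- The word of a permutation of four symbols. -/
def word (u : Perm (Fin 4)) : List (Fin 4) := [u 0, u 1, u 2, u 3]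

/-- The words adjacent to a given one. -/
def shuffle (k : ℕ) : List (Fin 4) → List (Fin 4)
  | [a, b, c, d] => match k with
    | 0 => [b, a, c, d]
    | 1 => [b, c, a, d]
    | 2 => [c, a, b, d]
    | _ => [b, a, d, c]
  | l => l

/-- The words on `a, b, c, d` ending with `d`. -/
def wordsEnding (a b c d : Fin 4) : List (List (Fin 4)) :=
  [[a, b, c, d], [a, c, b, d], [b, a, c, d], [b, c, a, d], [c, a, b, d], [c, b, a, d]]

/-- The words ending with `j`, for `j < 3`. -/
def clusterWords : Fin 3 → List (List (Fin 4)) :=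
  ![wordsEnding 1 2 3 0, wordsEnding 0 2 3 1, wordsEnding 0 1 3 2]

/-- Certificates for three vertices whose last symbol is `j`, the root being the identity. -/
def certificates : Fin 3 → List (Fin 3 → List ℕ) := ![
  [![[0, 2, 3, 1, 3, 0], [5, 2, 4, 2, 3, 1], [0, 10, 3, 4, 3, 1, 3, 2]],
   ![[1, 0, 2, 3, 1], [9, 4, 2, 3, 2, 3], [6, 0, 3, 1, 12, 3, 1, 3, 2]],
   ![[0, 2, 3, 1], [2, 8, 6, 1, 3, 2, 3], [0, 2, 3, 4, 3, 1, 3, 2]],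
   ![[1, 0, 2, 3, 1], [8, 5, 2, 3, 2, 0], [3, 1, 3, 18, 2, 0, 3, 1, 0, 3]],
   ![[1, 11, 3, 0, 2, 3], [0, 1, 0, 3, 1, 3, 2], [2, 8, 6, 1, 3, 1]],
   ![[0, 1, 3, 2, 3], [0, 1, 3, 4, 3, 1, 3, 2], [14, 1, 4, 1, 3, 1]],
   ![[13, 5, 2, 0, 3, 1], [6, 11, 3, 0, 2, 3], [0, 6, 0, 3, 1, 3, 2]],
   ![[2, 2, 3, 1], [3, 2, 3, 10, 2, 3, 2, 3], [0, 13, 0, 6, 0, 3, 2, 0]],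
   ![[4, 4, 2, 3, 2, 0], [3, 8, 2, 3, 2, 3], [1, 4, 2, 2, 3, 1]],
   ![[2, 0, 1, 3, 1], [8, 5, 2, 3, 1, 3, 2], [5, 0, 3, 2, 12, 3, 2, 3]],
   ![[10, 2, 0, 3, 1], [5, 2, 0, 3, 1, 3, 2], [1, 0, 3, 1, 11, 3, 2, 0]],
   ![[0, 1, 3, 2, 0], [3, 0, 7, 4, 2, 3, 1], [6, 1, 4, 1, 3, 2, 3]],
   ![[2, 2, 3, 2, 0], [2, 3, 1, 11, 3, 2, 0, 1, 3], [0, 5, 0, 5, 0, 3, 1]],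
   ![[10, 3, 4, 3, 1], [0, 2, 0, 3, 1, 3, 2], [1, 8, 6, 1, 3, 2, 3]],
   ![[2, 3, 4, 3, 1], [0, 6, 0, 3, 2, 3], [1, 4, 2, 2, 3, 1, 3, 0]],
   ![[1, 3, 4, 3, 1], [6, 1, 4, 2, 3, 2, 3], [0, 5, 0, 3, 1, 3, 2]],
   ![[1, 0, 2, 3, 2, 0], [10, 4, 1, 3, 1], [2, 0, 3, 2, 3, 9, 3, 2, 3]],
   ![[0, 5, 0, 3, 1], [1, 3, 4, 3, 2, 3], [2, 4, 1, 1, 3, 2, 0]],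
   ![[5, 5, 0, 3, 1], [5, 2, 0, 3, 2, 3], [2, 0, 3, 2, 3, 9, 3, 2, 0]],
   ![[3, 8, 1, 3, 1], [0, 1, 0, 3, 2, 3], [2, 8, 5, 2, 3, 1, 3, 2]]],
  [![[0, 2, 3, 1, 3], [2, 8, 6, 1, 3, 2], [0, 2, 3, 4, 3, 2, 3, 1]],
   ![[2, 4, 2, 3, 2], [5, 2, 0, 3, 1, 3], [1, 0, 3, 1, 3, 5, 3, 1, 0]],
   ![[0, 2, 3, 1, 0], [5, 2, 4, 2, 3, 1, 3], [3, 0, 7, 4, 1, 3, 2]],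
   ![[2, 0, 1, 3, 1, 0], [9, 4, 2, 3, 2], [1, 0, 3, 2, 3, 13, 3, 1, 3]],
   ![[1, 3, 4, 3, 1, 3], [0, 5, 0, 3, 2, 3, 1], [6, 1, 4, 2, 3, 2]],
   ![[8, 0, 2, 3, 1, 3], [6, 1, 4, 1, 3, 2], [2, 3, 4, 3, 2, 3, 1]],
   ![[1, 8, 6, 1, 3, 2], [0, 2, 0, 3, 2, 3, 1], [3, 8, 2, 3, 1, 3]],
   ![[2, 2, 3, 2, 0, 3], [2, 3, 1, 3, 10, 3, 1, 0], [0, 13, 0, 6, 0, 3, 2]],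
   ![[8, 0, 2, 3, 2], [2, 3, 4, 3, 1, 3], [1, 4, 2, 2, 3, 1, 0]],
   ![[9, 1, 0, 3, 2], [5, 2, 0, 3, 2, 3, 1], [3, 1, 20, 4, 2, 3, 1, 3]],
   ![[1, 0, 2, 3, 2], [10, 4, 1, 3, 2, 3, 1], [4, 2, 3, 1, 12, 3, 1, 3]],
   ![[14, 1, 4, 1, 3, 1, 3], [0, 1, 3, 2], [3, 0, 7, 4, 2, 3, 1, 0]],
   ![[1, 1, 3, 2], [3, 1, 3, 9, 1, 3, 1, 3], [0, 5, 0, 5, 0, 3, 1, 0]],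
   ![[2, 3, 4, 3, 2], [0, 6, 0, 3, 2, 3, 1], [6, 1, 4, 1, 3, 1, 3]],
   ![[0, 2, 0, 3, 1, 3], [3, 8, 2, 3, 2], [1, 8, 5, 2, 3, 2, 3, 1]],
   ![[3, 8, 1, 3, 2], [0, 1, 0, 3, 2, 3, 1], [2, 8, 5, 2, 3, 1, 3]],
   ![[6, 1, 0, 3, 2], [1, 4, 1, 3, 1, 3], [2, 0, 3, 2, 3, 6, 3, 2, 3, 0]],
   ![[0, 2, 3, 2], [0, 2, 3, 4, 3, 1, 3], [2, 8, 6, 1, 3, 2, 3, 1]],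
   ![[2, 0, 1, 3, 2], [10, 4, 1, 3, 1, 3], [3, 2, 3, 21, 5, 0, 3, 1, 0]],
   ![[1, 3, 4, 3, 2], [4, 4, 1, 3, 1, 3], [2, 4, 1, 1, 3, 2, 3, 0]]],
  [![[1, 0, 2, 3], [1, 4, 5, 2, 3, 0], [3, 2, 3, 6, 3, 4, 3, 1, 3, 1]],
   ![[1, 0, 2, 3], [3, 1, 3, 17, 4, 2, 3, 0], [9, 4, 2, 3, 2, 3, 2]],
   ![[0, 2, 3], [3, 0, 3, 5, 0, 3, 0], [2, 8, 6, 1, 3, 2, 3, 2]],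
   ![[2, 0, 1, 3], [9, 4, 2, 3, 0], [3, 2, 19, 1, 0, 3, 1, 0, 2, 3, 1]],
   ![[2, 8, 5, 2, 3], [3, 8, 1, 3, 2, 3, 2], [0, 1, 0, 3, 1, 3, 1]],
   ![[14, 9, 1, 0, 3], [0, 1, 3, 2, 3, 2], [0, 1, 3, 4, 3, 1, 3, 1]],
   ![[2, 0, 1, 3], [2, 4, 6, 1, 3, 0], [3, 1, 3, 5, 3, 4, 3, 2, 3, 2]],
   ![[2, 2, 3], [0, 13, 0, 6, 0, 3, 0], [3, 1, 3, 21, 2, 3, 2, 3, 2]],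
   ![[1, 4, 2, 2, 3], [4, 4, 2, 3, 0], [10, 3, 4, 3, 2, 3, 2]],
   ![[2, 0, 1, 3], [10, 4, 1, 3, 1, 3, 1], [5, 0, 3, 16, 3, 2, 3, 2]],
   ![[6, 6, 0, 3], [5, 2, 0, 3, 1, 3, 1], [1, 0, 3, 1, 3, 5, 3, 0]],
   ![[8, 0, 2, 3], [1, 4, 2, 2, 3, 0], [2, 3, 4, 3, 1, 3, 1]],
   ![[0, 9, 8, 0, 1, 3], [2, 2, 3, 0], [3, 2, 15, 2, 3, 1, 0, 2, 3, 1]],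
   ![[3, 8, 2, 3], [0, 2, 0, 3, 1, 3, 1], [1, 8, 6, 1, 3, 2, 3, 2]],
   ![[2, 3, 4, 3], [8, 0, 2, 3, 2, 3, 2], [6, 1, 4, 1, 3, 1, 3, 1]],
   ![[1, 3, 4, 3], [0, 5, 0, 3, 1, 3, 1], [5, 2, 4, 2, 3, 2, 3, 2]],
   ![[9, 4, 2, 3], [2, 0, 1, 3, 0], [3, 1, 3, 22, 1, 0, 3, 2, 3, 2]],
   ![[8, 0, 1, 3], [1, 3, 4, 3, 2, 3, 2], [2, 4, 1, 1, 3, 0]],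
   ![[9, 1, 0, 3], [5, 2, 0, 3, 2, 3, 2], [6, 0, 3, 1, 3, 9, 3, 0]],
   ![[1, 11, 3, 0], [0, 1, 0, 3, 2, 3, 2], [2, 8, 5, 2, 3, 1, 3, 1]]]]

set_option maxRecDepth 100000 in
theorem exists_certificate : ∀ j, ∀ L ∈ (clusterWords j).sublistsLen 3, ∃ c ∈ certificates j,
    IsCertificate shuffle [0, 1, 2, 3] L c := by
  decide

set_option maxRecDepth 100000 in
theorem word_mem_clusterWords : ∀ (j : Fin 3) (u : Perm (Fin 4)), u 3 = j.castSucc →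
    word u ∈ clusterWords j := by
  decide

end Four

/-- The first three positions. -/
def godanFrame (n : ℕ) (hn : 3 ≤ n) : Frame (Fin n) where
  p₀ := ⟨0, by omega⟩
  p₁ := ⟨1, by omega⟩
  p₂ := ⟨2, by omega⟩
  h₀₁ := by simp
  h₀₂ := by simp
  h₁₂ := by simp

theorem godanFrame_out {n : ℕ} {hn : 3 ≤ n} {k : Fin n} :
    (godanFrame n hn).Out k ↔ 3 ≤ (k : ℕ) := by
  simp only [Frame.Out, godanFrame, ne_eq, Fin.ext_iff]
  omega

theorem godanGraph_eq {n : ℕ} (hn : 3 ≤ n) : godanGraph n hn = (godanFrame n hn).graph := by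
  have hinv : perm132 n hn = (perm123 n hn)⁻¹ := by simp [perm132, perm123, mul_inv_rev]
  have key : ∀ u v : Perm (Fin n), (∃ s ∈ OmegaStar n hn, v = u * s) ↔
      (godanFrame n hn).graph.Adj u v := by
    intro u v
    constructor
    · rintro ⟨s, (rfl | rfl | rfl) | ⟨k, hk, rfl⟩, rfl⟩
      · exact Frame.adj_t u
      · exact Frame.adj_ρ u
      · rw [hinv]
        exact Frame.adj_ρ_inv u
      · exact Frame.adj_g u (godanFrame_out.2 hk)
    · rintro (h | h | h | ⟨k, hk, h⟩)
      · exact ⟨_, Or.inl (Or.inl rfl), h⟩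
      · exact ⟨_, Or.inl (Or.inr (Or.inl rfl)), h⟩
      · exact ⟨_, Or.inl (Or.inr (Or.inr rfl)), by rw [hinv]; exact eq_mul_inv_of_mul_eq h.symm⟩
      · exact ⟨_, Or.inr ⟨k, godanFrame_out.1 hk, rfl⟩, h⟩
  ext u v
  rw [godanGraph, SimpleGraph.fromRel_adj]
  constructor
  · rintro ⟨-, h | h⟩
    · exact ((key v u).1 h).symm
    · exact (key u v).1 h
  · exact fun h => ⟨h.ne, Or.inr ((key u v).2 h)⟩

/-- The neighbours of a permutation of four symbols. -/
def neighbor (k : ℕ) (u : Perm (Fin 4)) : Perm (Fin 4) :=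
  let P := godanFrame 4 (by omega)
  match k with
  | 0 => u * P.t
  | 1 => u * P.ρ
  | 2 => u * P.ρ⁻¹
  | _ => u * P.g 3

theorem adj_neighbor (k : ℕ) (u : Perm (Fin 4)) :
    (godanFrame 4 (by omega)).graph.Adj u (neighbor k u) := by
  match k with
  | 0 => exact Frame.adj_t u
  | 1 => exact Frame.adj_ρ u
  | 2 => exact Frame.adj_ρ_inv u
  | _ + 3 => exact Frame.adj_g u (godanFrame_out.2 le_rfl)

theorem word_injective : Function.Injective word := by
  intro u v h
  simp only [word, List.cons.injEq, and_true] at h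
  ext q
  fin_cases q <;> simp [h]

theorem word_mul_neighbor (v : Perm (Fin 4)) (k : ℕ) (u : Perm (Fin 4)) :
    word (v * neighbor k u) = shuffle k (word (v * u)) := by
  match k with
  | 0 => rfl
  | 1 => rfl
  | 2 => rfl
  | _ + 3 => rfl

theorem exists_isIDSTFamily_four {x y z w : Perm (Fin 4)} {i : Fin 4} (hx : x 3 = i)
    (hy : y 3 = i) (hz : z 3 = i) (hxy : x ≠ y) (hxz : x ≠ z) (hyz : y ≠ z) (hw : w 3 ≠ i) :
    ∃ T : Fin 3 → (godanFrame 4 (by omega)).graph.Subgraph,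
      IsIDSTFamily (godanFrame 4 (by omega)).graph {w, x, y, z} T := by
  let φ : Perm (Fin 4) → List (Fin 4) := fun u => word (w⁻¹ * u)
  have hφ : Function.Injective φ := word_injective.comp (mul_right_injective _)
  obtain ⟨j, hj⟩ : ∃ j : Fin 3, w⁻¹ i = j.castSucc := by
    have : w⁻¹ i ≠ Fin.last 3 := fun h => hw (Perm.inv_eq_iff_eq.1 h).symm
    exact ⟨_, (Fin.castSucc_castPred _ this).symm⟩
  have hmem : ∀ u ∈ ({x, y, z} : Set (Perm (Fin 4))), φ u ∈ clusterWords j := by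
    rintro u (rfl | rfl | rfl) <;> refine word_mem_clusterWords j _ ?_ <;>
      rw [Perm.mul_apply] <;> simp only [*]
  let L := (clusterWords j).filter (· ∈ ({φ x, φ y, φ z} : Finset (List (Fin 4))))
  have hL : ∀ u, u ∈ ({x, y, z} : Set (Perm (Fin 4))) ↔ φ u ∈ L := by
    intro u
    simp only [L, List.mem_filter, Finset.mem_insert, Finset.mem_singleton, hφ.eq_iff,
      decide_eq_true_eq]
    exact ⟨fun h => ⟨hmem u h, h⟩, fun h => h.2⟩
  have hnd : ∀ j, (clusterWords j).Nodup := by decide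
  have hlen : L.length = 3 := by
    rw [← List.toFinset_card_of_nodup ((hnd j).filter _)]
    have hL' : L.toFinset = {φ x, φ y, φ z} := by
      ext l
      simp only [L, List.mem_toFinset, List.mem_filter, decide_eq_true_eq, and_iff_right_iff_imp,
        Finset.mem_insert, Finset.mem_singleton]
      rintro (rfl | rfl | rfl) <;> exact hmem _ (by simp)
    rw [hL', Finset.card_eq_three]
    exact ⟨_, _, _, hφ.ne hxy, hφ.ne hxz, hφ.ne hyz, rfl⟩
  obtain ⟨c, -, hc⟩ := exists_certificate j L (List.mem_sublistsLen.2 ⟨List.filter_sublist, hlen⟩)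
  refine IsCertificate.exists_isIDSTFamily (a := neighbor) (w := w) hφ
    (word_mul_neighbor w⁻¹) adj_neighbor hL (c := c) ?_
  simpa [φ, word] using hc

/-- Let n ≥ 4, 4 ≤ m ≤ n, and let S be a set of four distinct vertices of EA_n
such that exactly three vertices of S have m-th symbol equal to i (symbols and
positions are 0-based: position m has index m − 1, symbol i is `i : Fin n`).
Then there exist n − 1 pairwise internally edge disjoint S-trees in EA_n. -/
theorem IDSTs_three_in_one_cluster (n m : ℕ) (hn : 4 ≤ n) (hm4 : 4 ≤ m)
    (hmn : m ≤ n) (S : Finset (Equiv.Perm (Fin n))) (hS : S.card = 4) (i : Fin n)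
    (h3 : (S.filter (fun σ => σ (⟨m - 1, by omega⟩ : Fin n) = i)).card = 3) :
    ∃ T : Fin (n - 1) → (godanGraph n (by omega)).Subgraph,
      IsIDSTFamily (godanGraph n (by omega)) (↑S : Set (Equiv.Perm (Fin n))) T := by
  rw [godanGraph_eq]
  set q : Fin n := ⟨m - 1, by omega⟩ with hq
  obtain ⟨x, y, z, hxy, hxz, hyz, hxyz⟩ := Finset.card_eq_three.1 h3
  have hmem : ∀ u, u ∈ S ∧ u q = i ↔ u = x ∨ u = y ∨ u = z := fun u => by
    simpa only [Finset.mem_filter, Finset.mem_insert, Finset.mem_singleton] using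
      Finset.ext_iff.1 hxyz u
  obtain ⟨w, hw⟩ : ∃ w, S.filter (fun σ => ¬ σ q = i) = {w} := by
    rw [← Finset.card_eq_one]
    have := Finset.card_filter_add_card_filter_not (s := S) (fun σ => σ q = i)
    omega
  have hw' : ∀ u, u ∈ S ∧ u q ≠ i ↔ u = w := fun u => by
    simpa only [Finset.mem_filter, Finset.mem_singleton] using Finset.ext_iff.1 hw u
  have hSw : (S : Set (Perm (Fin n))) = {w, x, y, z} := by
    ext u
    have h1 := hmem u
    have h2 := hw' u
    simp only [Finset.mem_coe, Set.mem_insert_iff, Set.mem_singleton_iff]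
    tauto
  have hx := ((hmem x).2 (by simp)).2
  have hy := ((hmem y).2 (by simp)).2
  have hz := ((hmem z).2 (by simp)).2
  have hwq := ((hw' w).2 rfl).2
  rw [hSw]
  rcases hn.eq_or_lt with rfl | hn5
  · have hq3 : q = 3 := by
      rw [hq, Fin.ext_iff]
      change m - 1 = 3
      omega
    rw [hq3] at hx hy hz hwq
    exact exists_isIDSTFamily_four hx hy hz hxy hxz hyz hwq
  · have := Frame.exists_isIDSTFamily (P := godanFrame n (by omega)) (by rwa [Fintype.card_fin])
      (godanFrame_out.2 (show 3 ≤ m - 1 by omega)) hx hy hz hxy hxz hyz hwq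
    rwa [Fintype.card_fin] at this

end Godan
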